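/- Let g ≥ 2 be an integer. If integers k ≥ 1, digits 1 ≤ d₁, d₂, d₃, d₄ ≤ g − 1 and exponents 1 ≤ ℓ ≤ m ≤ n ≤ t with t ≥ 2 satisfy N_k = d₁(gˡ−1)/(g−1) · d₂(gᵐ−1)/(g−1) · d₃(gⁿ−1)/(g−1) · d₄(gᵗ−1)/(g−1), then n < 9.72·10⁴² · (log t)³ · (log g)⁶. -/

import Mathlib

/-- The Narayana sequence: N₀ = 0, N₁ = N₂ = 1, Nₙ = Nₙ₋₁ + Nₙ₋₃. -/
def narayana : ℕ → ℕ
  | 0 => 0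
  | 1 => 1
  | 2 => 1
  | n + 3 => narayana (n + 2) + narayana n


section
theorem rolle_mult : ∀ (N : ℕ) (F : ℕ → ℝ → ℝ)
    (_ : ∀ j x, HasDerivAt (F j) (F (j+1) x) x) (x : ℕ → ℝ) (_ : Monotone x)
    (_ : ∀ i j, i + j ≤ N → x i = x (i+j) → F j (x i) = 0),
    ∃ ξ, x 0 ≤ ξ ∧ ξ ≤ x N ∧ F N ξ = 0 := by
  intro N
  induction N with
  | zero =>
    intro F hF x hx h
    exact ⟨x 0, le_rfl, le_rfl, h 0 0 le_rfl rfl⟩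
  | succ N ih =>
    intro F hF x hx h
    have key : ∀ i, ∃ y, x i ≤ y ∧ y ≤ x (i+1) ∧
        (i ≤ N → F 1 y = 0) ∧ (y = x i → x i = x (i+1)) ∧ (y = x (i+1) → x i = x (i+1)) := by
      intro i
      by_cases he : x i = x (i+1)
      · refine ⟨x i, le_rfl, hx (Nat.le_succ i), fun hi => h i 1 (by omega) he, fun _ => he,
          fun _ => he⟩
      · have hlt : x i < x (i+1) := lt_of_le_of_ne (hx (Nat.le_succ i)) he
        by_cases hi : i ≤ N
        · have h0 : F 0 (x i) = F 0 (x (i+1)) := by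
            rw [h i 0 (by omega) rfl, h (i+1) 0 (by omega) rfl]
          obtain ⟨c, hc, hc'⟩ := exists_hasDerivAt_eq_zero hlt
            (fun z _ => (hF 0 z).continuousAt.continuousWithinAt) h0 (fun z _ => hF 0 z)
          refine ⟨c, hc.1.le, hc.2.le, fun _ => hc', fun e => absurd e hc.1.ne',
            fun e => absurd e hc.2.ne⟩
        · refine ⟨(x i + x (i+1))/2, by linarith, by linarith, fun h' => absurd h' hi, ?_, ?_⟩
          · intro e; linarith
          · intro e; linarith
    choose y hy1 hy2 hy3 hy4 hy5 using key
    have hym : Monotone y := monotone_nat_of_le_succ fun i => (hy2 i).trans (hy1 (i+1))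
    obtain ⟨ξ, h1, h2, h3⟩ := ih (fun j => F (j+1)) (fun j z => hF (j+1) z) y hym (by
      intro i j hij he
      rcases Nat.eq_zero_or_pos j with rfl | hj
      · exact hy3 i (by omega)
      · have e1 : x (i+1) ≤ x (i+j) := hx (by omega)
        have a1 := hy2 i
        have a2 := hy1 (i+j)
        have e2 : y i = x (i+1) := by linarith
        have e3 : y (i+j) = x (i+j) := by linarith
        have e4 := hy5 i e2
        have e5 := hy4 (i+j) e3
        have e6 : x i = x (i+(j+1)) := by
          rw [← add_assoc, ← e5, ← e3, ← he, e2, e4]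
        have := h i (j+1) (by omega) e6
        rw [e2, ← e4]; exact this)
    exact ⟨ξ, (hy1 0).trans h1, h2.trans (hy2 N), h3⟩

open Polynomial in
theorem inv_series (d : ℝ) (hd : 0 < d) (s : Multiset ℝ) (hs : ∀ c ∈ s, d ≤ |c|) :
    ∃ B : PowerSeries ℝ, ((s.map (fun c => X + C c)).prod : ℝ[X]) * B = 1 ∧
      ∀ k, |PowerSeries.coeff k B| ≤ |s.prod|⁻¹ * (Nat.choose (s.card + k) k) * (d⁻¹)^k := by
  induction s using Multiset.induction_on with
  | empty =>
    refine ⟨1, by simp, ?_⟩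
    intro k
    rcases Nat.eq_zero_or_pos k with rfl | hk
    · simp
    · rw [PowerSeries.coeff_one, if_neg hk.ne']
      simp only [abs_zero]; positivity
  | cons c s ih =>
    obtain ⟨B, hB, hb⟩ := ih (fun c hc => hs c (Multiset.mem_cons_of_mem hc))
    have hc := hs c (Multiset.mem_cons_self c s)
    have hc0 : c ≠ 0 := by rintro rfl; simp at hc; linarith
    set E : PowerSeries ℝ := PowerSeries.mk (fun k => c⁻¹ * (-c⁻¹)^k) with hE
    have hE1 : ((X + C c : ℝ[X]) : PowerSeries ℝ) * E = 1 := by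
      ext k
      rw [Polynomial.coe_add, Polynomial.coe_X, Polynomial.coe_C, add_mul, map_add]
      rcases k with _ | k
      · simp [hE, hc0]
      · rw [PowerSeries.coeff_succ_X_mul, PowerSeries.coeff_C_mul]
        simp only [hE, PowerSeries.coeff_mk, PowerSeries.coeff_one]
        rw [pow_succ]; field_simp; simp
    refine ⟨E * B, ?_, ?_⟩
    · rw [Multiset.map_cons, Multiset.prod_cons, Polynomial.coe_mul,
        mul_mul_mul_comm, hE1, hB, one_mul]
    · intro k
      rw [PowerSeries.coeff_mul, Multiset.prod_cons, Multiset.card_cons]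
      refine (Finset.abs_sum_le_sum_abs _ _).trans ?_
      have hcd : |c|⁻¹ ≤ d⁻¹ := inv_anti₀ hd hc
      have : ∀ x ∈ Finset.HasAntidiagonal.antidiagonal k,
          |PowerSeries.coeff x.1 E * PowerSeries.coeff x.2 B| ≤
          |c * s.prod|⁻¹ * (d⁻¹)^k * (Nat.choose (s.card + x.2) s.card) := by
        intro x hx
        rw [Finset.HasAntidiagonal.mem_antidiagonal] at hx
        rw [abs_mul, abs_mul, hE, PowerSeries.coeff_mk, abs_mul, abs_pow, abs_neg, abs_inv]
        have h2 : (|c|⁻¹)^x.1 ≤ (d⁻¹)^x.1 := pow_le_pow_left₀ (by positivity) hcd _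
        have h3 := hb x.2
        rw [← hx, pow_add, mul_inv]
        rw [show (Nat.choose (s.card + x.2) s.card) = Nat.choose (s.card + x.2) x.2 from
          Nat.choose_symm_add]
        calc _ ≤ |c|⁻¹ * (d⁻¹)^x.1 * (|s.prod|⁻¹ * (Nat.choose (s.card + x.2) x.2) * (d⁻¹)^x.2) := by
              gcongr
          _ = _ := by ring
      refine (Finset.sum_le_sum this).trans ?_
      rw [← Finset.mul_sum]
      have hh : (∑ x ∈ Finset.HasAntidiagonal.antidiagonal k, ((Nat.choose (s.card + x.2) s.card : ℕ) : ℝ))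
          = (Nat.choose (s.card + 1 + k) k : ℕ) := by
        rw [← Nat.cast_sum]
        congr 1
        rw [Finset.Nat.sum_antidiagonal_eq_sum_range_succ_mk]
        rw [← Finset.sum_range_reflect]
        have := Nat.sum_range_add_choose k s.card
        rw [show (s.card + 1 + k).choose k = (k + s.card + 1).choose (s.card + 1) by
          rw [← Nat.choose_symm_add]; congr 1; omega]
        rw [← this]
        apply Finset.sum_congr rfl
        intro i hi
        rw [Finset.mem_range] at hi
        congr 1; omega
      rw [hh]
      apply le_of_eq; ring

end

section
theorem prod_dist_up (b : ℕ) : ∀ n, b ≤ n →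
    ∏ j ∈ Finset.range n, (|(j:ℝ) - b| + 1) = (b+1).factorial * (n-b).factorial := by
  intro n hn
  induction n, hn using Nat.le_induction with
  | base =>
    simp only [Nat.sub_self, Nat.factorial_zero, Nat.cast_one, mul_one]
    rw [← Finset.prod_range_reflect, ← Finset.prod_range_add_one_eq_factorial,
      Finset.prod_range_succ']
    push_cast
    simp only [zero_add, mul_one]
    apply Finset.prod_congr rfl
    intro j hj
    rw [Finset.mem_range] at hj
    rw [show b - 1 - j = b - (j+1) by omega, Nat.cast_sub (by omega)]
    push_cast
    rw [show (b:ℝ) - (j+1) - b = -(j+1) by ring, abs_neg, abs_of_nonneg (by positivity)]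
  | succ n hn ih =>
    rw [Finset.prod_range_succ, ih, Nat.succ_sub hn, Nat.factorial_succ (n-b)]
    have : (b:ℝ) ≤ n := by exact_mod_cast hn
    rw [abs_of_nonneg (by linarith)]
    push_cast [Nat.cast_sub hn]
    ring

theorem prod_dist_up_le (b n : ℕ) (h : b ≤ n) :
    ∏ j ∈ Finset.range n, (|(j:ℝ) - b| + 1) ≤ (n+1).factorial := by
  rw [prod_dist_up b n h]
  have := Nat.le_of_dvd (Nat.factorial_pos _) (Nat.factorial_mul_factorial_dvd_factorial_add (b+1) (n-b))
  rw [show b + 1 + (n-b) = n+1 by omega] at this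
  exact_mod_cast this

theorem prod_dist_erase (i : ℕ) : ∀ n, i + 1 ≤ n →
    ∏ j ∈ (Finset.range n).erase i, |(i:ℝ) - j| = i.factorial * (n-1-i).factorial := by
  intro n hn
  induction n, hn using Nat.le_induction with
  | base =>
    rw [Finset.range_add_one, Finset.erase_insert Finset.notMem_range_self]
    simp only [Nat.add_sub_cancel, Nat.sub_self, Nat.factorial_zero, Nat.cast_one, mul_one]
    rw [← Finset.prod_range_reflect, ← Finset.prod_range_add_one_eq_factorial]
    push_cast
    apply Finset.prod_congr rfl
    intro j hj
    rw [Finset.mem_range] at hj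
    rw [show i - 1 - j = i - (j+1) by omega, Nat.cast_sub (by omega)]
    push_cast
    rw [show (i:ℝ) - (i - (j+1)) = (j+1) by ring, abs_of_nonneg (by positivity)]
  | succ n hn ih =>
    have e : (Finset.range (n+1)).erase i = insert n ((Finset.range n).erase i) := by
      rw [Finset.range_add_one, Finset.erase_insert_of_ne (by omega)]
    rw [e, Finset.prod_insert (by simp), ih]
    obtain ⟨t, rfl⟩ := Nat.exists_eq_add_of_le hn
    rw [show i + 1 + t + 1 - 1 - i = t + 1 by omega, show i + 1 + t - 1 - i = t by omega,
      Nat.factorial_succ]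
    push_cast
    rw [show (i:ℝ) - (i+1+t) = -(t+1) by ring, abs_neg, abs_of_nonneg (by positivity)]
    ring

theorem prod_dist_erase_ge (i n : ℕ) (h : i < n) :
    ((n-1).factorial : ℝ) ≤ 2^n * ∏ j ∈ (Finset.range n).erase i, |(i:ℝ) - j| := by
  rw [prod_dist_erase i n h]
  have h1 : (n-1).choose i * i.factorial * (n-1-i).factorial = (n-1).factorial :=
    Nat.choose_mul_factorial_mul_factorial (by omega)
  have h2 : (n-1).choose i ≤ 2^n := (Nat.choose_le_two_pow _ _).trans
    (Nat.pow_le_pow_right (by norm_num) (by omega))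
  have h3 : (n-1).factorial ≤ 2^n * (i.factorial * (n-1-i).factorial) := by
    rw [← h1, mul_assoc]; exact Nat.mul_le_mul_right _ h2
  exact_mod_cast h3

theorem node_dist (d z0 : ℝ) (hd : 0 < d) (n : ℕ) (h0 : 0 ≤ z0) (h1 : z0 ≤ n * d) :
    ∃ b : ℕ, b ≤ n ∧ ∀ j : ℕ, |z0 - (j + 1/2) * d| ≤ d * (|(j:ℝ) - b| + 1) := by
  refine ⟨⌊z0/d⌋₊, ?_, ?_⟩
  · have : z0 / d ≤ n := by rw [div_le_iff₀ hd]; exact h1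
    exact Nat.floor_le_of_le this
  · intro j
    have a1 := Nat.floor_le (div_nonneg h0 hd.le)
    have a2 := Nat.lt_floor_add_one (z0/d)
    set b := ⌊z0/d⌋₊
    have : z0 - (j+1/2)*d = d * (z0/d - j - 1/2) := by field_simp; ring
    rw [this, abs_mul, abs_of_pos hd]
    apply mul_le_mul_of_nonneg_left _ hd.le
    rw [show z0/d - j - 1/2 = (b - j) + (z0/d - b - 1/2) by ring]
    refine (abs_add_le _ _).trans ?_
    rw [abs_sub_comm (b:ℝ)]
    gcongr
    rw [abs_le]; constructor <;> linarith

theorem prod_nodes_le (d z0 : ℝ) (hd : 0 < d) (n : ℕ) (h0 : 0 ≤ z0) (h1 : z0 ≤ n * d) :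
    ∏ j ∈ Finset.range n, |z0 - (j + 1/2) * d| ≤ d^n * (n+1).factorial := by
  obtain ⟨b, hb, h⟩ := node_dist d z0 hd n h0 h1
  calc _ ≤ ∏ j ∈ Finset.range n, (d * (|(j:ℝ) - b| + 1)) :=
        Finset.prod_le_prod (fun _ _ => abs_nonneg _) (fun j _ => h j)
    _ = d^n * ∏ j ∈ Finset.range n, (|(j:ℝ) - b| + 1) := by
        rw [Finset.prod_mul_distrib]; simp
    _ ≤ _ := by gcongr; exact prod_dist_up_le b n hb

theorem prod_nodes_erase_le (d z0 : ℝ) (hd : 0 < d) (n i : ℕ) (hi : i < n) (h0 : 0 ≤ z0)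
    (h1 : z0 ≤ n * d) :
    ∏ j ∈ (Finset.range n).erase i, |z0 - (j + 1/2) * d| ≤ d^(n-1) * (n+1).factorial := by
  obtain ⟨b, hb, h⟩ := node_dist d z0 hd n h0 h1
  calc _ ≤ ∏ j ∈ (Finset.range n).erase i, (d * (|(j:ℝ) - b| + 1)) :=
        Finset.prod_le_prod (fun _ _ => abs_nonneg _) (fun j _ => h j)
    _ = d^(n-1) * ∏ j ∈ (Finset.range n).erase i, (|(j:ℝ) - b| + 1) := by
        rw [Finset.prod_mul_distrib]; simp [hi]
    _ ≤ d^(n-1) * ∏ j ∈ Finset.range n, (|(j:ℝ) - b| + 1) := by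
        gcongr
        · intro j _ _; linarith [abs_nonneg ((j:ℝ) - b)]
        · exact Finset.erase_subset _ _
    _ ≤ _ := by gcongr; exact prod_dist_up_le b n hb

theorem node_ratio (d z0 : ℝ) (hd : 0 < d) (n i : ℕ) (hi : i < n) (h0 : 0 ≤ z0)
    (h1 : z0 ≤ n * d) :
    ∏ j ∈ (Finset.range n).erase i, |z0 - (j + 1/2) * d| ≤
     (2^n * (n * (n+1))) * ∏ j ∈ (Finset.range n).erase i, |(i + 1/2) * d - (j + 1/2) * d| := by
  have e : ∏ j ∈ (Finset.range n).erase i, |((i:ℝ) + 1/2) * d - (j + 1/2) * d| =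
      d^(n-1) * ∏ j ∈ (Finset.range n).erase i, |(i:ℝ) - j| := by
    calc _ = ∏ j ∈ (Finset.range n).erase i, (d * |(i:ℝ) - j|) := by
          apply Finset.prod_congr rfl
          intro j _
          rw [show ((i:ℝ) + 1/2) * d - (j + 1/2) * d = d * (i - j) by ring, abs_mul, abs_of_pos hd]
      _ = _ := by rw [Finset.prod_mul_distrib]; simp [hi]
  rw [e]
  refine (prod_nodes_erase_le d z0 hd n i hi h0 h1).trans ?_
  have h2 := prod_dist_erase_ge i n hi
  obtain ⟨t, rfl⟩ : ∃ t, n = t + 1 := ⟨n-1, by omega⟩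
  have h3 : ((t+1+1).factorial : ℝ) = (t+1:ℕ) * ((t+1:ℕ)+1) * (t).factorial := by
    rw [Nat.factorial_succ, Nat.factorial_succ]; push_cast; ring
  simp only [Nat.add_sub_cancel] at *
  rw [h3]
  calc _ ≤ d ^ t * ((t+1:ℕ) * ((t+1:ℕ)+1) * (2 ^ (t+1) * ∏ j ∈ (Finset.range (t+1)).erase i, |(i:ℝ) - j|)) := by
        gcongr
    _ = _ := by ring

end

section
open Polynomial

theorem hermite_exists (n M : ℕ) (hM : 0 < M) (d : ℝ) (hd : 0 < d) (hd2 : d ≤ 2)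
    (c : ℕ → ℕ → ℝ) (δ : ℝ) (hδ : 0 ≤ δ) (hc : ∀ i < n, ∀ j < M, |c i j| ≤ δ)
    (z0 : ℝ) (h0 : 0 ≤ z0) (h1 : z0 ≤ n * d) (hn : 0 < n) :
    ∃ H : ℝ[X], H.degree < (n * M : ℕ) ∧
      (∀ i < n, ∀ j < M, (taylor (((i:ℝ) + 1/2) * d) H).coeff j = c i j) ∧
      |H.eval z0| ≤ δ * n * M * 4^(n*M) * (2 * n^2 * (n+1))^M := by
  set r : ℕ → ℝ := fun i => ((i:ℝ) + 1/2) * d with hr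
  have hrd : ∀ i j : ℕ, i ≠ j → d ≤ |r i - r j| := by
    intro i j hij
    rw [show r i - r j = d * ((i:ℤ) - (j:ℤ) : ℤ) by simp [hr]; ring, abs_mul, abs_of_pos hd]
    have : (1:ℤ) ≤ |(i:ℤ) - j| := Int.one_le_abs (by omega)
    have : (1:ℝ) ≤ |(((i:ℤ) - (j:ℤ) : ℤ) : ℝ)| := by exact_mod_cast this
    nlinarith
  -- local data at node i
  have loc : ∀ i < n, ∃ Q : ℝ[X], Q.degree < (n * M : ℕ) ∧
      (∀ j < M, (taylor (r i) Q).coeff j = c i j) ∧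
      (∀ i' < n, i' ≠ i → ∀ j < M, (taylor (r i') Q).coeff j = 0) ∧
      |Q.eval z0| ≤ δ * M * 4^(n*M) * (2 * n^2 * (n+1))^M := by
    intro i hi
    set W : ℝ[X] := ∏ j ∈ (Finset.range n).erase i, (X - C (r j))^M with hW
    set s : Multiset ℝ := M • (((Finset.range n).erase i).val.map (fun j => r i - r j)) with hs
    have hsc : s.card = M * (n-1) := by
      rw [hs, Multiset.card_nsmul, Multiset.card_map]
      simp [hi]
    obtain ⟨B, hB, hb⟩ := inv_series d hd s (by
      intro x hx
      rw [hs] at hx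
      have := Multiset.mem_of_mem_nsmul hx
      rw [Multiset.mem_map] at this
      obtain ⟨j, hj, rfl⟩ := this
      apply hrd
      have := (Finset.mem_erase.1 (show j ∈ (Finset.range n).erase i from hj)).1
      exact fun h => this h.symm)
    have hWt : taylor (r i) W = (s.map (fun c => X + C c)).prod := by
      rw [hs, Multiset.map_nsmul, Multiset.prod_nsmul, Multiset.map_map, hW]
      rw [show taylor (r i) (∏ j ∈ (Finset.range n).erase i, (X - C (r j))^M) =
        ∏ j ∈ (Finset.range n).erase i, (taylor (r i) (X - C (r j)))^M by
          have := map_prod (taylorAlgHom (r i)) (fun j => (X - C (r j))^M) ((Finset.range n).erase i)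
          simp only [map_pow] at this
          exact this]
      rw [Finset.prod_pow]
      congr 1
      rw [Finset.prod]
      congr 1
      apply Multiset.map_congr rfl
      intro j _
      simp only [map_sub, taylor_X, taylor_C, Function.comp, C_sub]; ring
    set D : PowerSeries ℝ := PowerSeries.mk (c i) * B with hD
    set Tr : ℝ[X] := PowerSeries.trunc M D with hTr
    have hsprod : |s.prod| = (∏ j ∈ (Finset.range n).erase i, |r i - r j|)^M := by
      rw [hs, Multiset.prod_nsmul, abs_pow]
      congr 1
      rw [← Finset.abs_prod]; rfl
    have hsp0 : 0 < |s.prod| := by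
      rw [hsprod]
      apply pow_pos
      apply Finset.prod_pos
      intro j hj
      exact lt_of_lt_of_le hd (hrd _ _ (fun h => (Finset.mem_erase.1 hj).1 h.symm))
    refine ⟨W * taylor (-r i) Tr, ?_, ?_, ?_, ?_⟩
    · have hWd : W.degree = ((n-1) * M : ℕ) := by
        rw [hW, degree_prod]
        simp only [degree_pow, degree_X_sub_C]
        simp [hi]
      have hTd : (taylor (-r i) Tr).degree < M := by
        rw [degree_taylor]; exact PowerSeries.degree_trunc_lt _ _
      by_cases hz : taylor (-r i) Tr = 0
      · rw [hz, mul_zero, degree_zero]; exact WithBot.bot_lt_coe _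
      rw [degree_mul, hWd, degree_eq_natDegree hz]
      rw [degree_eq_natDegree hz] at hTd
      norm_cast at hTd ⊢
      obtain ⟨t, rfl⟩ : ∃ t, n = t + 1 := ⟨n-1, by omega⟩
      simp only [Nat.add_sub_cancel]
      nlinarith
    · intro j hj
      rw [taylor_mul, taylor_taylor, add_neg_cancel, taylor_zero, hWt]
      have e1 : PowerSeries.coeff j ((((s.map (fun c => X + C c)).prod : ℝ[X]) : PowerSeries ℝ) * D) = c i j := by
        rw [hD, mul_left_comm, hB, mul_one, PowerSeries.coeff_mk]
      rw [← e1, PowerSeries.coeff_mul, coeff_mul]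
      apply Finset.sum_congr rfl
      intro x hx
      rw [Finset.HasAntidiagonal.mem_antidiagonal] at hx
      rw [Polynomial.coeff_coe, hTr, PowerSeries.coeff_trunc, if_pos (by omega)]
    · intro i' hi' hne j hj
      have hdvd : X^M ∣ taylor (r i') (W * taylor (-r i) Tr) := by
        rw [taylor_mul]
        apply Dvd.dvd.mul_right
        have : (X - C (r i'))^M ∣ W :=
          Finset.dvd_prod_of_mem (fun j => (X - C (r j))^M)
            (Finset.mem_erase.2 ⟨hne, Finset.mem_range.2 hi'⟩)
        have h2 := map_dvd (taylorAlgHom (r i')) this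
        simpa using h2
      exact (X_pow_dvd_iff.1 hdvd) j hj
    · rw [eval_mul, abs_mul]
      have hcoef : ∀ k < M, |Tr.coeff k| ≤ δ * |s.prod|⁻¹ * 2^(n*M) * 2^M * (d⁻¹)^k := by
        intro k hk
        rw [hTr, PowerSeries.coeff_trunc, if_pos hk, hD, PowerSeries.coeff_mul]
        refine (Finset.abs_sum_le_sum_abs _ _).trans ?_
        have : ∀ x ∈ Finset.HasAntidiagonal.antidiagonal k,
          |PowerSeries.coeff x.1 (PowerSeries.mk (c i)) * PowerSeries.coeff x.2 B| ≤
          (δ * |s.prod|⁻¹ * 2^M * (d⁻¹)^k) * (Nat.choose (s.card + x.2) s.card) := by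
          intro x hx
          rw [Finset.HasAntidiagonal.mem_antidiagonal] at hx
          rw [abs_mul, PowerSeries.coeff_mk]
          have h2 := hc i hi x.1 (by omega)
          have h3 := hb x.2
          rw [show (Nat.choose (s.card + x.2) s.card) = Nat.choose (s.card + x.2) x.2 from
            Nat.choose_symm_add]
          have h4 : (d⁻¹)^x.2 ≤ 2^M * (d⁻¹)^k := by
            rw [← hx, pow_add, ← mul_assoc]
            apply le_mul_of_one_le_left (by positivity)
            have : (1:ℝ) ≤ 2^x.1 * (d⁻¹)^x.1 := by
              rw [← mul_pow]
              apply one_le_pow₀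
              rw [← div_eq_mul_inv, le_div_iff₀ hd]; linarith
            refine this.trans ?_
            gcongr
            · norm_num
            · omega
          calc _ ≤ δ * (|s.prod|⁻¹ * (Nat.choose (s.card + x.2) x.2) * (2^M * (d⁻¹)^k)) := by
                gcongr
                exact h3.trans (by gcongr)
            _ = _ := by ring
        refine (Finset.sum_le_sum this).trans ?_
        rw [← Finset.mul_sum]
        have hh : (∑ x ∈ Finset.HasAntidiagonal.antidiagonal k, ((Nat.choose (s.card + x.2) s.card : ℕ) : ℝ))
            ≤ 2^(n*M) := by
          rw [← Nat.cast_sum, Finset.Nat.sum_antidiagonal_eq_sum_range_succ_mk,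
            ← Finset.sum_range_reflect]
          have h5 := Nat.sum_range_add_choose k s.card
          have h6 : (k + s.card + 1).choose (s.card + 1) ≤ 2^(n*M) := by
            refine (Nat.choose_le_two_pow _ _).trans (Nat.pow_le_pow_right (by norm_num) ?_)
            rw [hsc]
            obtain ⟨t, rfl⟩ : ∃ t, n = t + 1 := ⟨n-1, by omega⟩
            simp only [Nat.add_sub_cancel]
            nlinarith
          rw [← h5] at h6
          refine le_trans (le_of_eq ?_) (by exact_mod_cast h6 :
            ((∑ i ∈ Finset.range (k + 1), (i + s.card).choose s.card : ℕ):ℝ) ≤ 2^(n*M))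
          congr 1
          apply Finset.sum_congr rfl
          intro a ha
          rw [Finset.mem_range] at ha
          congr 1; omega
        calc _ ≤ (δ * |s.prod|⁻¹ * 2^M * (d⁻¹)^k) * 2^(n*M) := by gcongr
          _ = _ := by ring
      have hz : |z0 - r i| ≤ n * d := by
        have a1 : r i ≤ n * d := by
          simp only [hr]; gcongr
          have : (i:ℝ) + 1 ≤ n := by exact_mod_cast hi
          linarith
        have a2 : 0 ≤ r i := by simp only [hr]; positivity
        rw [abs_le]; constructor <;> linarith
      have hTe : |(taylor (-r i) Tr).eval z0| ≤ M * (δ * |s.prod|⁻¹ * 2^(n*M) * 2^M * n^M) := by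
        rw [taylor_eval, ← sub_eq_add_neg, eval_eq_sum_range' (n := M)]
        · refine (Finset.abs_sum_le_sum_abs _ _).trans ?_
          have : ∀ k ∈ Finset.range M, |Tr.coeff k * (z0 - r i)^k| ≤
              δ * |s.prod|⁻¹ * 2^(n*M) * 2^M * n^M := by
            intro k hk
            rw [Finset.mem_range] at hk
            rw [abs_mul, abs_pow]
            have hnn : (1:ℝ) ≤ n := by exact_mod_cast hn
            calc _ ≤ (δ * |s.prod|⁻¹ * 2^(n*M) * 2^M * (d⁻¹)^k) * (n * d)^k := by
                  gcongr; exact hcoef k hk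
              _ = δ * |s.prod|⁻¹ * 2^(n*M) * 2^M * (n:ℝ)^k := by
                  rw [mul_pow, inv_pow]; field_simp
              _ ≤ _ := by gcongr
          refine (Finset.sum_le_sum this).trans ?_
          simp
        · by_cases hz0 : Tr = 0
          · rw [hz0]; simpa using hM
          · exact (natDegree_lt_iff_degree_lt hz0).2 (PowerSeries.degree_trunc_lt _ _)
      have hWe : |W.eval z0| ≤ (2^n * (n * (n+1)))^M * |s.prod| := by
        rw [hW, eval_prod, Finset.abs_prod, hsprod, ← mul_pow]
        simp only [eval_pow, eval_sub, eval_X, eval_C, abs_pow]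
        rw [Finset.prod_pow]
        apply pow_le_pow_left₀ (Finset.prod_nonneg (fun _ _ => abs_nonneg _))
        exact node_ratio d z0 hd n i hi h0 h1
      calc _ ≤ ((2^n * (n * (n+1)))^M * |s.prod|) * (M * (δ * |s.prod|⁻¹ * 2^(n*M) * 2^M * n^M)) := by
            gcongr
        _ = δ * M * (2^(n*M) * 2^(n*M)) * (2 * n^2 * (n+1))^M := by
            rw [pow_mul 2 n M]; field_simp; simp only [mul_pow]; ring
        _ = _ := by rw [← mul_pow]; norm_num
  choose! Q hQ1 hQ2 hQ3 hQ4 using loc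
  refine ⟨∑ i ∈ Finset.range n, Q i, ?_, ?_, ?_⟩
  · refine lt_of_le_of_lt (degree_sum_le _ _) ?_
    rw [Finset.sup_lt_iff (WithBot.bot_lt_coe _)]
    intro i hi
    exact hQ1 i (Finset.mem_range.1 hi)
  · intro i hi j hj
    rw [map_sum, finsetSum_coeff, Finset.sum_eq_single i]
    · exact hQ2 i hi j hj
    · intro b hb hbi
      exact hQ3 b (Finset.mem_range.1 hb) i hi (Ne.symm hbi) j hj
    · intro h; exact absurd (Finset.mem_range.2 hi) h
  · rw [eval_finsetSum]
    refine (Finset.abs_sum_le_sum_abs _ _).trans ?_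
    refine (Finset.sum_le_sum (fun i hi => hQ4 i (Finset.mem_range.1 hi))).trans ?_
    rw [Finset.sum_const, Finset.card_range, nsmul_eq_mul]
    apply le_of_eq; ring

end

section
open Polynomial

theorem interp_bound (n M : ℕ) (hn : 0 < n) (hM : 0 < M) (d : ℝ) (hd : 0 < d) (hd2 : d ≤ 2)
    (F : ℕ → ℝ → ℝ) (hF : ∀ j x, HasDerivAt (F j) (F (j+1) x) x)
    (δ A : ℝ) (hδ : 0 ≤ δ)
    (hc : ∀ i < n, ∀ j < M, |F j (((i:ℝ) + 1/2) * d)| ≤ j.factorial * δ)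
    (hA : ∀ ξ, 0 ≤ ξ → ξ ≤ n * d → |F (n*M) ξ| ≤ (n*M).factorial * A)
    (z0 : ℝ) (h0 : 0 ≤ z0) (h1 : z0 ≤ n * d) (hz : ∀ i : ℕ, z0 ≠ ((i:ℝ) + 1/2) * d) :
    |F 0 z0| ≤ δ * n * M * 4^(n*M) * (2 * n^2 * (n+1))^M + A * (d^n * (n+1).factorial)^M := by
  set r : ℕ → ℝ := fun i => ((i:ℝ) + 1/2) * d with hr
  have hrm : StrictMono r := by
    intro i j hij
    have : (i:ℝ) < j := by exact_mod_cast hij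
    simp only [hr]; nlinarith
  obtain ⟨H, hH1, hH2, hH3⟩ := hermite_exists n M hM d hd hd2 (fun i j => F j (r i) / j.factorial)
    δ hδ (by
      intro i hi j hj
      have := hc i hi j hj
      rw [abs_div, Nat.abs_cast, div_le_iff₀ (by positivity), mul_comm]
      exact this) z0 h0 h1 hn
  set W : ℝ[X] := ∏ j ∈ Finset.range n, (X - C (r j))^M with hW
  have hWm : W.Monic := monic_prod_of_monic _ _ (fun j _ => (monic_X_sub_C _).pow M)
  have hWd : W.natDegree = n * M := by
    rw [hW, natDegree_prod_of_monic _ _ (fun j _ => (monic_X_sub_C _).pow M)]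
    simp [natDegree_pow]
  have hWe : W.eval z0 ≠ 0 := by
    rw [hW, eval_prod, Finset.prod_ne_zero_iff]
    intro j _
    simp only [eval_pow, eval_sub, eval_X, eval_C]
    exact pow_ne_zero _ (sub_ne_zero.2 (hz j))
  have hWb : |W.eval z0| ≤ (d^n * (n+1).factorial)^M := by
    rw [hW, eval_prod, Finset.abs_prod]
    simp only [eval_pow, eval_sub, eval_X, eval_C, abs_pow]
    rw [Finset.prod_pow]
    exact pow_le_pow_left₀ (Finset.prod_nonneg (fun _ _ => abs_nonneg _))
      (prod_nodes_le d z0 hd n h0 h1) M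
  have hdt : ∀ (P : ℝ[X]) (j : ℕ) (a : ℝ), (derivative^[j] P).eval a =
      j.factorial * (taylor a P).coeff j := by
    intro P j a
    rw [taylor_coeff, ← factorial_smul_hasseDeriv]
    simp
  have hW0 : ∀ i < n, ∀ j < M, (derivative^[j] W).eval (r i) = 0 := by
    intro i hi j hj
    rw [hdt]
    have hdvd : X^M ∣ taylor (r i) W := by
      have : (X - C (r i))^M ∣ W :=
        Finset.dvd_prod_of_mem (fun j => (X - C (r j))^M) (Finset.mem_range.2 hi)
      have h2 := map_dvd (taylorAlgHom (r i)) this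
      simpa using h2
    rw [X_pow_dvd_iff.1 hdvd j hj, mul_zero]
  set C0 := (F 0 z0 - H.eval z0) / W.eval z0 with hC0
  set g : ℕ → ℝ → ℝ := fun j x => F j x - (derivative^[j] H).eval x - C0 * (derivative^[j] W).eval x
    with hg
  have hgd : ∀ j x, HasDerivAt (g j) (g (j+1) x) x := by
    intro j x
    simp only [hg, Function.iterate_succ_apply']
    exact ((hF j x).sub ((derivative^[j] H).hasDerivAt x)).sub
      (((derivative^[j] W).hasDerivAt x).const_mul C0)
  have hgn : ∀ i < n, ∀ j < M, g j (r i) = 0 := by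
    intro i hi j hj
    simp only [hg]
    rw [hW0 i hi j hj, hdt, hH2 i hi j hj]
    have : (j.factorial : ℝ) ≠ 0 := by positivity
    field_simp
    ring
  have hg0 : g 0 z0 = 0 := by
    simp only [hg, hC0, Function.iterate_zero, id]
    field_simp; ring
  set b := ⌈z0/d - 1/2⌉₊ with hb
  have hbn : b ≤ n := by
    rw [hb, Nat.ceil_le]
    have : z0 / d ≤ n := by rw [div_le_iff₀ hd]; exact h1
    linarith
  have hlt : ∀ i, i < b → r i < z0 := by
    intro i hi
    rw [hb, Nat.lt_ceil] at hi
    have : (i:ℝ) + 1/2 < z0 / d := by linarith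
    rw [lt_div_iff₀ hd] at this
    exact this
  have hgt : ∀ i, b ≤ i → z0 < r i := by
    intro i hi
    refine lt_of_le_of_ne ?_ (hz i)
    rw [hb, Nat.ceil_le] at hi
    have : z0 / d ≤ (i:ℝ) + 1/2 := by linarith
    rw [div_le_iff₀ hd] at this
    exact this
  set x : ℕ → ℝ := fun k => if k < b * M then r (k / M) else if k = b * M then z0
    else r ((k-1)/M) with hx
  have x1 : ∀ k, k < b * M → x k = r (k / M) := fun k hk => by simp only [hx]; rw [if_pos hk]
  have x2 : x (b * M) = z0 := by simp [hx]
  have x3 : ∀ k, b * M < k → x k = r ((k-1) / M) := fun k hk => by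
    simp only [hx]; rw [if_neg (by omega), if_neg (by omega)]
  have l1 : ∀ k, k < b * M → k / M < b := fun k hk => by
    rw [Nat.div_lt_iff_lt_mul hM]; exact hk
  have l3 : ∀ k, b * M < k → b ≤ (k-1) / M := fun k hk => by
    rw [Nat.le_div_iff_mul_le hM]; omega
  have hxm : Monotone x := by
    apply monotone_nat_of_le_succ
    intro k
    rcases lt_trichotomy (k+1) (b*M) with h | h | h
    · rw [x1 k (by omega), x1 _ h]; exact hrm.monotone (Nat.div_le_div_right (Nat.le_succ k))
    · rw [h, x2, x1 k (by omega)]; exact (hlt _ (l1 k (by omega))).le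
    · rw [x3 _ h]
      rcases Nat.lt_or_ge (b*M) k with h' | h'
      · rw [x3 k h']; exact hrm.monotone (Nat.div_le_div_right (by omega))
      · have : k = b * M := by omega
        rw [this, x2]; exact (hgt _ (l3 _ (by omega))).le
  have hdivj : ∀ i j, i / M = (i + j) / M → j < M := by
    intro i j h
    by_contra hj
    push Not at hj
    have : (i + M) / M ≤ (i + j) / M := Nat.div_le_div_right (by omega)
    rw [Nat.add_div_right _ hM] at this
    omega
  obtain ⟨ξ, hξ1, hξ2, hξ3⟩ := rolle_mult (n*M) g hgd x hxm (by
    intro i j hij he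
    rcases lt_trichotomy i (b*M) with h | h | h
    · rcases lt_trichotomy (i+j) (b*M) with h' | h' | h'
      · rw [x1 i h, x1 _ h'] at he
        rw [x1 i h]
        exact hgn _ ((l1 i h).trans_le hbn) _ (hdivj i j (hrm.injective he))
      · rw [h', x2, x1 i h] at he
        exact absurd he (hlt _ (l1 i h)).ne
      · rw [x1 i h, x3 _ h'] at he
        have := hrm.injective he
        have a := l1 i h
        have b' := l3 _ h'
        omega
    · rcases Nat.eq_zero_or_pos j with rfl | hj
      · rw [h, x2]; exact hg0
      · rw [h, x2, x3 _ (by omega)] at he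
        exact absurd he (hz _)
    · rw [x3 i h, x3 _ (by omega)] at he
      rw [x3 i h]
      have hj := hrm.injective he
      rw [show i + j - 1 = i - 1 + j by omega] at hj
      refine hgn _ ?_ _ (hdivj _ _ hj)
      rw [Nat.div_lt_iff_lt_mul hM]; omega)
  have hx0 : 0 ≤ x 0 := by
    have hrn : ∀ i, 0 ≤ r i := fun i => by simp only [hr]; positivity
    rcases Nat.eq_zero_or_pos (b * M) with h | h
    · rw [show x 0 = z0 by rw [← h, x2]]; exact h0
    · rw [x1 0 h]; exact hrn _
  have hxN : x (n*M) ≤ n * d := by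
    rcases Nat.lt_or_ge b n with h | h
    · have : b * M < n * M := Nat.mul_lt_mul_of_pos_right h hM
      rw [x3 _ this]
      have : (n*M-1)/M + 1 ≤ n := by
        have : (n*M-1)/M < n := by rw [Nat.div_lt_iff_lt_mul hM]; omega
        omega
      have : (((n*M-1)/M : ℕ):ℝ) + 1 ≤ n := by exact_mod_cast this
      simp only [hr]
      apply mul_le_mul_of_nonneg_right _ hd.le
      linarith
    · have : b = n := by omega
      rw [← this, x2, this]; exact h1
  have hNN : F (n*M) ξ = C0 * (n*M).factorial := by
    have e1 : derivative^[n*M] H = 0 := by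
      apply iterate_derivative_eq_zero_of_degree_lt
      exact hH1
    have e2 : (derivative^[n*M] W).eval ξ = (n*M).factorial := by
      rw [hdt]
      have : (taylor ξ W).coeff (n*M) = 1 := by
        have h3 : (taylor ξ W).natDegree = n*M := by rw [natDegree_taylor, hWd]
        have h4 := coeff_natDegree (p := taylor ξ W)
        rw [h3] at h4
        rw [h4, leadingCoeff_taylor, hWm]
      rw [this, mul_one]
    simp only [hg] at hξ3
    rw [e1, e2] at hξ3
    simp at hξ3
    linarith
  have hC : |C0| ≤ A := by
    have := hA ξ (hx0.trans hξ1) (hξ2.trans hxN)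
    rw [hNN, abs_mul, Nat.abs_cast, mul_comm] at this
    exact le_of_mul_le_mul_left this (by positivity)
  have hfin : F 0 z0 = H.eval z0 + C0 * W.eval z0 := by
    rw [hC0]; field_simp; ring
  rw [hfin]
  refine (abs_add_le _ _).trans ?_
  rw [abs_mul]
  have := (abs_nonneg C0).trans hC
  gcongr

end

section
open Polynomial

/-- weighted l1 norm of a polynomial -/
noncomputable def maj (ϱ : ℝ) (p : ℝ[X]) : ℝ := p.sum fun j a => |a| * ϱ^j

theorem maj_eq (ϱ : ℝ) (p : ℝ[X]) (N : ℕ) (hN : p.natDegree < N) :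
    maj ϱ p = ∑ j ∈ Finset.range N, |p.coeff j| * ϱ^j := by
  rw [maj, sum_over_range' _ _ N hN]; simp

theorem maj_nonneg {ϱ : ℝ} (h : 0 ≤ ϱ) (p : ℝ[X]) : 0 ≤ maj ϱ p := by
  rw [maj_eq ϱ p _ (Nat.lt_succ_self _)]
  exact Finset.sum_nonneg (fun _ _ => by positivity)

theorem maj_coeff_sum {ϱ : ℝ} (h : 0 ≤ ϱ) (p : ℝ[X]) (s : Finset ℕ) :
    ∑ j ∈ s, |p.coeff j| * ϱ^j ≤ maj ϱ p := by
  rw [maj_eq ϱ p (p.natDegree + s.sup id + 1) (by omega)]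
  apply Finset.sum_le_sum_of_subset_of_nonneg
  · intro j hj
    have := Finset.le_sup (f := id) hj
    simp at this ⊢; omega
  · intros; positivity

theorem maj_add {ϱ : ℝ} (h : 0 ≤ ϱ) (p q : ℝ[X]) : maj ϱ (p + q) ≤ maj ϱ p + maj ϱ q := by
  set N := (p+q).natDegree + p.natDegree + q.natDegree + 1
  rw [maj_eq ϱ (p+q) N (by omega), maj_eq ϱ p N (by omega), maj_eq ϱ q N (by omega),
    ← Finset.sum_add_distrib]
  apply Finset.sum_le_sum
  intro j _
  rw [coeff_add, ← add_mul]
  gcongr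
  exact abs_add_le _ _

theorem maj_zero (ϱ : ℝ) : maj ϱ 0 = 0 := by simp [maj]

theorem maj_sum {ϱ : ℝ} (h : 0 ≤ ϱ) {ι : Type*} (s : Finset ι) (f : ι → ℝ[X]) :
    maj ϱ (∑ i ∈ s, f i) ≤ ∑ i ∈ s, maj ϱ (f i) := by
  classical
  induction s using Finset.induction_on with
  | empty => simp [maj_zero]
  | insert a s ha ih =>
    rw [Finset.sum_insert ha, Finset.sum_insert ha]
    exact (maj_add h _ _).trans (by gcongr)

theorem maj_C_mul_X_pow (ϱ a : ℝ) (n : ℕ) : maj ϱ (C a * X^n) = |a| * ϱ^n := by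
  rw [maj, C_mul_X_pow_eq_monomial, sum_monomial_index]; simp

theorem maj_C (ϱ a : ℝ) : maj ϱ (C a) = |a| := by
  have := maj_C_mul_X_pow ϱ a 0; simpa using this

theorem maj_C_mul (ϱ a : ℝ) (p : ℝ[X]) : maj ϱ (C a * p) = |a| * maj ϱ p := by
  rw [maj_eq ϱ (C a * p) (p.natDegree + 1) (Nat.lt_succ_of_le (natDegree_C_mul_le a p)),
    maj_eq ϱ p _ (Nat.lt_succ_self _), Finset.mul_sum]
  apply Finset.sum_congr rfl
  intro j _
  rw [coeff_C_mul, abs_mul, mul_assoc]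

theorem maj_X_pow_mul (ϱ : ℝ) (n : ℕ) (p : ℝ[X]) : maj ϱ (X^n * p) = ϱ^n * maj ϱ p := by
  by_cases hp : p = 0
  · simp [hp, maj_zero]
  rw [maj_eq ϱ (X^n * p) (n + (p.natDegree + 1)) (by
      rw [natDegree_X_pow_mul n hp]; omega),
    maj_eq ϱ p _ (Nat.lt_succ_self _), Finset.sum_range_add, Finset.mul_sum]
  rw [Finset.sum_eq_zero, zero_add]
  · apply Finset.sum_congr rfl
    intro j _
    rw [add_comm n j, coeff_X_pow_mul, pow_add]; ring
  · intro j hj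
    rw [Finset.mem_range] at hj
    rw [coeff_X_pow_mul']; simp [hj]

theorem maj_mul {ϱ : ℝ} (h : 0 ≤ ϱ) (p q : ℝ[X]) : maj ϱ (p * q) ≤ maj ϱ p * maj ϱ q := by
  conv_lhs => rw [p.as_sum_range_C_mul_X_pow, Finset.sum_mul]
  refine (maj_sum h _ _).trans ?_
  rw [maj_eq ϱ p _ (Nat.lt_succ_self _), Finset.sum_mul]
  apply Finset.sum_le_sum
  intro j _
  rw [mul_assoc, maj_C_mul, maj_X_pow_mul, mul_assoc]

theorem maj_pow {ϱ : ℝ} (h : 0 ≤ ϱ) (p : ℝ[X]) (n : ℕ) : maj ϱ (p^n) ≤ (maj ϱ p)^n := by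
  induction n with
  | zero => have := maj_C ϱ 1; simp at this; simp [this]
  | succ n ih =>
    rw [pow_succ, pow_succ]
    refine (maj_mul h _ _).trans ?_
    have := maj_nonneg h p
    gcongr

theorem maj_prod {ϱ : ℝ} (h : 0 ≤ ϱ) {ι : Type*} (s : Finset ι) (f : ι → ℝ[X]) :
    maj ϱ (∏ i ∈ s, f i) ≤ ∏ i ∈ s, maj ϱ (f i) := by
  classical
  induction s using Finset.induction_on with
  | empty => have := maj_C ϱ 1; simp at this; simp [this]
  | insert a s ha ih =>
    rw [Finset.prod_insert ha, Finset.prod_insert ha]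
    have := maj_nonneg h (f a)
    exact (maj_mul h _ _).trans (by gcongr)

theorem maj_taylor_hasse {ϱ : ℝ} (h : 0 ≤ ϱ) (p : ℝ[X]) (m : ℕ) (ξ : ℝ) :
    maj ϱ (taylor ξ (hasseDeriv m p)) ≤ maj (ϱ+1) (taylor ξ p) := by
  set N := (taylor ξ (hasseDeriv m p)).natDegree + 1
  rw [maj_eq ϱ _ N (by omega)]
  have e : ∀ j, |(taylor ξ (hasseDeriv m p)).coeff j| * ϱ^j ≤
      |(taylor ξ p).coeff (j+m)| * (ϱ+1)^(j+m) := by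
    intro j
    rw [taylor_coeff, taylor_coeff]
    have := congrArg (fun f => f p) (hasseDeriv_comp (R := ℝ) j m)
    simp only [LinearMap.comp_apply, LinearMap.smul_apply] at this
    rw [this, eval_smul, nsmul_eq_mul, abs_mul, Nat.abs_cast, mul_comm ((_:ℕ):ℝ), mul_assoc]
    gcongr
    rw [add_pow]
    have := Finset.single_le_sum (f := fun i => ϱ^i * 1^(j+m-i) * ((j+m).choose i:ℝ))
      (s := Finset.range (j+m+1)) (fun i _ => by positivity) (Finset.mem_range.2 (by omega : j < j+m+1))
    refine le_trans (le_of_eq ?_) this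
    simp [mul_comm]
  refine (Finset.sum_le_sum (fun j _ => e j)).trans ?_
  have := maj_coeff_sum (by linarith : 0 ≤ ϱ+1) (taylor ξ p) ((Finset.range N).map (addRightEmbedding m))
  rw [Finset.sum_map] at this
  exact this

theorem abs_eval_le_maj (p : ℝ[X]) (m : ℕ) (ξ : ℝ) {ϱ : ℝ} (h : 1 ≤ ϱ) :
    |(hasseDeriv m p).eval ξ| ≤ maj ϱ (taylor ξ p) := by
  have := maj_coeff_sum (by linarith : 0 ≤ ϱ) (taylor ξ p) {m}
  rw [Finset.sum_singleton, taylor_coeff] at this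
  refine le_trans ?_ this
  exact le_mul_of_one_le_right (abs_nonneg _) (one_le_pow₀ h)

/-- the operator D + θ -/
noncomputable def opD (θ : ℝ) : Module.End ℝ ℝ[X] := derivative + θ • 1

theorem opD_apply (θ : ℝ) (p : ℝ[X]) : opD θ p = derivative p + C θ * p := by
  simp [opD, smul_eq_C_mul]

theorem opD_pow_eval (θ : ℝ) (p : ℝ[X]) (j : ℕ) (ξ : ℝ) :
    ((opD θ ^ j) p).eval ξ = j.factorial * ∑ i ∈ Finset.range (j+1),
      (taylor ξ p).coeff i * (θ^(j-i) / (j-i).factorial) := by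
  have hcm : Commute (derivative : Module.End ℝ ℝ[X]) (θ • 1) := by
    apply Commute.smul_right; exact Commute.one_right _
  rw [opD, hcm.add_pow, LinearMap.sum_apply, eval_finsetSum, Finset.mul_sum]
  apply Finset.sum_congr rfl
  intro i hi
  rw [Finset.mem_range] at hi
  have e1 : (((derivative : Module.End ℝ ℝ[X])^i * (θ • 1)^(j-i) * ((j.choose i : ℕ) : Module.End ℝ ℝ[X])) p)
     = (θ^(j-i) * (j.choose i)) • (derivative^[i] p) := by
    rw [_root_.smul_pow, one_pow, ← nsmul_one (j.choose i), ← Nat.cast_smul_eq_nsmul ℝ]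
    simp only [mul_smul_comm, mul_one, LinearMap.smul_apply, Module.End.pow_apply, smul_smul]
    rw [mul_comm]
  rw [e1, eval_smul, ← factorial_smul_hasseDeriv, taylor_coeff]
  rw [LinearMap.smul_apply, eval_smul, nsmul_eq_mul, smul_eq_mul]
  have hch : ((j.choose i : ℕ):ℝ) * i.factorial * (j-i).factorial = j.factorial := by
    exact_mod_cast Nat.choose_mul_factorial_mul_factorial (by omega : i ≤ j)
  have : ((j-i).factorial : ℝ) ≠ 0 := by positivity
  rw [← hch]
  field_simp

theorem opD_pow_bound (θ Θ : ℝ) (hθ : |θ| ≤ Θ) (p : ℝ[X]) (j : ℕ) (ξ : ℝ) {ϱ : ℝ} (h : 0 < ϱ) :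
    |((opD θ ^ j) p).eval ξ| ≤ j.factorial * ((ϱ^j)⁻¹ * (maj ϱ (taylor ξ p) * Real.exp (Θ * ϱ))) := by
  rw [opD_pow_eval, abs_mul, Nat.abs_cast]
  gcongr
  refine (Finset.abs_sum_le_sum_abs _ _).trans ?_
  have : ∀ i ∈ Finset.range (j+1), |(taylor ξ p).coeff i * (θ^(j-i) / (j-i).factorial)| ≤
      (|(taylor ξ p).coeff i| * ϱ^i) * ((ϱ^j)⁻¹ * Real.exp (Θ * ϱ)) := by
    intro i hi
    rw [Finset.mem_range] at hi
    rw [abs_mul, mul_assoc]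
    gcongr
    have h1 := Real.pow_div_factorial_le_exp (Θ * ϱ) (by have := (abs_nonneg θ).trans hθ; positivity) (j-i)
    have h2 : ϱ^j = ϱ^i * ϱ^(j-i) := by rw [← pow_add]; congr 1; omega
    rw [abs_div, abs_pow, Nat.abs_cast, h2]
    calc |θ|^(j-i) / (j-i).factorial ≤ Θ^(j-i) / (j-i).factorial := by gcongr
      _ = ϱ^i * ((ϱ^i * ϱ^(j-i))⁻¹ * ((Θ*ϱ)^(j-i)/(j-i).factorial)) := by
          rw [mul_pow]; field_simp
      _ ≤ _ := by gcongr
  refine (Finset.sum_le_sum this).trans ?_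
  rw [← Finset.sum_mul]
  have := maj_coeff_sum h.le (taylor ξ p) (Finset.range (j+1))
  calc _ ≤ maj ϱ (taylor ξ p) * ((ϱ^j)⁻¹ * Real.exp (Θ * ϱ)) := by gcongr
    _ = _ := by ring

theorem expPoly_deriv {ι : Type*} (I : Finset ι) (p : ι → ℝ[X]) (θ : ι → ℝ) (j : ℕ) (x : ℝ) :
    HasDerivAt (fun z => ∑ i ∈ I, ((opD (θ i) ^ j) (p i)).eval z * Real.exp (θ i * z))
      (∑ i ∈ I, ((opD (θ i) ^ (j+1)) (p i)).eval x * Real.exp (θ i * x)) x := by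
  apply HasDerivAt.fun_sum
  intro i _
  have h1 := ((opD (θ i) ^ j) (p i)).hasDerivAt x
  have h2 : HasDerivAt (fun z => Real.exp (θ i * z)) (Real.exp (θ i * x) * (θ i * 1)) x :=
    ((hasDerivAt_id x).const_mul (θ i)).exp
  refine (h1.mul h2).congr_deriv ?_
  rw [pow_succ', Module.End.mul_apply, opD_apply]
  simp only [eval_add, eval_mul, eval_C]
  ring

theorem opD_moment {ι : Type*} (I : Finset ι) (p : ι → ℝ[X]) (u v E : ι → ℝ) (a1 a2 r : ℝ) (T : ℕ)
    (hz : ∀ m0 m1 m2, m0 + m1 + m2 < T →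
      ∑ i ∈ I, (hasseDeriv m0 (p i)).eval r * (u i^m1 * v i^m2) * E i = 0) :
    ∀ j m0 m1 m2, m0 + m1 + m2 + j < T →
      ∑ i ∈ I, ((opD (u i * a1 + v i * a2) ^ j) (C (u i^m1 * v i^m2) * hasseDeriv m0 (p i))).eval r
        * E i = 0 := by
  intro j
  induction j with
  | zero =>
    intro m0 m1 m2 h
    simp only [pow_zero, Module.End.one_apply, eval_mul, eval_C]
    rw [← hz m0 m1 m2 (by omega)]
    apply Finset.sum_congr rfl
    intro i _
    ring
  | succ j ih =>
    intro m0 m1 m2 h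
    have e : ∀ i, opD (u i * a1 + v i * a2) (C (u i^m1 * v i^m2) * hasseDeriv m0 (p i)) =
        ((m0+1 : ℕ):ℝ) • (C (u i^m1 * v i^m2) * hasseDeriv (m0+1) (p i)) +
        (a1 • (C (u i^(m1+1) * v i^m2) * hasseDeriv m0 (p i)) +
         a2 • (C (u i^m1 * v i^(m2+1)) * hasseDeriv m0 (p i))) := by
      intro i
      have hd : derivative (hasseDeriv m0 (p i)) = ((m0+1:ℕ):ℝ) • hasseDeriv (m0+1) (p i) := by
        have := congrArg (fun f => f (p i)) (hasseDeriv_comp (R := ℝ) 1 m0)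
        simp only [LinearMap.comp_apply, LinearMap.smul_apply, hasseDeriv_one] at this
        rw [this, add_comm 1 m0, Nat.choose_one_right, Nat.cast_smul_eq_nsmul]
      rw [opD_apply, derivative_C_mul, hd]
      simp only [smul_eq_C_mul, C_mul, C_add, C_pow]
      ring
    have hs : ∀ i ∈ I, ((opD (u i * a1 + v i * a2) ^ (j+1)) (C (u i^m1 * v i^m2) * hasseDeriv m0 (p i))).eval r
        * E i = ((m0+1 : ℕ):ℝ) * (((opD (u i * a1 + v i * a2) ^ j)
            (C (u i^m1 * v i^m2) * hasseDeriv (m0+1) (p i))).eval r * E i) +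
          (a1 * (((opD (u i * a1 + v i * a2) ^ j)
            (C (u i^(m1+1) * v i^m2) * hasseDeriv m0 (p i))).eval r * E i) +
          a2 * (((opD (u i * a1 + v i * a2) ^ j)
            (C (u i^m1 * v i^(m2+1)) * hasseDeriv m0 (p i))).eval r * E i)) := by
      intro i _
      rw [pow_succ, Module.End.mul_apply, e i]
      simp only [map_add, map_smul, eval_add, eval_smul, smul_eq_mul]
      ring
    rw [Finset.sum_congr rfl hs, Finset.sum_add_distrib, Finset.sum_add_distrib,
      ← Finset.mul_sum, ← Finset.mul_sum, ← Finset.mul_sum,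
      ih (m0+1) m1 m2 (by omega), ih m0 (m1+1) m2 (by omega), ih m0 m1 (m2+1) (by omega)]
    simp

end

section
open Polynomial

theorem exp_diff_le (θ τ τm r Y Θ : ℝ) (hr : 0 ≤ r) (hrY : r ≤ Y) (hτ : |τ| ≤ τm) (hY : Y * τm ≤ 1)
    (hθ : |θ| ≤ Θ) :
    |Real.exp (θ * r) - Real.exp ((θ + τ) * r)| ≤ Real.exp (Θ * Y) * (2 * Y * τm) := by
  have hx : |τ * r| ≤ Y * τm := by
    rw [abs_mul, abs_of_nonneg hr, mul_comm]
    exact mul_le_mul hrY hτ (abs_nonneg _) (hr.trans hrY)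
  have h1 : |Real.exp (τ * r) - 1| ≤ 2 * |τ * r| := Real.abs_exp_sub_one_le (hx.trans hY)
  have e : Real.exp (θ * r) - Real.exp ((θ + τ) * r) = - (Real.exp (θ * r) * (Real.exp (τ * r) - 1)) := by
    rw [add_mul, Real.exp_add]; ring
  rw [e, abs_neg, abs_mul, abs_of_pos (Real.exp_pos _)]
  apply mul_le_mul _ (by linarith) (abs_nonneg _) (Real.exp_pos _).le
  apply Real.exp_le_exp.2
  calc θ * r ≤ |θ| * r := mul_le_mul_of_nonneg_right (le_abs_self _) hr
    _ ≤ Θ * Y := mul_le_mul hθ hrY hr ((abs_nonneg _).trans hθ)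

theorem maj_weight {ϱ : ℝ} (h : 0 ≤ ϱ) (p : ℝ[X]) (u v B : ℝ) (hu : |u| ≤ B) (hv : |v| ≤ B)
    (m0 m1 m2 : ℕ) (hB : 1 ≤ B) (ξ A : ℝ) (hA : maj (ϱ+1) (taylor ξ p) ≤ A) :
    maj ϱ (taylor ξ (C (u^m1*v^m2) * hasseDeriv m0 p)) ≤ B^(m0+m1+m2) * A := by
  have e : taylor ξ (C (u^m1*v^m2) * hasseDeriv m0 p) = C (u^m1*v^m2) * taylor ξ (hasseDeriv m0 p) := by
    rw [taylor_mul, taylor_C]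
  rw [e, maj_C_mul]
  apply mul_le_mul _ ((maj_taylor_hasse h p m0 ξ).trans hA) (maj_nonneg h _) (by positivity)
  rw [abs_mul, abs_pow, abs_pow]
  calc |u|^m1*|v|^m2 ≤ B^m1 * B^m2 := by gcongr
    _ = B^(m1+m2) := by rw [pow_add]
    _ ≤ B^(m0+m1+m2) := pow_le_pow_right₀ hB (by omega)

theorem analytic_step {ι : Type*} (I : Finset ι) (p : ι → ℝ[X]) (u v τ : ι → ℝ) (a1 a2 : ℝ)
    (n M T0 : ℕ) (hn : 0 < n) (hM : 0 < M) (d : ℝ) (hd : 0 < d) (hd2 : d ≤ 2)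
    (Y τm Θ B ϱ A1 A2 Nc : ℝ) (hYn : Y = n * d) (hϱ : 0 < ϱ) (hB : 1 ≤ B) (hA1 : 0 ≤ A1) (hA2 : 0 ≤ A2)
    (hcard : (I.card : ℝ) ≤ Nc)
    (hτ0 : 0 ≤ τm) (hτ : ∀ i ∈ I, |τ i| ≤ τm) (hYτ : Y * τm ≤ 1) (hΘ0 : 0 ≤ Θ)
    (hΘ : ∀ i ∈ I, |u i * a1 + v i * a2| ≤ Θ)
    (hu : ∀ i ∈ I, |u i| ≤ B) (hv : ∀ i ∈ I, |v i| ≤ B)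
    (hp1 : ∀ i ∈ I, ∀ ξ, 0 ≤ ξ → ξ ≤ Y → maj (ϱ+1) (taylor ξ (p i)) ≤ A1)
    (hp2 : ∀ i ∈ I, ∀ ξ, 0 ≤ ξ → ξ ≤ Y → maj 2 (taylor ξ (p i)) ≤ A2)
    (hz : ∀ i : ℕ, i < n → ∀ m0 m1 m2, m0+m1+m2 < T0 →
      ∑ i' ∈ I, (hasseDeriv m0 (p i')).eval (((i:ℝ)+1/2)*d) * (u i'^m1 * v i'^m2) *
        Real.exp ((u i' * a1 + v i' * a2 + τ i') * (((i:ℝ)+1/2)*d)) = 0)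
    (m0 m1 m2 : ℕ) (hm : m0+m1+m2+M ≤ T0)
    (z0 : ℝ) (h0 : 0 ≤ z0) (h1 : z0 ≤ Y) (hz0 : ∀ i : ℕ, z0 ≠ ((i:ℝ) + 1/2) * d) :
    |∑ i' ∈ I, (hasseDeriv m0 (p i')).eval z0 * (u i'^m1 * v i'^m2) *
        Real.exp ((u i' * a1 + v i' * a2 + τ i') * z0)| ≤
      Nc * (B^(m0+m1+m2) * A2 * Real.exp (Θ*(1+Y)) * (2*Y*τm)) *
        (1 + n * M * 4^(n*M) * (2 * n^2 * (n+1))^M) +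
      Nc * (B^(m0+m1+m2) * A1 * Real.exp (Θ*(ϱ+Y))) * ((ϱ^(n*M))⁻¹ * (d^n * (n+1).factorial)^M) := by
  have hY0 : 0 ≤ Y := by rw [hYn]; positivity
  have hNc : 0 ≤ Nc := le_trans (by positivity) hcard
  set θ : ι → ℝ := fun i => u i * a1 + v i * a2 with hθd
  set q : ι → ℝ[X] := fun i => C (u i^m1 * v i^m2) * hasseDeriv m0 (p i) with hq
  set F : ℕ → ℝ → ℝ := fun j z => ∑ i ∈ I, ((opD (θ i)^j) (q i)).eval z * Real.exp (θ i * z) with hF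
  set δ := Nc * (B^(m0+m1+m2) * A2 * Real.exp (Θ*(1+Y)) * (2*Y*τm)) with hδ
  set A := Nc * (B^(m0+m1+m2) * A1 * Real.exp (Θ*(ϱ+Y))) * (ϱ^(n*M))⁻¹ with hAdef
  have hδ0 : 0 ≤ δ := by rw [hδ]; positivity
  -- difference bound
  have hdiff : ∀ j r, 0 ≤ r → r ≤ Y →
      |F j r - ∑ i ∈ I, ((opD (θ i)^j) (q i)).eval r * Real.exp ((θ i + τ i) * r)| ≤ j.factorial * δ := by
    intro j r hr hrY
    rw [hF]
    simp only
    rw [← Finset.sum_sub_distrib]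
    have : ∀ i ∈ I, |((opD (θ i)^j) (q i)).eval r * Real.exp (θ i * r) -
        ((opD (θ i)^j) (q i)).eval r * Real.exp ((θ i + τ i) * r)| ≤
        j.factorial * (B^(m0+m1+m2) * A2 * Real.exp (Θ*(1+Y)) * (2*Y*τm)) := by
      intro i hi
      rw [← mul_sub, abs_mul]
      have b1 := opD_pow_bound (θ i) Θ (hΘ i hi) (q i) j r (ϱ := 1) one_pos
      have b2 := exp_diff_le (θ i) (τ i) τm r Y Θ hr hrY (hτ i hi) hYτ (hΘ i hi)
      have b3 : maj 1 (taylor r (q i)) ≤ B^(m0+m1+m2) * A2 :=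
        maj_weight zero_le_one (p i) (u i) (v i) B (hu i hi) (hv i hi) m0 m1 m2 hB r A2
          (by norm_num; exact hp2 i hi r hr hrY)
      have b4 : |((opD (θ i)^j) (q i)).eval r| ≤ j.factorial * (B^(m0+m1+m2) * A2 * Real.exp Θ) := by
        refine b1.trans ?_
        rw [one_pow, inv_one, one_mul, mul_one]
        gcongr
      refine (mul_le_mul b4 b2 (abs_nonneg _) (by positivity)).trans (le_of_eq ?_)
      rw [mul_add, Real.exp_add]; ring_nf
    refine (Finset.abs_sum_le_sum_abs _ _).trans ((Finset.sum_le_sum this).trans ?_)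
    rw [Finset.sum_const, nsmul_eq_mul, hδ]
    calc (I.card:ℝ) * (j.factorial * (B^(m0+m1+m2) * A2 * Real.exp (Θ*(1+Y)) * (2*Y*τm)))
        ≤ Nc * (j.factorial * (B^(m0+m1+m2) * A2 * Real.exp (Θ*(1+Y)) * (2*Y*τm))) := by gcongr
      _ = _ := by ring
  have hmain : |F 0 z0| ≤ δ * n * M * 4^(n*M) * (2 * n^2 * (n+1))^M + A * (d^n * (n+1).factorial)^M := by
    apply interp_bound n M hn hM d hd hd2 F (fun j x => expPoly_deriv I q θ j x) δ A hδ0 _ _ z0 h0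
      (by rw [← hYn]; exact h1) hz0
    · intro i hi j hj
      have hr0 : 0 ≤ ((i:ℝ)+1/2)*d := by positivity
      have hrY : ((i:ℝ)+1/2)*d ≤ Y := by
        rw [hYn]
        have : (i:ℝ) + 1 ≤ n := by exact_mod_cast hi
        exact mul_le_mul_of_nonneg_right (by linarith) hd.le
      have := hdiff j _ hr0 hrY
      rwa [opD_moment I p u v (fun i' => Real.exp ((θ i' + τ i') * (((i:ℝ)+1/2)*d))) a1 a2
        (((i:ℝ)+1/2)*d) T0 (hz i hi) j m0 m1 m2 (by omega), sub_zero] at this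
    · intro ξ hξ0 hξ1
      rw [← hYn] at hξ1
      have : ∀ i ∈ I, |((opD (θ i)^(n*M)) (q i)).eval ξ * Real.exp (θ i * ξ)| ≤
          (n*M).factorial * ((ϱ^(n*M))⁻¹ * (B^(m0+m1+m2) * A1 * Real.exp (Θ*(ϱ+Y)))) := by
        intro i hi
        rw [abs_mul]
        have b1 := opD_pow_bound (θ i) Θ (hΘ i hi) (q i) (n*M) ξ hϱ
        have b3 : maj ϱ (taylor ξ (q i)) ≤ B^(m0+m1+m2) * A1 :=
          maj_weight hϱ.le (p i) (u i) (v i) B (hu i hi) (hv i hi) m0 m1 m2 hB ξ A1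
            (hp1 i hi ξ hξ0 hξ1)
        have b4 : |((opD (θ i)^(n*M)) (q i)).eval ξ| ≤
            (n*M).factorial * ((ϱ^(n*M))⁻¹ * (B^(m0+m1+m2) * A1 * Real.exp (Θ*ϱ))) := by
          refine b1.trans ?_
          gcongr
        have b5 : |Real.exp (θ i * ξ)| ≤ Real.exp (Θ * Y) := by
          rw [abs_of_pos (Real.exp_pos _)]
          apply Real.exp_le_exp.2
          calc θ i * ξ ≤ |θ i| * ξ := mul_le_mul_of_nonneg_right (le_abs_self _) hξ0
            _ ≤ Θ * Y := mul_le_mul (hΘ i hi) hξ1 hξ0 hΘ0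
        refine (mul_le_mul b4 b5 (abs_nonneg _) (by positivity)).trans (le_of_eq ?_)
        rw [mul_add, Real.exp_add]; ring
      refine (Finset.abs_sum_le_sum_abs _ _).trans ((Finset.sum_le_sum this).trans ?_)
      rw [Finset.sum_const, nsmul_eq_mul, hAdef]
      calc (I.card:ℝ) * ((n*M).factorial * ((ϱ^(n*M))⁻¹ * (B^(m0+m1+m2) * A1 * Real.exp (Θ*(ϱ+Y)))))
          ≤ Nc * ((n*M).factorial * ((ϱ^(n*M))⁻¹ * (B^(m0+m1+m2) * A1 * Real.exp (Θ*(ϱ+Y))))) := by gcongr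
        _ = _ := by ring
  have hd0 := hdiff 0 z0 h0 h1
  simp only [pow_zero, Module.End.one_apply, Nat.factorial_zero, Nat.cast_one, one_mul] at hd0
  have e : ∑ i' ∈ I, (hasseDeriv m0 (p i')).eval z0 * (u i'^m1 * v i'^m2) *
        Real.exp ((u i' * a1 + v i' * a2 + τ i') * z0) =
      ∑ i ∈ I, (q i).eval z0 * Real.exp ((θ i + τ i) * z0) := by
    apply Finset.sum_congr rfl
    intro i _
    simp only [hq, hθd, eval_mul, eval_C]
    ring
  rw [e]
  have := abs_sub_abs_le_abs_sub (∑ i ∈ I, (q i).eval z0 * Real.exp ((θ i + τ i) * z0)) (F 0 z0)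
  rw [abs_sub_comm] at this
  have hfin : |∑ i ∈ I, (q i).eval z0 * Real.exp ((θ i + τ i) * z0)| ≤ |F 0 z0| + δ := by linarith
  refine hfin.trans ?_
  calc |F 0 z0| + δ ≤ δ * n * M * 4^(n*M) * (2 * n^2 * (n+1))^M + A * (d^n * (n+1).factorial)^M + δ := by linarith
    _ = _ := by rw [hAdef]; ring

end

section
open Polynomial
theorem descP_prod {R : Type*} [CommRing R] (x : R) (k : ℕ) :
    (descPochhammer ℤ k).smeval x = ∏ j ∈ Finset.range k, (x - (j:R)) := by
  induction k with
  | zero => simp [descPochhammer_zero]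
  | succ k ih =>
    rw [descPochhammer_succ_right, smeval_mul, ih, Finset.prod_range_succ]
    simp [smeval_sub, smeval_natCast]

/-- the integral polynomials inside the real ones -/
noncomputable def intP : Subring ℝ[X] := (mapRingHom (Int.castRingHom ℝ)).range

theorem intP_X : (X : ℝ[X]) ∈ intP := ⟨X, by simp⟩
theorem intP_C (z : ℤ) : (C (z:ℝ) : ℝ[X]) ∈ intP := ⟨C z, by simp⟩
theorem intP_coeff {p : ℝ[X]} (hp : p ∈ intP) (m : ℕ) : ∃ z : ℤ, p.coeff m = z := by
  obtain ⟨q, rfl⟩ := hp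
  exact ⟨q.coeff m, by simp⟩

theorem odd_part_dvd (k J : ℕ) (y : ℤ) :
    (k.factorial : ℤ) ∣ 2^k * ∏ j ∈ Finset.range k, (y - (j:ℤ) * 2^J) := by
  rcases Nat.eq_zero_or_pos k with rfl | hk
  · simp
  obtain ⟨a, o, ho, hko⟩ := Nat.exists_eq_two_pow_mul_odd (Nat.factorial_ne_zero k)
  have ha : a < k := by
    have h1 := Nat.emultiplicity_two_factorial_lt hk.ne'
    have h2 : (2:ℕ)^a ∣ k.factorial := ⟨o, hko⟩
    have h3 := le_emultiplicity_of_pow_dvd h2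
    exact_mod_cast lt_of_le_of_lt h3 h1
  have hcop : IsCoprime ((2:ℤ)^J) (o:ℤ) := by
    apply IsCoprime.pow_left
    exact_mod_cast Nat.isCoprime_iff_coprime.2 (Nat.coprime_two_left.2 ho)
  obtain ⟨D', b, hDb⟩ := hcop
  have h1 : (o:ℤ) ∣ ∏ j ∈ Finset.range k, (D' * y - (j:ℤ)) := by
    have : (k.factorial : ℤ) ∣ ∏ j ∈ Finset.range k, (D' * y - (j:ℤ)) := by
      have e := Ring.descPochhammer_eq_factorial_smul_choose (D' * y) k
      rw [descP_prod] at e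
      simp only [Int.cast_natCast, nsmul_eq_mul, Nat.cast_id] at e
      exact ⟨_, e⟩
    refine dvd_trans ?_ this
    rw [hko]; push_cast; exact Dvd.intro_left _ rfl
  have h2 : (o:ℤ) ∣ ∏ j ∈ Finset.range k, (y - (j:ℤ) * 2^J) := by
    have hc : IsCoprime (o:ℤ) (D'^k) := by
      apply IsCoprime.pow_right
      exact ⟨b, 2^J, by linarith⟩
    apply hc.dvd_of_dvd_mul_left
    have e : (D'^k * ∏ j ∈ Finset.range k, (y - (j:ℤ) * 2^J)) ≡
        ∏ j ∈ Finset.range k, (D' * y - (j:ℤ)) [ZMOD o] := by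
      have : D'^k * ∏ j ∈ Finset.range k, (y - (j:ℤ) * 2^J) =
          ∏ j ∈ Finset.range k, (D' * (y - (j:ℤ) * 2^J)) := by
        rw [Finset.prod_mul_distrib]; simp
      rw [this]
      apply Int.ModEq.prod
      intro j _
      apply Int.modEq_of_dvd
      exact ⟨-(j:ℤ) * b, by linear_combination (j:ℤ) * hDb⟩
    exact (Int.modEq_zero_iff_dvd.1 (e.trans (Int.modEq_zero_iff_dvd.2 h1)))
  rw [hko]
  push_cast
  exact mul_dvd_mul (pow_dvd_pow 2 ha.le) h2

/-- binomial coefficient polynomial -/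
noncomputable def fbin (h : ℕ) : ℝ[X] := C ((h.factorial:ℝ)⁻¹) * ∏ i ∈ Finset.range h, (X - C (i:ℝ))

theorem fbin_comp (h : ℕ) (q : ℝ[X]) :
    (fbin h).comp q = C ((h.factorial:ℝ)⁻¹) * ∏ i ∈ Finset.range h, (q - C (i:ℝ)) := by
  simp [fbin, prod_comp]

theorem fbin_vandermonde (h : ℕ) (q s : ℝ[X]) :
    (fbin h).comp (q + s) = ∑ ij ∈ Finset.HasAntidiagonal.antidiagonal h, (fbin ij.1).comp q * (fbin ij.2).comp s := by
  have e := Ring.add_choose_eq (R := ℝ[X]) h (Commute.all q s)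
  have key : ∀ (k : ℕ) (x : ℝ[X]), (fbin k).comp x = Ring.choose x k := by
    intro k x
    have := Ring.descPochhammer_eq_factorial_smul_choose x k
    rw [descP_prod, nsmul_eq_mul] at this
    rw [fbin_comp]
    have e2 : ∏ i ∈ Finset.range k, (x - C (i:ℝ)) = ∏ i ∈ Finset.range k, (x - (i:ℝ[X])) := by simp
    rw [e2, this, ← C_eq_natCast, ← mul_assoc, ← C_mul, inv_mul_cancel₀ (by positivity), C_1, one_mul]
  simp only [key]
  exact e

theorem fbin_comp_int (j Δ h : ℕ) (hjh : j ≤ h) (hΔ : ∀ i, 1 ≤ i → i ≤ h → i ∣ Δ) :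
    (fbin j).comp (C (Δ:ℝ) * X) ∈ intP := by
  induction j with
  | zero => rw [fbin_comp]; simp [one_mem]
  | succ j ih =>
    have e : (fbin (j+1)).comp (C (Δ:ℝ) * X) = (fbin j).comp (C (Δ:ℝ)*X) *
        (C ((((j+1:ℕ):ℝ))⁻¹) * (C (Δ:ℝ) * X - C (j:ℝ))) := by
      rw [fbin_comp, fbin_comp, Finset.prod_range_succ, Nat.factorial_succ]
      push_cast
      rw [mul_inv, C_mul]; ring
    rcases Nat.eq_zero_or_pos j with rfl | hj
    · rw [fbin_comp]
      simp only [zero_add, Nat.factorial_one, Nat.cast_one, inv_one, C_1, Finset.prod_range_one, Nat.cast_zero, C_0, sub_zero, one_mul]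
      exact intP.mul_mem (by simpa using intP_C (Δ:ℤ)) intP_X
    · -- use shifted product form
      clear e ih
      obtain ⟨c, hc⟩ := hΔ (j+1) (by omega) hjh
      have hprod : ∏ i ∈ Finset.range j, (C (Δ:ℝ) * X - C ((i+1:ℕ):ℝ)) * C ((((i+1:ℕ):ℝ))⁻¹) ∈ intP := by
        apply Subring.prod_mem
        intro i hi
        obtain ⟨c, hc⟩ := hΔ (i+1) (by omega) (by have := Finset.mem_range.1 hi; omega)
        have hne : ((i+1:ℕ):ℝ) ≠ 0 := by positivity
        have : (C (Δ:ℝ) * X - C ((i+1:ℕ):ℝ)) * C ((((i+1:ℕ):ℝ))⁻¹) = C ((c:ℤ):ℝ) * X - 1 := by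
          rw [hc, sub_mul, ← C_mul, mul_inv_cancel₀ hne, C_1, mul_right_comm, ← C_mul, Nat.cast_mul,
            mul_right_comm, mul_inv_cancel₀ hne]
          simp
        rw [this]
        exact intP.sub_mem (intP.mul_mem (intP_C _) intP_X) intP.one_mem
      have : (fbin (j+1)).comp (C (Δ:ℝ) * X) =
          (C ((c:ℤ):ℝ) * X) * ∏ i ∈ Finset.range j, (C (Δ:ℝ) * X - C ((i+1:ℕ):ℝ)) * C ((((i+1:ℕ):ℝ))⁻¹) := by
        rw [fbin_comp, Finset.prod_range_succ', Finset.prod_mul_distrib]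
        have e1 : ∏ i ∈ Finset.range j, C ((((i+1:ℕ):ℝ))⁻¹) = C ((j.factorial:ℝ)⁻¹) := by
          rw [← map_prod, Finset.prod_inv_distrib, ← Nat.cast_prod, Finset.prod_range_add_one_eq_factorial]
        rw [e1, Nat.factorial_succ, hc]
        have hne : ((j+1:ℕ):ℝ) ≠ 0 := by positivity
        have e2 : C (((((j+1)*j.factorial : ℕ)):ℝ)⁻¹) * C ((((j+1)*c:ℕ)):ℝ) = C ((c:ℤ):ℝ) * C ((j.factorial:ℝ)⁻¹) := by
          rw [← C_mul, ← C_mul]; congr 1; push_cast; field_simp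
        simp only [Nat.cast_zero, C_0, sub_zero]
        linear_combination (∏ i ∈ Finset.range j, (C (((j+1)*c:ℕ):ℝ) * X - C ((i+1:ℕ):ℝ))) * X * e2
      rw [this]
      exact intP.mul_mem (intP.mul_mem (intP_C _) intP_X) hprod

theorem fbin_const_int (k J : ℕ) (y : ℤ) :
    C (((2 * 2^J : ℕ):ℝ)^k) * (fbin k).comp (C ((y:ℝ) / 2^J)) ∈ intP := by
  obtain ⟨c, hc⟩ := odd_part_dvd k J y
  have : C (((2 * 2^J : ℕ):ℝ)^k) * (fbin k).comp (C ((y:ℝ) / 2^J)) = C (c:ℝ) := by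
    rw [fbin_comp]
    have e : ∏ i ∈ Finset.range k, (C ((y:ℝ)/2^J) - C (i:ℝ)) = C (∏ i ∈ Finset.range k, ((y:ℝ)/2^J - i)) := by
      rw [map_prod]; simp
    rw [e, ← C_mul, ← C_mul]
    congr 1
    have hc' := congrArg (fun z : ℤ => (z:ℝ)) hc
    push_cast at hc'
    have e2 : ∏ j ∈ Finset.range k, ((y:ℝ) - j * 2^J) = (2^J)^k * ∏ i ∈ Finset.range k, ((y:ℝ)/2^J - i) := by
      have : ((2:ℝ)^J)^k = ∏ i ∈ Finset.range k, (2:ℝ)^J := by simp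
      rw [this, ← Finset.prod_mul_distrib]
      apply Finset.prod_congr rfl
      intro i _
      field_simp
    rw [e2] at hc'
    have hk : (k.factorial:ℝ) ≠ 0 := by positivity
    push_cast
    rw [mul_pow, show (2^k * ((2:ℝ)^J)^k) * ((k.factorial:ℝ)⁻¹ * ∏ i ∈ Finset.range k, ((y:ℝ)/2^J - i)) =
      (k.factorial:ℝ)⁻¹ * (2^k * (((2:ℝ)^J)^k * ∏ i ∈ Finset.range k, ((y:ℝ)/2^J - i))) by ring, hc']
    field_simp
  rw [this]; exact intP_C c

/-- the Feldman-type basis -/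
noncomputable def fQ (h i : ℕ) : ℝ[X] := fbin (i % h) * (fbin h)^(i / h)

theorem fbin_shift_int (h J Δ : ℕ) (hΔ : ∀ i, 1 ≤ i → i ≤ h → i ∣ Δ) (y : ℤ) :
    C (((2 * 2^J : ℕ):ℝ)^h) * (fbin h).comp (C ((y:ℝ) / 2^J) + C (Δ:ℝ) * X) ∈ intP := by
  rw [fbin_vandermonde, Finset.mul_sum]
  apply Subring.sum_mem
  intro ij hij
  have hs : ij.1 + ij.2 = h := Finset.HasAntidiagonal.mem_antidiagonal.1 hij
  have : C (((2 * 2^J : ℕ):ℝ)^h) * ((fbin ij.1).comp (C ((y:ℝ) / 2^J)) * (fbin ij.2).comp (C (Δ:ℝ) * X)) =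
     C ((((2 * 2^J : ℕ)^ij.2:ℤ)):ℝ) * (C (((2 * 2^J : ℕ):ℝ)^ij.1) * (fbin ij.1).comp (C ((y:ℝ) / 2^J))) * (fbin ij.2).comp (C (Δ:ℝ) * X) := by
    rw [← hs, pow_add, C_mul]; push_cast; ring
  rw [this]
  exact intP.mul_mem (intP.mul_mem (intP_C _) (fbin_const_int _ _ _))
    (fbin_comp_int ij.2 Δ h (by omega) hΔ)

theorem fQ_int (h L J Δ i m : ℕ) (hh : 0 < h) (hi : i < h * L)
    (hΔ : ∀ i, 1 ≤ i → i ≤ h → i ∣ Δ) (y : ℤ) :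
    ∃ z : ℤ, ((2 * 2^J : ℕ):ℝ)^(h*L) * (Δ:ℝ)^m * (hasseDeriv m (fQ h i)).eval ((y:ℝ)/2^J) = z := by
  have h1 : C (((2 * 2^J : ℕ):ℝ)^(i%h)) * (fbin (i%h)).comp (C ((y:ℝ) / 2^J) + C (Δ:ℝ) * X) ∈ intP :=
    fbin_shift_int (i%h) J Δ (fun j hj hj' => hΔ j hj (hj'.trans (Nat.mod_lt _ hh).le)) y
  have h2 : (C (((2 * 2^J : ℕ):ℝ)^h) * (fbin h).comp (C ((y:ℝ) / 2^J) + C (Δ:ℝ) * X))^(i/h) ∈ intP :=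
    intP.pow_mem (fbin_shift_int h J Δ hΔ y) _
  have h3 : C (((2 * 2^J : ℕ):ℝ)^(h*L)) * (fQ h i).comp (C ((y:ℝ) / 2^J) + C (Δ:ℝ) * X) ∈ intP := by
    have : C (((2 * 2^J : ℕ):ℝ)^(h*L)) * (fQ h i).comp (C ((y:ℝ) / 2^J) + C (Δ:ℝ) * X) =
      C ((((2 * 2^J : ℕ)^(h*L-i):ℤ)):ℝ) * (C (((2 * 2^J : ℕ):ℝ)^(i%h)) * (fbin (i%h)).comp (C ((y:ℝ) / 2^J) + C (Δ:ℝ) * X) *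
        (C (((2 * 2^J : ℕ):ℝ)^h) * (fbin h).comp (C ((y:ℝ) / 2^J) + C (Δ:ℝ) * X))^(i/h)) := by
      have e : h*L = (h*L-i) + (i%h + h*(i/h)) := by rw [Nat.mod_add_div]; omega
      conv_lhs => rw [e]
      rw [fQ, mul_comp, pow_comp, pow_add, pow_add, pow_mul, mul_pow]
      push_cast
      simp only [C_mul, C_pow]
      ring
    rw [this]
    exact intP.mul_mem (intP_C _) (intP.mul_mem h1 h2)
  obtain ⟨z, hz⟩ := intP_coeff h3 m
  refine ⟨z, ?_⟩
  rw [← hz, coeff_C_mul]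
  have e : (fQ h i).comp (C ((y:ℝ) / 2^J) + C (Δ:ℝ) * X) = (taylor ((y:ℝ)/2^J) (fQ h i)).comp (C (Δ:ℝ) * X) := by
    rw [taylor_apply, comp_assoc]; congr 1; simp [add_comm]
  rw [e, comp_C_mul_X_coeff, taylor_coeff]
  ring

theorem fbin_maj (h h' : ℕ) (hh' : h' ≤ h) (Y ϱ ξ : ℝ) (hϱ : 1 ≤ ϱ) (h0 : 0 ≤ ξ) (h1 : ξ ≤ Y)
    (hY : (h:ℝ) ≤ Y) : maj ϱ (taylor ξ (fbin h')) ≤ (Y+ϱ)^h' / h'.factorial := by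
  have hϱ0 : 0 ≤ ϱ := by linarith
  have hlin : ∀ i < h, maj ϱ (taylor ξ (X - C (i:ℝ))) ≤ Y + ϱ := by
    intro i hi
    have e : taylor ξ (X - C (i:ℝ)) = C 1 * X^1 + C (ξ - i) := by
      simp only [map_sub, taylor_X, taylor_C, C_1, C_sub]; ring
    rw [e]
    refine (maj_add hϱ0 _ _).trans ?_
    rw [maj_C_mul_X_pow, maj_C]
    have : (i:ℝ) ≤ Y := le_trans (by exact_mod_cast hi.le) hY
    have : |ξ - i| ≤ Y := by rw [abs_le]; constructor <;> [linarith; linarith [(Nat.cast_nonneg i : (0:ℝ) ≤ i)]]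
    simp; linarith
  have e : taylor ξ (fbin h') = C ((h'.factorial:ℝ)⁻¹) * ∏ i ∈ Finset.range h', taylor ξ (X - C (i:ℝ)) := by
    rw [fbin, taylor_mul, taylor_C]
    congr 1
    exact map_prod (taylorAlgHom ξ) _ _
  rw [e, maj_C_mul, abs_of_pos (by positivity), div_eq_inv_mul]
  gcongr
  refine (maj_prod hϱ0 _ _).trans ?_
  calc ∏ i ∈ Finset.range h', maj ϱ (taylor ξ (X - C (i:ℝ))) ≤ ∏ i ∈ Finset.range h', (Y + ϱ) := by
        apply Finset.prod_le_prod
        · intro i _; exact maj_nonneg hϱ0 _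
        · intro i hi; exact hlin i ((Finset.mem_range.1 hi).trans_le hh')
    _ = _ := by simp

theorem pow_div_fact_mono (Z : ℝ) (h h' : ℕ) (hh' : h' ≤ h) (hZ : (h:ℝ) ≤ Z) :
    Z^h' / h'.factorial ≤ Z^h / h.factorial := by
  induction h, hh' using Nat.le_induction with
  | base => exact le_rfl
  | succ n hn ih =>
    push_cast at hZ
    refine (ih (by linarith)).trans ?_
    rw [pow_succ, Nat.factorial_succ]
    push_cast
    have hZ0 : 0 ≤ Z := by linarith [(Nat.cast_nonneg n : (0:ℝ) ≤ n)]
    rw [div_le_div_iff₀ (by positivity) (by positivity)]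
    have : 0 ≤ Z^n * n.factorial := by positivity
    nlinarith

theorem fQ_maj (h L i : ℕ) (hh : 0 < h) (hi : i < h * L) (Y ϱ ξ : ℝ) (hϱ : 1 ≤ ϱ) (h0 : 0 ≤ ξ) (h1 : ξ ≤ Y)
    (hY : (h:ℝ) ≤ Y) :
    maj ϱ (taylor ξ (fQ h i)) ≤ ((Y+ϱ)^h / h.factorial)^L := by
  have hϱ0 : 0 ≤ ϱ := by linarith
  have hY1 : 1 ≤ Y + ϱ := by linarith
  have hb := fbin_maj h h le_rfl Y ϱ ξ hϱ h0 h1 hY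
  have hb' := (fbin_maj h (i%h) (Nat.mod_lt _ hh).le Y ϱ ξ hϱ h0 h1 hY).trans
    (pow_div_fact_mono (Y+ϱ) h (i%h) (Nat.mod_lt _ hh).le (by linarith))
  have hge : 1 ≤ (Y+ϱ)^h / h.factorial := by
    rw [one_le_div (by positivity)]
    calc (h.factorial:ℝ) ≤ (h:ℝ)^h := by exact_mod_cast Nat.factorial_le_pow h
      _ ≤ (Y+ϱ)^h := by gcongr; linarith
  have e : taylor ξ (fQ h i) = (taylor ξ (fbin (i%h))) * (taylor ξ (fbin h))^(i/h) := by
    rw [fQ, taylor_mul, taylor_pow]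
  rw [e]
  refine (maj_mul hϱ0 _ _).trans ?_
  calc _ ≤ ((Y+ϱ)^h / h.factorial) * ((Y+ϱ)^h / h.factorial)^(i/h) := by
        apply mul_le_mul hb' _ (maj_nonneg hϱ0 _) (by positivity)
        refine (maj_pow hϱ0 _ _).trans ?_
        gcongr; exact maj_nonneg hϱ0 _
    _ = ((Y+ϱ)^h / h.factorial)^(i/h+1) := by rw [pow_succ]; ring
    _ ≤ _ := pow_le_pow_right₀ hge (Nat.div_lt_of_lt_mul hi)

theorem fbin_natDegree (h : ℕ) : (fbin h).natDegree = h ∧ fbin h ≠ 0 := by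
  have hc : ((h.factorial:ℝ)⁻¹) ≠ 0 := by positivity
  have hm : (∏ i ∈ Finset.range h, (X - C (i:ℝ))).Monic := monic_prod_of_monic _ _ (fun i _ => monic_X_sub_C _)
  constructor
  · rw [fbin, natDegree_C_mul hc, natDegree_prod_of_monic _ _ (fun i _ => monic_X_sub_C _)]
    simp only [natDegree_X_sub_C, Finset.sum_const, Finset.card_range, smul_eq_mul, mul_one]
  · rw [fbin]
    exact mul_ne_zero (by simpa using hc) hm.ne_zero

theorem fQ_degree (h i : ℕ) : (fQ h i).degree = i := by
  have hb := fbin_natDegree h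
  have hb' := fbin_natDegree (i%h)
  have hne : fQ h i ≠ 0 := mul_ne_zero hb'.2 (pow_ne_zero _ hb.2)
  rw [degree_eq_natDegree hne, fQ, natDegree_mul hb'.2 (pow_ne_zero _ hb.2),
    natDegree_pow, hb.1, hb'.1, mul_comm (i/h) h, Nat.mod_add_div]

noncomputable def fSeq (h : ℕ) : Polynomial.Sequence ℝ := ⟨fQ h, fQ_degree h⟩

theorem fQ_indep (h n : ℕ) (c : ℕ → ℝ) (hc : ∑ i ∈ Finset.range n, C (c i) * fQ h i = 0) :
    ∀ i < n, c i = 0 := by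
  have := linearIndependent_iff'.1 (fSeq h).linearIndependent (Finset.range n) c
    (by rw [← hc]; apply Finset.sum_congr rfl; intro i _; rw [smul_eq_C_mul]; rfl)
  intro i hi
  exact this i (Finset.mem_range.2 hi)

end

section
open Polynomial IntermediateField

theorem al_gt {α : ℝ} (hα : α^3 = α^2 + 1) : 1.46 < α := by
  by_contra h
  push Not at h
  rcases le_or_gt α 0 with h0 | h0
  · nlinarith [sq_nonneg α, pow_nonneg (neg_nonneg.2 h0) 3]
  · nlinarith [mul_nonneg h0.le (sub_nonneg.2 h), sq_nonneg (α - 1), mul_nonneg (mul_nonneg h0.le h0.le) (sub_nonneg.2 h)]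

theorem al_lt {α : ℝ} (hα : α^3 = α^2 + 1) : α < 1.47 := by
  by_contra h
  push Not at h
  nlinarith [mul_nonneg (mul_nonneg (by linarith : (0:ℝ) ≤ α) (by linarith : (0:ℝ) ≤ α)) (sub_nonneg.2 h)]

theorem int_of_monic_rat (x : ℚ) (p : ℤ[X]) (hp : p.Monic) (h : aeval x p = 0) : ∃ z : ℤ, x = z := by
  have hi : IsIntegral ℤ x := ⟨p, hp, by simpa [aeval_def] using h⟩
  obtain ⟨z, hz⟩ := IsIntegrallyClosed.isIntegral_iff.1 hi
  exact ⟨z, by simpa using hz.symm⟩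

noncomputable def pα : ℚ[X] := X^3 - X^2 - 1

theorem pα_monic : pα.Monic := by unfold pα; monicity!
theorem pα_natDegree : pα.natDegree = 3 := by unfold pα; compute_degree!

theorem pα_irred : Irreducible pα := by
  apply (Polynomial.Monic.irreducible_iff_roots_eq_zero_of_degree_le_three pα_monic
    (by rw [pα_natDegree]; norm_num) (by rw [pα_natDegree])).2
  rw [Multiset.eq_zero_iff_forall_notMem]
  intro x hx
  have hx' : x^3 - x^2 - 1 = 0 := by
    have := (mem_roots'.1 hx).2
    simpa [pα, IsRoot] using this
  obtain ⟨z, rfl⟩ := int_of_monic_rat x (X^3 - X^2 - 1) (by monicity!) (by simpa using hx')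
  have hz : z^3 - z^2 - 1 = 0 := by exact_mod_cast hx'
  have : z * (z * (z-1)) = 1 := by linarith [hz, show z * (z * (z-1)) = z^3 - z^2 by ring]
  rcases Int.isUnit_iff.1 (IsUnit.of_mul_eq_one _ this) with h | h <;> subst h <;> norm_num at this

theorem pα_minpoly {α : ℝ} (hα : α^3 = α^2 + 1) : minpoly ℚ α = pα :=
  (minpoly.eq_of_irreducible_of_monic pα_irred (by simp [pα, hα]) pα_monic).symm

theorem al_indep {α : ℝ} (hα : α^3 = α^2 + 1) (a b c : ℚ) (h : (a:ℝ) + b * α + c * α^2 = 0) :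
    a = 0 ∧ b = 0 ∧ c = 0 := by
  have hd : pα ∣ (C c * X^2 + C b * X + C a) := by
    rw [← pα_minpoly hα]
    apply minpoly.dvd
    simp
    linarith
  have h0 : (C c * X^2 + C b * X + C a : ℚ[X]) = 0 := by
    by_contra hne
    have h1 := natDegree_le_of_dvd hd hne
    rw [pα_natDegree] at h1
    have h2 : (C c * X^2 + C b * X + C a : ℚ[X]).natDegree ≤ 2 := natDegree_quadratic_le
    omega
  have e0 := congrArg (fun p => p.coeff 0) h0
  have e1 := congrArg (fun p => p.coeff 1) h0
  have e2 := congrArg (fun p => p.coeff 2) h0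
  simp [coeff_X, coeff_C] at e0 e1 e2
  exact ⟨e0, e1, e2⟩

theorem al_coords {α : ℝ} (hα : α^3 = α^2 + 1) (x : ℝ) (hx : x ∈ ℚ⟮α⟯) :
    ∃ a b c : ℚ, x = a + b * α + c * α^2 := by
  have hInt : IsIntegral ℚ α := ⟨pα, pα_monic, by simp [pα, hα]⟩
  have hx' : x ∈ Algebra.adjoin ℚ {α} := by
    rw [← IntermediateField.adjoin_simple_toSubalgebra_of_isAlgebraic hInt.isAlgebraic]
    exact hx
  rw [Algebra.adjoin_singleton_eq_range_aeval] at hx'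
  obtain ⟨p, rfl⟩ := hx'
  have hz : aeval α pα = 0 := by simp [pα, hα]
  have e : aeval α p = aeval α (p %ₘ pα) := (aeval_modByMonic_eq_self_of_root hz).symm
  have hd : (p %ₘ pα).natDegree < 3 := by
    have := natDegree_modByMonic_lt p pα_monic (by intro h; have := pα_natDegree; rw [h] at this; simp at this)
    rwa [pα_natDegree] at this
  refine ⟨(p %ₘ pα).coeff 0, (p %ₘ pα).coeff 1, (p %ₘ pα).coeff 2, ?_⟩
  show aeval α p = _
  rw [e, aeval_eq_sum_range' hd]
  simp [Finset.sum_range_succ, Algebra.smul_def]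

/- symmetric functions of a + b α + c α² -/
def sE1 (a b c : ℚ) : ℚ := 3*a + b + c
def sE2 (a b c : ℚ) : ℚ := 3*a^2 + 2*a*b + 2*a*c - 3*b*c - 2*c^2
def sE3 (a b c : ℚ) : ℚ :=
  a*(a*(a+b+c) - c*(b+c)) - c*(b*(a+b+c) - c*c) + (b+c)*(b*(b+c) - a*c)

theorem sq_coords {α : ℝ} (hα : α^3 = α^2 + 1) (η : ℝ) (hη : η ∈ ℚ⟮α⟯) (A B D : ℚ)
    (h : η^2 = A + B * α + D * α^2) :
    ∃ e1 e2 e3 : ℚ, e1^2 - 2*e2 = sE1 A B D ∧ e2^2 - 2*e1*e3 = sE2 A B D ∧ e3^2 = sE3 A B D := by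
  obtain ⟨a, b, c, rfl⟩ := al_coords hα η hη
  have hz := al_indep hα (a^2+2*b*c+c^2 - A) (2*a*b + c^2 - B) (b^2+2*a*c+2*b*c+c^2 - D) (by
    push_cast
    linear_combination h - (2 * b * c + c^2 * α + c^2) * hα)
  obtain ⟨h1, h2, h3⟩ := hz
  have hA : A = a^2+2*b*c+c^2 := by linarith
  have hB : B = 2*a*b+c^2 := by linarith
  have hD : D = b^2+2*a*c+2*b*c+c^2 := by linarith
  refine ⟨sE1 a b c, sE2 a b c, sE3 a b c, ?_, ?_, ?_⟩ <;> simp only [sE1, sE2, sE3, hA, hB, hD] <;> ring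

theorem no_sq_arith (e1 e2 e3 : ℚ) (A C : ℤ) (hA : Odd A) (hC : Odd C) (h1 : e1^2 - 2*e2 = A)
    (h2 : e2^2 = 2*e1*e3) (h3 : e3^2 = C^2) : False := by
  have h4 : e2^4 = 4 * C^2 * (A + 2*e2) := by
    linear_combination (e2^2 + 2*e1*e3) * h2 + 4*e3^2 * h1 + 4 * (A + 2*e2) * h3
  obtain ⟨z, rfl⟩ := int_of_monic_rat e2 (X^4 - Polynomial.C (8*C^2) * X - Polynomial.C (4*C^2*A))
    (by monicity!) (by
      rw [aeval_sub, aeval_sub, aeval_mul, aeval_C, aeval_C, aeval_X, aeval_X_pow]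
      simp only [algebraMap_int_eq, eq_intCast]
      push_cast; linarith)
  have h5 : z^4 = 4 * C^2 * (A + 2*z) := by exact_mod_cast h4
  have hev : Even z := by
    have : Even (z^4) := by rw [h5]; exact ⟨2*C^2*(A+2*z), by ring⟩
    exact (Int.even_pow.1 this).1
  obtain ⟨y, rfl⟩ := hev
  have h6 : 4 * y^4 = C^2 * (A + 4*y) := by
    have : (y+y)^4 = 16*y^4 := by ring
    rw [this] at h5
    linarith
  have hodd : Odd (C^2 * (A + 4*y)) := (hC.pow).mul (hA.add_even ⟨2*y, by ring⟩)
  rw [← h6] at hodd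
  exact (Int.not_even_iff_odd.2 hodd) ⟨2*y^4, by ring⟩

theorem al_nonsq {α : ℝ} (hα : α^3 = α^2 + 1) (η : ℝ) (hη : η ∈ ℚ⟮α⟯) : η^2 ≠ α := by
  intro h
  obtain ⟨e1, e2, e3, h1, h2, h3⟩ := sq_coords hα η hη 0 1 0 (by simpa using h)
  simp only [sE1, sE2, sE3] at h1 h2 h3
  exact no_sq_arith e1 e2 e3 1 1 odd_one odd_one (by push_cast; linarith) (by linarith) (by push_cast; linarith)

theorem w_arith (e1 e2 e3 c : ℚ) (A : ℤ) (hA : Odd A) (hc : c ≠ 0) (h1 : e1^2 - 2*e2 = A * c)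
    (h2 : e2^2 = 2*e1*e3) (h3 : e3^2 = 31 * c^3) : False := by
  have h30 : e3 ≠ 0 := by
    rintro rfl
    have : c^3 = 0 := by linarith
    exact hc (by simpa using this)
  set e := e3 / (31*c) with he
  have hene : e ≠ 0 := by rw [he]; positivity
  have hce : c = 31 * e^2 := by rw [he, div_pow, h3]; field_simp
  have h3' : e3 = 961 * e^3 := by
    have : e3 = e * (31 * c) := by rw [he]; field_simp
    rw [this, hce]; ring
  apply no_sq_arith (e1/e) (e2/e^2) 961 (31*A) 961 ((by decide : Odd (31:ℤ)).mul hA) (by decide)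
  · push_cast
    rw [div_pow, ← mul_div_assoc, ← sub_div, h1, hce]; field_simp
  · rw [div_pow, h2, h3']; field_simp
  · norm_num

theorem cw_nonsq {α : ℝ} (hα : α^3 = α^2 + 1) (η : ℝ) (hη : η ∈ ℚ⟮α⟯) (c : ℚ) (hc : c ≠ 0) :
    η^2 ≠ c * (3*α-2) := by
  intro h
  obtain ⟨e1, e2, e3, h1, h2, h3⟩ := sq_coords hα η hη (-2*c) (3*c) 0 (by push_cast; rw [h]; ring)
  simp only [sE1, sE2, sE3] at h1 h2 h3
  exact w_arith e1 e2 e3 c (-3) (by decide) hc (by push_cast; linarith) (by linarith) (by push_cast; linarith)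

theorem cwa_nonsq {α : ℝ} (hα : α^3 = α^2 + 1) (η : ℝ) (hη : η ∈ ℚ⟮α⟯) (c : ℚ) (hc : c ≠ 0) :
    η^2 ≠ c * (3*α-2) * α := by
  intro h
  obtain ⟨e1, e2, e3, h1, h2, h3⟩ := sq_coords hα η hη 0 (-2*c) (3*c) (by push_cast; rw [h]; ring)
  simp only [sE1, sE2, sE3] at h1 h2 h3
  exact w_arith e1 e2 e3 c 1 (by decide) hc (by push_cast; linarith) (by linarith) (by push_cast; linarith)

theorem sq_of_cube (G : ℕ) (hG : ¬ IsSquare G) (e : ℚ) (h : e^2 = (G:ℚ)^3) : False := by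
  have hG0 : (G:ℚ) ≠ 0 := by
    intro h0
    have : G = 0 := by exact_mod_cast h0
    subst this
    exact hG ⟨0, rfl⟩
  have h1 : IsSquare (G:ℚ) := ⟨e / G, by field_simp; rw [← h]⟩
  exact hG (Rat.isSquare_natCast_iff.1 h1)

theorem G_nonsq {α : ℝ} (hα : α^3 = α^2 + 1) (η : ℝ) (hη : η ∈ ℚ⟮α⟯) (G : ℕ) (hG : ¬ IsSquare G) :
    η^2 ≠ G := by
  intro h
  obtain ⟨e1, e2, e3, h1, h2, h3⟩ := sq_coords hα η hη G 0 0 (by push_cast; rw [h]; ring)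
  simp only [sE3] at h3
  exact sq_of_cube G hG e3 (by linarith)

theorem Ga_nonsq {α : ℝ} (hα : α^3 = α^2 + 1) (η : ℝ) (hη : η ∈ ℚ⟮α⟯) (G : ℕ) (hG : ¬ IsSquare G) :
    η^2 ≠ G * α := by
  intro h
  obtain ⟨e1, e2, e3, h1, h2, h3⟩ := sq_coords hα η hη 0 G 0 (by push_cast; rw [h]; ring)
  simp only [sE3] at h3
  exact sq_of_cube G hG e3 (by linarith)

/-- quadratic extension of a subfield of ℝ -/
def quadF (F : Subfield ℝ) (x : ℝ) (hx : x ∉ F) (hx2 : x^2 ∈ F) : Subfield ℝ where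
  carrier := {y | ∃ a ∈ F, ∃ b ∈ F, y = a + b * x}
  zero_mem' := ⟨0, F.zero_mem, 0, F.zero_mem, by simp⟩
  one_mem' := ⟨1, F.one_mem, 0, F.zero_mem, by simp⟩
  add_mem' := by
    rintro _ _ ⟨a, ha, b, hb, rfl⟩ ⟨c, hc, d, hd, rfl⟩
    exact ⟨a + c, F.add_mem ha hc, b + d, F.add_mem hb hd, by ring⟩
  neg_mem' := by
    rintro _ ⟨a, ha, b, hb, rfl⟩
    exact ⟨-a, F.neg_mem ha, -b, F.neg_mem hb, by ring⟩
  mul_mem' := by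
    rintro _ _ ⟨a, ha, b, hb, rfl⟩ ⟨c, hc, d, hd, rfl⟩
    exact ⟨a*c + b*d*x^2, F.add_mem (F.mul_mem ha hc) (F.mul_mem (F.mul_mem hb hd) hx2),
      a*d + b*c, F.add_mem (F.mul_mem ha hd) (F.mul_mem hb hc), by ring⟩
  inv_mem' := by
    rintro _ ⟨a, ha, b, hb, rfl⟩
    by_cases hb0 : b = 0
    · subst hb0
      exact ⟨a⁻¹, F.inv_mem ha, 0, F.zero_mem, by simp⟩
    · have h1 : a + b * x ≠ 0 := by
        intro h
        apply hx
        have : x = (-a) / b := by field_simp; linarith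
        rw [this]; exact F.div_mem (F.neg_mem ha) hb
      have h2 : a - b * x ≠ 0 := by
        intro h
        apply hx
        have : x = a / b := by field_simp; linarith
        rw [this]; exact F.div_mem ha hb
      have hd : a^2 - b^2*x^2 ≠ 0 := by
        have : a^2 - b^2*x^2 = (a + b*x)*(a - b*x) := by ring
        rw [this]; exact mul_ne_zero h1 h2
      have hdF : a^2 - b^2*x^2 ∈ F := F.sub_mem (F.pow_mem ha 2) (F.mul_mem (F.pow_mem hb 2) hx2)
      refine ⟨a / (a^2 - b^2*x^2), F.div_mem ha hdF, -b / (a^2 - b^2*x^2), F.div_mem (F.neg_mem hb) hdF, ?_⟩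
      field_simp
      ring

theorem quadF_base (F : Subfield ℝ) (x : ℝ) (hx : x ∉ F) (hx2 : x^2 ∈ F) {y : ℝ} (hy : y ∈ F) :
    y ∈ quadF F x hx hx2 := ⟨y, hy, 0, F.zero_mem, by simp⟩

theorem quadF_gen (F : Subfield ℝ) (x : ℝ) (hx : x ∉ F) (hx2 : x^2 ∈ F) :
    x ∈ quadF F x hx hx2 := ⟨0, F.zero_mem, 1, F.one_mem, by simp⟩

theorem quadF_sqrt (F : Subfield ℝ) (x : ℝ) (hx : x ∉ F) (hx2 : x^2 ∈ F) {y : ℝ}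
    (hy : y ∈ quadF F x hx hx2) (hy2 : y^2 ∈ F) : y ∈ F ∨ y * x ∈ F := by
  obtain ⟨a, ha, b, hb, rfl⟩ := hy
  by_cases hab : a * b = 0
  · rcases mul_eq_zero.1 hab with h | h
    · right
      have : (a + b*x) * x = b * x^2 := by rw [h]; ring
      rw [this]; exact F.mul_mem hb hx2
    · left; rw [h]; simpa using ha
  · exfalso
    apply hx
    have : x = ((a + b*x)^2 - a^2 - b^2*x^2) / (2*(a*b)) := by
      rw [eq_div_iff (mul_ne_zero two_ne_zero hab)]; ring
    rw [this]
    have h2 : (2:ℝ) ∈ F := by simpa using F.natCast_mem 2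
    exact F.div_mem (F.sub_mem (F.sub_mem hy2 (F.pow_mem ha 2)) (F.mul_mem (F.pow_mem hb 2) hx2))
      (F.mul_mem h2 (F.mul_mem ha hb))

theorem split_lemma {ι : Type*} (F : Subfield ℝ) (x : ℝ) (hx : x ∉ F) (hx2 : x^2 ∈ F) (s : Finset ι)
    (f : ι → ℝ) (n : ι → ℕ) (hf : ∀ i ∈ s, f i ∈ F) (h : ∑ i ∈ s, f i * x^(n i) = 0) (b : ℕ) (hb : b < 2) :
    ∑ i ∈ s.filter (fun i => n i % 2 = b), f i * x^(n i) = 0 := by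
  have hx0 : x ≠ 0 := fun h => hx (h ▸ F.zero_mem)
  have e : ∀ b, b < 2 → ∑ i ∈ s.filter (fun i => n i % 2 = b), f i * x^(n i) =
      (∑ i ∈ s.filter (fun i => n i % 2 = b), f i * (x^2)^(n i / 2)) * x^b := by
    intro b _
    rw [Finset.sum_mul]
    apply Finset.sum_congr rfl
    intro i hi
    have hi2 := (Finset.mem_filter.1 hi).2
    conv_lhs => rw [← Nat.div_add_mod (n i) 2, hi2, pow_add, pow_mul]
    ring
  have hmem : ∀ b, ∑ i ∈ s.filter (fun i => n i % 2 = b), f i * (x^2)^(n i / 2) ∈ F := by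
    intro b
    exact F.sum_mem fun i hi => F.mul_mem (hf i (Finset.mem_filter.1 hi).1) (F.pow_mem hx2 _)
  have htot : ∑ i ∈ s.filter (fun i => n i % 2 = 0), f i * x^(n i) +
      ∑ i ∈ s.filter (fun i => n i % 2 = 1), f i * x^(n i) = 0 := by
    rw [← h, ← Finset.sum_filter_add_sum_filter_not s (fun i => n i % 2 = 0)]
    congr 2
    ext i
    simp only [Finset.mem_filter]
    have := Nat.mod_two_eq_zero_or_one (n i)
    constructor
    · rintro ⟨h1, h2⟩; exact ⟨h1, by omega⟩
    · rintro ⟨h1, h2⟩; exact ⟨h1, by omega⟩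
  rw [e 0 (by norm_num), e 1 (by norm_num), pow_zero, mul_one, pow_one] at htot
  have h1 : ∑ i ∈ s.filter (fun i => n i % 2 = 1), f i * (x^2)^(n i / 2) = 0 := by
    by_contra hne
    apply hx
    have : x = -(∑ i ∈ s.filter (fun i => n i % 2 = 0), f i * (x^2)^(n i / 2)) /
      (∑ i ∈ s.filter (fun i => n i % 2 = 1), f i * (x^2)^(n i / 2)) := by
      field_simp; linarith
    rw [this]; exact F.div_mem (F.neg_mem (hmem 0)) (hmem 1)
  have h0 : ∑ i ∈ s.filter (fun i => n i % 2 = 0), f i * (x^2)^(n i / 2) = 0 := by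
    rw [h1] at htot; linarith
  rw [e b hb]
  interval_cases b
  · rw [h0, zero_mul]
  · rw [h1, zero_mul]

end

section
open Polynomial IntermediateField

theorem kummer_split {ι : Type*} {α : ℝ} (hα : α^3 = α^2 + 1) (G : ℕ) (hG : ¬ IsSquare G) (c : ℚ) (hc : 0 < c)
    (x1 x2 x3 : ℝ) (h1 : x1^2 = α) (h2 : x2^2 = G) (h3 : x3^2 = c * (3*α-2))
    (s : Finset ι) (f : ι → ℤ) (n1 n2 n3 : ι → ℕ)
    (h : ∑ i ∈ s, (f i : ℝ) * (x1^(n1 i) * x2^(n2 i) * x3^(n3 i)) = 0)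
    (b1 b2 b3 : ℕ) (hb1 : b1 < 2) (hb2 : b2 < 2) (hb3 : b3 < 2) :
    ∑ i ∈ s.filter (fun i => n1 i % 2 = b1 ∧ n2 i % 2 = b2 ∧ n3 i % 2 = b3),
      (f i : ℝ) * (x1^(n1 i) * x2^(n2 i) * x3^(n3 i)) = 0 := by
  set K : Subfield ℝ := (ℚ⟮α⟯).toSubfield with hK
  have hαK : α ∈ K := mem_adjoin_simple_self ℚ α
  have hQ : ∀ r : ℚ, (r:ℝ) ∈ K := fun r => (ℚ⟮α⟯).algebraMap_mem r
  have hG0 : G ≠ 0 := by rintro rfl; exact hG ⟨0, rfl⟩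
  have hGq : (G:ℚ) ≠ 0 := by exact_mod_cast hG0
  have hGK : (G:ℝ) ∈ K := by simpa using hQ G
  have hx1 : x1 ∉ K := fun hx => al_nonsq hα x1 hx h1
  have hx1K : x1^2 ∈ K := h1 ▸ hαK
  set F1 := quadF K x1 hx1 hx1K with hF1
  have hx2K : x2^2 ∈ K := h2 ▸ hGK
  have hx2 : x2 ∉ F1 := by
    intro hx
    rcases quadF_sqrt K x1 hx1 hx1K hx hx2K with h | h
    · exact G_nonsq hα x2 h G hG h2
    · exact Ga_nonsq hα _ h G hG (by rw [mul_pow, h1, h2])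
  have hK1 : ∀ {y}, y ∈ K → y ∈ F1 := fun hy => quadF_base K x1 hx1 hx1K hy
  set F2 := quadF F1 x2 hx2 (hK1 hx2K) with hF2
  have hK2 : ∀ {y}, y ∈ F1 → y ∈ F2 := fun hy => quadF_base F1 x2 hx2 (hK1 hx2K) hy
  have hx3K : x3^2 ∈ K := by
    rw [h3]
    have h32 : ((3:ℚ):ℝ) * α - ((2:ℚ):ℝ) ∈ K := K.sub_mem (K.mul_mem (hQ 3) hαK) (hQ 2)
    exact K.mul_mem (hQ c) (by simpa using h32)
  have hx3 : x3 ∉ F2 := by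
    intro hx
    rcases quadF_sqrt F1 x2 hx2 (hK1 hx2K) hx (hK1 hx3K) with h | h
    · rcases quadF_sqrt K x1 hx1 hx1K h hx3K with h | h
      · exact cw_nonsq hα x3 h c hc.ne' h3
      · exact cwa_nonsq hα _ h c hc.ne' (by rw [mul_pow, h1, h3])
    · rcases quadF_sqrt K x1 hx1 hx1K h (by rw [mul_pow]; exact K.mul_mem hx3K hx2K) with h | h
      · exact cw_nonsq hα _ h (c*G) (mul_ne_zero hc.ne' hGq) (by rw [mul_pow, h2, h3]; push_cast; ring)
      · exact cwa_nonsq hα _ h (c*G) (mul_ne_zero hc.ne' hGq) (by rw [mul_pow, mul_pow, h1, h2, h3]; push_cast; ring)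
  have hf : ∀ i, (f i : ℝ) ∈ K := fun i => by simpa using hQ (f i)
  have hx1F : x1 ∈ F1 := quadF_gen K x1 hx1 hx1K
  have hx2F : x2 ∈ F2 := quadF_gen F1 x2 hx2 (hK1 hx2K)
  have s1 := split_lemma F2 x3 hx3 (hK2 (hK1 hx3K)) s (fun i => (f i:ℝ) * (x1^(n1 i) * x2^(n2 i))) n3
    (fun i _ => F2.mul_mem (hK2 (hK1 (hf i))) (F2.mul_mem (F2.pow_mem (hK2 hx1F) _) (F2.pow_mem hx2F _)))
    (by rw [← h]; apply Finset.sum_congr rfl; intro i _; ring) b3 hb3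
  have hx30 : x3 ≠ 0 := fun h => hx3 (h ▸ F2.zero_mem)
  have hx20 : x2 ≠ 0 := fun h => hx2 (h ▸ F1.zero_mem)
  -- rewrite x3 powers: same parity
  have s1' : ∑ i ∈ s.filter (fun i => n3 i % 2 = b3), ((f i:ℝ) * (x1^(n1 i)) * (x3^2)^(n3 i/2)) * x2^(n2 i) = 0 := by
    have e : ∑ i ∈ s.filter (fun i => n3 i % 2 = b3), (fun i => (f i:ℝ) * (x1^(n1 i) * x2^(n2 i))) i * x3^(n3 i) =
       (∑ i ∈ s.filter (fun i => n3 i % 2 = b3), ((f i:ℝ) * (x1^(n1 i)) * (x3^2)^(n3 i/2)) * x2^(n2 i)) * x3^b3 := by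
      rw [Finset.sum_mul]
      apply Finset.sum_congr rfl
      intro i hi
      have hi2 := (Finset.mem_filter.1 hi).2
      have : x3^(n3 i) = (x3^2)^(n3 i/2) * x3^b3 := by
        conv_lhs => rw [← Nat.div_add_mod (n3 i) 2, hi2, pow_add, pow_mul]
      simp only [this]; ring
    rw [e] at s1
    exact (mul_eq_zero.1 s1).resolve_right (pow_ne_zero _ hx30)
  have s2 := split_lemma F1 x2 hx2 (hK1 hx2K) _ _ n2 (fun i _ => F1.mul_mem (F1.mul_mem (hK1 (hf i)) (F1.pow_mem hx1F _))
    (F1.pow_mem (hK1 hx3K) _)) s1' b2 hb2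
  have s2' : ∑ i ∈ (s.filter (fun i => n3 i % 2 = b3)).filter (fun i => n2 i % 2 = b2),
      ((f i:ℝ) * (x3^2)^(n3 i/2) * (x2^2)^(n2 i/2)) * x1^(n1 i) = 0 := by
    have e : ∑ i ∈ (s.filter (fun i => n3 i % 2 = b3)).filter (fun i => n2 i % 2 = b2), ((f i:ℝ) * (x1^(n1 i)) * (x3^2)^(n3 i/2)) * x2^(n2 i) =
       (∑ i ∈ (s.filter (fun i => n3 i % 2 = b3)).filter (fun i => n2 i % 2 = b2),
      ((f i:ℝ) * (x3^2)^(n3 i/2) * (x2^2)^(n2 i/2)) * x1^(n1 i)) * x2^b2 := by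
      rw [Finset.sum_mul]
      apply Finset.sum_congr rfl
      intro i hi
      have hi2 := (Finset.mem_filter.1 hi).2
      have : x2^(n2 i) = (x2^2)^(n2 i/2) * x2^b2 := by
        conv_lhs => rw [← Nat.div_add_mod (n2 i) 2, hi2, pow_add, pow_mul]
      simp only [this]; ring
    rw [e] at s2
    exact (mul_eq_zero.1 s2).resolve_right (pow_ne_zero _ hx20)
  have s3 := split_lemma K x1 hx1 hx1K _ _ n1 (fun i _ => K.mul_mem (K.mul_mem (hf i) (K.pow_mem hx3K _))
    (K.pow_mem hx2K _)) s2' b1 hb1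
  have hset : s.filter (fun i => n1 i % 2 = b1 ∧ n2 i % 2 = b2 ∧ n3 i % 2 = b3) =
      ((s.filter (fun i => n3 i % 2 = b3)).filter (fun i => n2 i % 2 = b2)).filter (fun i => n1 i % 2 = b1) := by
    ext i; simp only [Finset.mem_filter]; tauto
  rw [hset]
  have e : ∑ i ∈ ((s.filter (fun i => n3 i % 2 = b3)).filter (fun i => n2 i % 2 = b2)).filter (fun i => n1 i % 2 = b1),
      (f i : ℝ) * (x1^(n1 i) * x2^(n2 i) * x3^(n3 i)) = (∑ i ∈ ((s.filter (fun i => n3 i % 2 = b3)).filter (fun i => n2 i % 2 = b2)).filter (fun i => n1 i % 2 = b1),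
      ((f i:ℝ) * (x3^2)^(n3 i/2) * (x2^2)^(n2 i/2)) * x1^(n1 i)) * (x2^b2 * x3^b3) := by
    rw [Finset.sum_mul]
    apply Finset.sum_congr rfl
    intro i hi
    rw [← hset] at hi
    obtain ⟨_, _, hi2, hi3⟩ := Finset.mem_filter.1 hi
    have e2 : x2^(n2 i) = (x2^2)^(n2 i/2) * x2^b2 := by
      conv_lhs => rw [← Nat.div_add_mod (n2 i) 2, hi2, pow_add, pow_mul]
    have e3 : x3^(n3 i) = (x3^2)^(n3 i/2) * x3^b3 := by
      conv_lhs => rw [← Nat.div_add_mod (n3 i) 2, hi3, pow_add, pow_mul]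
    rw [e2, e3]; ring
  rw [e, s3, zero_mul]

theorem liouville_gen (L : Type*) [Field L] [Algebra ℚ L] [FiniteDimensional ℚ L] (ι : L →ₐ[ℚ] ℝ)
    (hfin : Module.finrank ℚ L ≤ 24) (ξ : L) (hξ : IsIntegral ℤ ξ) (Bd : ℝ) (hBd : 1 ≤ Bd)
    (hσ : ∀ σ : L →ₐ[ℚ] ℂ, ‖σ ξ‖ ≤ Bd) : ξ = 0 ∨ 1 ≤ |ι ξ| * Bd^23 := by
  by_cases h0 : ξ = 0
  · exact Or.inl h0
  right
  have hN : Algebra.norm ℚ ξ ≠ 0 := Algebra.norm_ne_zero_iff.2 h0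
  have hNi : IsIntegral ℤ (Algebra.norm ℚ ξ) := Algebra.isIntegral_norm ℚ hξ
  obtain ⟨z, hz⟩ := IsIntegrallyClosed.isIntegral_iff.1 hNi
  have hz0 : z ≠ 0 := by rintro rfl; exact hN (by simpa using hz.symm)
  have hprod := Algebra.norm_eq_prod_embeddings ℚ ℂ ξ
  have h1 : (1:ℝ) ≤ ‖(algebraMap ℚ ℂ) (Algebra.norm ℚ ξ)‖ := by
    rw [← hz]
    simp only [algebraMap_int_eq, eq_intCast, eq_ratCast, Rat.cast_intCast, Complex.norm_intCast]
    exact_mod_cast Int.one_le_abs hz0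
  rw [hprod, norm_prod] at h1
  classical
  set σ0 : L →ₐ[ℚ] ℂ := (Algebra.ofId ℝ ℂ |>.restrictScalars ℚ).comp ι with hσ0
  rw [← Finset.mul_prod_erase Finset.univ _ (Finset.mem_univ σ0)] at h1
  have e0 : ‖σ0 ξ‖ = |ι ξ| := by
    simp [hσ0, Algebra.ofId_apply]
  rw [e0] at h1
  refine h1.trans (mul_le_mul_of_nonneg_left ?_ (abs_nonneg _))
  calc ∏ σ ∈ Finset.univ.erase σ0, ‖σ ξ‖ ≤ ∏ σ ∈ Finset.univ.erase σ0, Bd :=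
        Finset.prod_le_prod (fun _ _ => norm_nonneg _) (fun σ _ => hσ σ)
    _ = Bd^((Finset.univ.erase σ0).card) := by simp
    _ ≤ Bd^23 := by
      apply pow_le_pow_right₀ hBd
      rw [Finset.card_erase_of_mem (Finset.mem_univ _), Finset.card_univ, AlgHom.card]
      omega

theorem norm_root_le {α : ℝ} (hα : α^3 = α^2 + 1) (z : ℂ) (hz : z^3 = z^2 + 1) : ‖z‖ ≤ α := by
  have h1 : ‖z‖^3 ≤ ‖z‖^2 + 1 := by
    rw [← norm_pow, hz, ← norm_pow]
    exact (norm_add_le _ _).trans (by simp)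
  by_contra h
  push Not at h
  have hg := al_gt hα
  have h0 := norm_nonneg z
  nlinarith [mul_pos (sub_pos.2 h) (by linarith : (0:ℝ) < α), mul_pos (mul_pos (sub_pos.2 h) (by linarith : (0:ℝ) < α)) (by linarith : (0:ℝ) < α), mul_pos (mul_pos (sub_pos.2 h) (by linarith : (0:ℝ) < ‖z‖)) (by linarith : (0:ℝ) < α), mul_pos (mul_pos (sub_pos.2 h) (by linarith : (0:ℝ) < ‖z‖)) (by linarith : (0:ℝ) < ‖z‖)]

end

section
open Polynomial IntermediateField

theorem finrank_quad_le (K : IntermediateField ℚ ℝ) (x : ℝ) (hx : x^2 ∈ K) :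
    FiniteDimensional K K⟮x⟯ ∧ Module.finrank K K⟮x⟯ ≤ 2 := by
  have hz : aeval x (X^2 - C (⟨x^2, hx⟩ : K)) = 0 := by simp
  have hm : (X^2 - C (⟨x^2, hx⟩ : K)).Monic := by monicity!
  have hInt : IsIntegral K x := ⟨_, hm, by simpa [aeval_def] using hz⟩
  refine ⟨adjoin.finiteDimensional hInt, ?_⟩
  rw [adjoin.finrank hInt]
  refine (natDegree_le_of_dvd (minpoly.dvd K x hz) hm.ne_zero).trans ?_
  compute_degree

theorem tower24_gen (F K M : Type*) [Field F] [Field K] [Field M] [Algebra F K] [Algebra K M] [Algebra F M]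
    [IsScalarTower F K M] [FiniteDimensional F K]
    [FiniteDimensional K M] (h3 : Module.finrank F K = 3) (h8 : Module.finrank K M ≤ 8) :
    Module.finrank F M ≤ 24 := by
  rw [← Module.finrank_mul_finrank F K M, h3]
  omega

theorem tower24 (K : IntermediateField ℚ ℝ) [FiniteDimensional ℚ K] (M : IntermediateField K ℝ)
    [FiniteDimensional K M] (h3 : Module.finrank ℚ K = 3) (h8 : Module.finrank K M ≤ 8) :
    FiniteDimensional ℚ M ∧ Module.finrank ℚ M ≤ 24 := by
  exact ⟨FiniteDimensional.trans ℚ K M, tower24_gen ℚ K M h3 h8⟩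

theorem field_exists {α : ℝ} (hα : α^3 = α^2 + 1) (x1 x2 x3 : ℝ)
    (h1 : x1^2 ∈ ℚ⟮α⟯) (h2 : x2^2 ∈ ℚ⟮α⟯) (h3 : x3^2 ∈ ℚ⟮α⟯) :
    ∃ (M : IntermediateField ℚ⟮α⟯ ℝ), FiniteDimensional ℚ M ∧ Module.finrank ℚ M ≤ 24 ∧
      x1 ∈ M ∧ x2 ∈ M ∧ x3 ∈ M := by
  have hInt : IsIntegral ℚ α := ⟨pα, pα_monic, by simp [pα, hα]⟩
  have hK : FiniteDimensional ℚ ℚ⟮α⟯ := adjoin.finiteDimensional hInt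
  have hK3 : Module.finrank ℚ ℚ⟮α⟯ = 3 := by
    rw [adjoin.finrank hInt, pα_minpoly hα, pα_natDegree]
  obtain ⟨f1, r1⟩ := finrank_quad_le _ x1 h1
  obtain ⟨f2, r2⟩ := finrank_quad_le _ x2 h2
  obtain ⟨f3, r3⟩ := finrank_quad_le _ x3 h3
  let K := ℚ⟮α⟯
  let A : IntermediateField K ℝ := K⟮x1⟯
  let B : IntermediateField K ℝ := K⟮x2⟯
  let D : IntermediateField K ℝ := K⟮x3⟯
  have fA : FiniteDimensional K A := f1
  have fB : FiniteDimensional K B := f2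
  have fD : FiniteDimensional K D := f3
  have fAB : FiniteDimensional K (A ⊔ B : IntermediateField K ℝ) := finiteDimensional_sup A B
  have fM : FiniteDimensional K (A ⊔ B ⊔ D : IntermediateField K ℝ) := finiteDimensional_sup _ D
  have hr : Module.finrank K (A ⊔ B ⊔ D : IntermediateField K ℝ) ≤ 8 := by
    have a1 := finrank_sup_le (A ⊔ B) D
    have a2 := finrank_sup_le A B
    calc _ ≤ _ := a1
      _ ≤ (2 * 2) * 2 := Nat.mul_le_mul (a2.trans (Nat.mul_le_mul r1 r2)) r3
  obtain ⟨t1, t2⟩ := tower24 K (A ⊔ B ⊔ D) hK3 hr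
  refine ⟨A ⊔ B ⊔ D, t1, t2, ?_, ?_, ?_⟩
  · exact (le_sup_left.trans le_sup_left : A ≤ A ⊔ B ⊔ D) (mem_adjoin_simple_self K x1)
  · exact (le_sup_right.trans le_sup_left : B ≤ A ⊔ B ⊔ D) (mem_adjoin_simple_self K x2)
  · exact (le_sup_right : D ≤ A ⊔ B ⊔ D) (mem_adjoin_simple_self K x3)

theorem liouville_field {ι : Type*} (L : Type*) [Field L] [Algebra ℚ L] [FiniteDimensional ℚ L] (emb : L →ₐ[ℚ] ℝ)
    (hfin : Module.finrank ℚ L ≤ 24) {α : ℝ} (hα : α^3 = α^2 + 1) (G : ℕ)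
    (p q : ℕ) (hq : 0 < q)
    (x1 x2 : ℝ) (h1 : x1^2 = α) (h2 : x2^2 = G) (hx1 : 0 ≤ x1) (hx2 : 0 ≤ x2)
    (X1 X2 X3 : L) (e1 : X1^6 = X1^4 + 1) (e2 : X2^2 = G) (e3 : (q:L) * X3^2 = p * (3*X1^2-2))
    (V : ℝ) (hV1 : (q:ℝ) ≤ V) (hV2 : (p:ℝ) * (3*α+2) ≤ V)
    (s : Finset ι) (f : ι → ℤ) (n1 n2 n3 : ι → ℕ) (E : ℕ) (hn3 : ∀ i ∈ s, n3 i ≤ 2 * E)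
    (Nc Em R : ℝ) (hNc : (s.card:ℝ) ≤ Nc) (hNc1 : 1 ≤ Nc) (hEm : ∀ i ∈ s, |(f i:ℝ)| ≤ Em) (hEm1 : 1 ≤ Em) (hR : 0 ≤ R)
    (hRx : ∀ i ∈ s, x1^(n1 i) * x2^(n2 i) ≤ Real.exp R) :
    ∑ i ∈ s, (f i : ℝ) * ((emb X1)^(n1 i) * (emb X2)^(n2 i) * (emb X3)^(n3 i)) = 0 ∨
    1 ≤ |∑ i ∈ s, (f i : ℝ) * ((emb X1)^(n1 i) * (emb X2)^(n2 i) * (emb X3)^(n3 i))| * V^E *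
      (Nc * Em * Real.exp R * V^E)^23 := by
  have hg := al_gt hα
  have hV : 1 ≤ V := le_trans (by exact_mod_cast hq) hV1
  set ξ : L := ∑ i ∈ s, (f i : L) * (X1^(n1 i) * X2^(n2 i) * ((q:L)^E * X3^(n3 i))) with hξd
  have iX1 : IsIntegral ℤ X1 := by
    refine ⟨X^6 - X^4 - 1, by monicity!, ?_⟩
    simp [e1]
  have iX2 : IsIntegral ℤ X2 := by
    apply IsIntegral.of_pow (n := 2) (by norm_num)
    rw [e2]
    simpa using (isIntegral_algebraMap (R := ℤ) (A := L) (x := (G:ℤ)))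
  have key : ∀ n, n ≤ 2*E → ((q:L)^E * X3^n)^2 = (q:L)^(2*E-n) * (p:L)^n * (3*X1^2-2)^n := by
    intro n hn
    have : ((q:L)^E * X3^n)^2 = (q:L)^(2*E-n) * ((q:L) * X3^2)^n := by
      rw [mul_pow, mul_pow, ← pow_mul, ← pow_mul, ← pow_mul, ← mul_assoc, ← pow_add]
      congr 2
      · omega
      · ring
    rw [this, e3, mul_pow, mul_assoc]
  have natI : ∀ n : ℕ, IsIntegral ℤ (n:L) := fun n => by
    simpa using (isIntegral_algebraMap (R := ℤ) (A := L) (x := (n:ℤ)))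
  have intI : ∀ n : ℤ, IsIntegral ℤ (n:L) := fun n => by
    simpa using (isIntegral_algebraMap (R := ℤ) (A := L) (x := n))
  have iw : IsIntegral ℤ (3*X1^2-2) := by
    have h3 := natI 3
    have h2 := natI 2
    push_cast at h3 h2
    exact (h3.mul (iX1.pow 2)).sub h2
  have iX3 : ∀ n, n ≤ 2*E → IsIntegral ℤ ((q:L)^E * X3^n) := by
    intro n hn
    apply IsIntegral.of_pow (n := 2) (by norm_num)
    rw [key n hn]
    exact (((natI q).pow _).mul ((natI p).pow _)).mul (iw.pow _)
  have iξ : IsIntegral ℤ ξ := by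
    apply IsIntegral.sum
    intro i hi
    exact (intI _).mul (((iX1.pow _).mul (iX2.pow _)).mul (iX3 _ (hn3 i hi)))
  have hσ : ∀ σ : L →ₐ[ℚ] ℂ, ‖σ ξ‖ ≤ Nc * Em * Real.exp R * V^E := by
    intro σ
    have b1 : ‖σ X1‖ ≤ x1 := by
      have : ‖(σ X1)^2‖ ≤ α := by
        apply norm_root_le hα
        rw [← map_pow, ← map_pow, ← map_pow, ← pow_mul, ← pow_mul, e1]; simp
      rw [norm_pow, ← h1] at this
      exact (pow_le_pow_iff_left₀ (norm_nonneg _) hx1 (by norm_num)).1 this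
    have b2 : ‖σ X2‖ ≤ x2 := by
      have : ‖(σ X2)^2‖ ≤ x2^2 := by
        rw [← map_pow, e2, h2]; simp
      rw [norm_pow] at this
      exact (pow_le_pow_iff_left₀ (norm_nonneg _) hx2 (by norm_num)).1 this
    have bw : ‖σ (3*X1^2-2)‖ ≤ 3*α+2 := by
      have e : σ (3*X1^2-2) = 3 * (σ X1)^2 - 2 := by
        rw [map_sub, map_mul, map_pow, map_ofNat, map_ofNat]
      rw [e]
      refine (norm_sub_le _ _).trans ?_
      rw [norm_mul, norm_pow]
      have : ‖σ X1‖^2 ≤ α := by rw [← h1]; gcongr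
      simp; linarith
    have b3 : ∀ n, n ≤ 2*E → ‖σ ((q:L)^E * X3^n)‖ ≤ V^E := by
      intro n hn
      have : ‖σ ((q:L)^E * X3^n)‖^2 ≤ (V^E)^2 := by
        rw [← norm_pow, ← map_pow, key n hn, map_mul, map_mul, norm_mul, norm_mul, map_pow, map_pow, map_pow,
          norm_pow, norm_pow, norm_pow]
        simp only [map_natCast, Complex.norm_natCast]
        calc (q:ℝ)^(2*E-n) * (p:ℝ)^n * ‖σ (3*X1^2-2)‖^n ≤ (q:ℝ)^(2*E-n) * (p:ℝ)^n * (3*α+2)^n := by gcongr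
          _ = (q:ℝ)^(2*E-n) * ((p:ℝ) * (3*α+2))^n := by rw [mul_pow]; ring
          _ ≤ V^(2*E-n) * V^n := by gcongr
          _ = (V^E)^2 := by rw [← pow_add, ← pow_mul]; congr 1; omega
      exact (pow_le_pow_iff_left₀ (norm_nonneg _) (by positivity) (by norm_num)).1 this
    rw [hξd, map_sum]
    refine (norm_sum_le _ _).trans ?_
    calc ∑ i ∈ s, ‖σ ((f i : L) * (X1^(n1 i) * X2^(n2 i) * ((q:L)^E * X3^(n3 i))))‖
        ≤ ∑ i ∈ s, Em * Real.exp R * V^E := by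
          apply Finset.sum_le_sum
          intro i hi
          rw [map_mul, map_mul (σ), norm_mul, norm_mul, mul_assoc]
          have t1 : ‖σ (f i : L)‖ ≤ Em := by
            have : ‖σ (f i : L)‖ = |(f i:ℝ)| := by simp
            rw [this]; exact hEm i hi
          have t2 : ‖σ (X1^(n1 i) * X2^(n2 i))‖ ≤ Real.exp R := by
            rw [map_mul, map_pow, map_pow, norm_mul, norm_pow, norm_pow]
            refine le_trans ?_ (hRx i hi)
            gcongr
          exact mul_le_mul t1 (mul_le_mul t2 (b3 _ (hn3 i hi)) (norm_nonneg _) (Real.exp_pos _).le)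
            (by positivity) (by linarith)
      _ = s.card * (Em * Real.exp R * V^E) := by rw [Finset.sum_const, nsmul_eq_mul]
      _ ≤ Nc * (Em * Real.exp R * V^E) := by gcongr
      _ = _ := by ring
  have hBd : 1 ≤ Nc * Em * Real.exp R * V^E :=
    one_le_mul_of_one_le_of_one_le (one_le_mul_of_one_le_of_one_le (one_le_mul_of_one_le_of_one_le hNc1 hEm1)
      (Real.one_le_exp hR)) (one_le_pow₀ hV)
  have eξ : emb ξ = (q:ℝ)^E * ∑ i ∈ s, (f i : ℝ) * ((emb X1)^(n1 i) * (emb X2)^(n2 i) * (emb X3)^(n3 i)) := by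
    rw [hξd, map_sum, Finset.mul_sum]
    apply Finset.sum_congr rfl
    intro i _
    simp; ring
  have hqR : (q:ℝ)^E ≠ 0 := by positivity
  rcases liouville_gen L emb hfin ξ iξ _ hBd hσ with h | h
  · left
    rw [h, map_zero] at eξ
    exact (mul_eq_zero.1 eξ.symm).resolve_left hqR
  · right
    refine h.trans ?_
    rw [eξ, abs_mul, abs_of_nonneg (by positivity : (0:ℝ) ≤ (q:ℝ)^E)]
    apply mul_le_mul_of_nonneg_right _ (by positivity)
    rw [mul_comm]
    gcongr

theorem liouville {ι : Type*} {α : ℝ} (hα : α^3 = α^2 + 1) (G : ℕ)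
    (p q : ℕ) (hq : 0 < q)
    (x1 x2 x3 : ℝ) (h1 : x1^2 = α) (h2 : x2^2 = G) (h3 : x3^2 = ((p:ℚ)/q : ℚ) * (3*α-2)) (hx1 : 0 ≤ x1) (hx2 : 0 ≤ x2)
    (V : ℝ) (hV1 : (q:ℝ) ≤ V) (hV2 : (p:ℝ) * (3*α+2) ≤ V)
    (s : Finset ι) (f : ι → ℤ) (n1 n2 n3 : ι → ℕ) (E : ℕ) (hn3 : ∀ i ∈ s, n3 i ≤ 2 * E)
    (Nc Em R : ℝ) (hNc : (s.card:ℝ) ≤ Nc) (hNc1 : 1 ≤ Nc) (hEm : ∀ i ∈ s, |(f i:ℝ)| ≤ Em) (hEm1 : 1 ≤ Em) (hR : 0 ≤ R)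
    (hRx : ∀ i ∈ s, x1^(n1 i) * x2^(n2 i) ≤ Real.exp R) :
    ∑ i ∈ s, (f i : ℝ) * (x1^(n1 i) * x2^(n2 i) * x3^(n3 i)) = 0 ∨
    1 ≤ |∑ i ∈ s, (f i : ℝ) * (x1^(n1 i) * x2^(n2 i) * x3^(n3 i))| * V^E *
      (Nc * Em * Real.exp R * V^E)^23 := by
  have hαK : α ∈ ℚ⟮α⟯ := mem_adjoin_simple_self ℚ α
  have hQ : ∀ r : ℚ, (r:ℝ) ∈ ℚ⟮α⟯ := fun r => (ℚ⟮α⟯).algebraMap_mem r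
  obtain ⟨M, hM, hfin, m1, m2, m3⟩ := field_exists hα x1 x2 x3 (h1 ▸ hαK)
    (by rw [h2]; simpa using hQ G) (by
      rw [h3]
      have h32 : ((3:ℚ):ℝ) * α - ((2:ℚ):ℝ) ∈ ℚ⟮α⟯ := sub_mem (mul_mem (hQ 3) hαK) (hQ 2)
      exact mul_mem (hQ _) (by simpa using h32))
  have := hM
  have hqR : (q:ℝ) ≠ 0 := by positivity
  exact liouville_field M (M.val.restrictScalars ℚ) hfin hα G p q hq x1 x2 h1 h2 hx1 hx2
    ⟨x1, m1⟩ ⟨x2, m2⟩ ⟨x3, m3⟩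
    (by
      apply Subtype.ext
      have : x1^6 = x1^4 + 1 := by
        rw [show x1^6 = (x1^2)^3 by ring, show x1^4 = (x1^2)^2 by ring, h1, hα]
      exact this)
    (by
      apply Subtype.ext
      have : x2^2 = (G:ℝ) := h2
      simpa using this)
    (by
      apply Subtype.ext
      have : (q:ℝ) * x3^2 = p * (3*x1^2-2) := by rw [h3, h1]; push_cast; field_simp
      exact this)
    V hV1 hV2 s f n1 n2 n3 E hn3 Nc Em R hNc hNc1 hEm hEm1 hR hRx

end

section
open Polynomial

theorem siegel_abs {I J : Type*} [Fintype I] [Fintype J] [DecidableEq I] [DecidableEq J] (A : I → J → ℤ)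
    (Ent Cm : ℝ) (ν : ℕ) (hν : 2 ≤ ν) (hJ : ν * Fintype.card I ≤ Fintype.card J) (hI : 0 < Fintype.card I)
    (hA : ∀ i j, |(A i j : ℝ)| ≤ Ent) (hE : 1 ≤ Ent) (hCm : 1 ≤ Cm)
    (hC : Fintype.card J * Ent ≤ Cm^(ν-1)) :
    ∃ c : J → ℤ, c ≠ 0 ∧ (∀ i, ∑ j, A i j * c j = 0) ∧ ∀ j, |(c j : ℝ)| ≤ Cm := by
  letI : SeminormedAddCommGroup (Matrix I J ℤ) := Matrix.seminormedAddCommGroup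
  have hlt : Fintype.card I < Fintype.card J := by nlinarith
  obtain ⟨t, ht0, ht, hn⟩ := Int.Matrix.exists_ne_zero_int_vec_norm_le (Matrix.of A) hlt hI
  refine ⟨t, ht0, fun i => ?_, fun j => ?_⟩
  · have := congrFun ht i
    simpa [Matrix.mulVec, dotProduct] using this
  have hj : |(t j : ℝ)| ≤ ‖t‖ := by
    have := norm_le_pi_norm t j
    simpa [Int.norm_eq_abs] using this
  refine hj.trans (hn.trans ?_)
  have hnA : max 1 ‖Matrix.of A‖ ≤ Ent := by
    refine max_le hE ?_
    rw [Matrix.norm_le_iff (by linarith)]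
    intro i j
    simpa [Int.norm_eq_abs] using hA i j
  have hJ' : (ν:ℝ) * Fintype.card I ≤ Fintype.card J := by exact_mod_cast hJ
  have hI' : (1:ℝ) ≤ Fintype.card I := by exact_mod_cast hI
  have hν' : (2:ℝ) ≤ ν := by exact_mod_cast hν
  have hb : (Fintype.card J : ℝ) * max 1 ‖Matrix.of A‖ ≤ Cm^(ν-1) :=
    (mul_le_mul_of_nonneg_left hnA (by positivity)).trans hC
  have hpos : (0:ℝ) < (Fintype.card J : ℝ) - Fintype.card I := by nlinarith
  have hcJ : (1:ℝ) ≤ Fintype.card J := by nlinarith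
  have hb1 : 1 ≤ (Fintype.card J : ℝ) * max 1 ‖Matrix.of A‖ := by
    have := le_max_left (1:ℝ) ‖Matrix.of A‖
    nlinarith
  have hexp : (Fintype.card I : ℝ) / ((Fintype.card J : ℝ) - Fintype.card I) ≤ 1 / ((ν-1 : ℕ) : ℝ) := by
    rw [Nat.cast_sub (by omega), div_le_div_iff₀ hpos (by push_cast; linarith)]
    push_cast; nlinarith
  calc ((Fintype.card J : ℝ) * max 1 ‖Matrix.of A‖) ^ ((Fintype.card I : ℝ) / ((Fintype.card J : ℝ) - Fintype.card I))
      ≤ ((Fintype.card J : ℝ) * max 1 ‖Matrix.of A‖) ^ (1 / ((ν-1 : ℕ) : ℝ)) :=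
        Real.rpow_le_rpow_of_exponent_le hb1 hexp
    _ ≤ (Cm^(ν-1)) ^ (1 / ((ν-1 : ℕ) : ℝ)) := Real.rpow_le_rpow (by linarith) hb (by positivity)
    _ = Cm := by
        rw [one_div]; exact Real.pow_rpow_inv_natCast (by linarith) (by omega)

theorem coords_bound {α : ℝ} (hα : α^3 = α^2 + 1) (a b : ℕ) :
    ∃ A : Fin 3 → ℤ, α^a * (3*α-2)^b = A 0 + A 1 * α + A 2 * α^2 ∧ ∀ j, |(A j : ℝ)| ≤ α^a * (3*α+2)^b := by
  have ha := al_gt hα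
  suffices h : ∃ x y z : ℤ, α^a * (3*α-2)^b = x + y * α + z * α^2 ∧
      |(x:ℝ)| + |(y:ℝ)| * α + |(z:ℝ)| * α^2 ≤ α^a * (3*α+2)^b by
    obtain ⟨x, y, z, h1, h2⟩ := h
    refine ⟨![x,y,z], by simpa using h1, fun j => ?_⟩
    have h3 := abs_nonneg (x:ℝ)
    have h4 := abs_nonneg (y:ℝ)
    have h5 := abs_nonneg (z:ℝ)
    have h6 : 1 ≤ α^2 := by nlinarith
    fin_cases j <;> simp <;> nlinarith
  induction b with
  | zero =>
    induction a with
    | zero => exact ⟨1, 0, 0, by simp, by simp⟩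
    | succ a ih =>
      obtain ⟨x, y, z, h1, h2⟩ := ih
      refine ⟨z, x, y + z, ?_, ?_⟩
      · push_cast
        simp only [pow_zero, mul_one] at h1 ⊢
        rw [pow_succ, h1]; linear_combination (z:ℝ) * hα
      · push_cast
        simp only [pow_zero, mul_one] at h2 ⊢
        have := abs_add_le (y:ℝ) z
        have h6 : 0 ≤ α^2 := by positivity
        rw [pow_succ α a]
        have h7 := mul_le_mul_of_nonneg_right h2 (by linarith : 0 ≤ α)
        have h8 := mul_le_mul_of_nonneg_right this h6
        have h9 : |(z:ℝ)| * α^3 = |(z:ℝ)| * (α^2+1) := by rw [hα]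
        nlinarith
  | succ b ih =>
      obtain ⟨x, y, z, h1, h2⟩ := ih
      refine ⟨3*z - 2*x, 3*x-2*y, 3*(y+z)-2*z, ?_, ?_⟩
      · push_cast
        rw [pow_succ, ← mul_assoc, h1]; linear_combination (3*z:ℝ) * hα
      · push_cast
        have e1 : |3*(z:ℝ) - 2*x| ≤ 3*|(z:ℝ)| + 2*|(x:ℝ)| := by
          have := abs_sub (3*(z:ℝ)) (2*x)
          rwa [abs_mul, abs_mul, abs_of_pos (by norm_num : (0:ℝ)<3), abs_of_pos (by norm_num : (0:ℝ)<2)] at this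
        have e2 : |3*(x:ℝ) - 2*y| ≤ 3*|(x:ℝ)| + 2*|(y:ℝ)| := by
          have := abs_sub (3*(x:ℝ)) (2*y)
          rwa [abs_mul, abs_mul, abs_of_pos (by norm_num : (0:ℝ)<3), abs_of_pos (by norm_num : (0:ℝ)<2)] at this
        have e3 : |3*((y:ℝ)+z) - 2*z| ≤ 3*(|(y:ℝ)|+|(z:ℝ)|) + 2*|(z:ℝ)| := by
          have := abs_sub (3*((y:ℝ)+z)) (2*z)
          rw [abs_mul, abs_mul, abs_of_pos (by norm_num : (0:ℝ)<3), abs_of_pos (by norm_num : (0:ℝ)<2)] at this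
          linarith [abs_add_le (y:ℝ) z]
        have h6 : 0 ≤ α^2 := by positivity
        have h7 := mul_le_mul_of_nonneg_right e2 (by linarith : 0 ≤ α)
        have h8 := mul_le_mul_of_nonneg_right e3 h6
        have h9 := mul_le_mul_of_nonneg_right h2 (by linarith : 0 ≤ 3*α+2)
        rw [pow_succ (3*α+2), ← mul_assoc]
        refine le_trans ?_ h9
        have : |(z:ℝ)| * α^3 = |(z:ℝ)| * (α^2+1) := by rw [hα]
        nlinarith

def box (L1 L2 L3 : ℕ) : Finset (ℕ × ℕ × ℕ) := Finset.range L1 ×ˢ Finset.range L2 ×ˢ Finset.range L3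
def uu (k : ℕ) (l : ℕ × ℕ × ℕ) : ℤ := l.1 + k * l.2.2
def vv (s : ℕ) (l : ℕ × ℕ × ℕ) : ℤ := l.2.1 - s * l.2.2
noncomputable def pp (h L0 : ℕ) (c : ℕ × ℕ × ℕ → ℕ → ℤ) (l : ℕ × ℕ × ℕ) : ℝ[X] :=
  ∑ i ∈ Finset.range L0, C (c l i : ℝ) * fQ h i
noncomputable def QB (Y ϱ : ℝ) (h L : ℕ) : ℝ := ((Y+ϱ)^h/h.factorial)^L

theorem pp_hasse (h L0 : ℕ) (c : ℕ × ℕ × ℕ → ℕ → ℤ) (l : ℕ × ℕ × ℕ) (m : ℕ) (x : ℝ) :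
    (hasseDeriv m (pp h L0 c l)).eval x = ∑ i ∈ Finset.range L0, (c l i : ℝ) * (hasseDeriv m (fQ h i)).eval x := by
  unfold pp
  rw [map_sum, eval_finsetSum]
  refine Finset.sum_congr rfl fun i _ => ?_
  rw [← smul_eq_C_mul, map_smul, eval_smul, smul_eq_mul]

abbrev Smp (T : ℕ) : Type := Σ a : Fin T, Σ b : Fin (T - a), Fin (T - a - b)

theorem smp_card (T : ℕ) : 6 * Fintype.card (Smp T) = T * (T+1) * (T+2) := by
  have h1 : ∀ n : ℕ, 2 * ∑ b : Fin n, (n - (b:ℕ)) = n * (n+1) := by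
    intro n
    rw [Fin.sum_univ_eq_sum_range (fun b => n - b) n]
    induction n with
    | zero => simp
    | succ n ih =>
      rw [Finset.sum_range_succ']
      simp only [Nat.add_sub_add_right, mul_add, ih]
      simp; ring
  have h2 : ∀ n : ℕ, 3 * ∑ b ∈ Finset.range n, (n - b) * (n - b + 1) = n * (n+1) * (n+2) := by
    intro n
    induction n with
    | zero => simp
    | succ n ih =>
      rw [Finset.sum_range_succ']
      simp only [Nat.add_sub_add_right, mul_add] at ih ⊢
      rw [ih]
      simp; ring
  simp only [Fintype.card_sigma, Fintype.card_fin]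
  rw [← h2, show (6:ℕ) = 3 * 2 by rfl, mul_assoc, Finset.mul_sum]
  simp only [h1]
  rw [Fin.sum_univ_eq_sum_range (fun b => (T - b) * (T - b + 1)) T]

end

section
open Polynomial

theorem exp_lin (a1 a2 a3 : ℝ) (l : ℕ × ℕ × ℕ) (y : ℕ) :
    Real.exp ((l.1 * a1 + l.2.1 * a2 + l.2.2 * a3) * (y:ℝ)) =
      (Real.exp a1)^(l.1*y) * (Real.exp a2)^(l.2.1*y) * (Real.exp a3)^(l.2.2*y) := by
  rw [← Real.exp_nat_mul, ← Real.exp_nat_mul, ← Real.exp_nat_mul, ← Real.exp_add, ← Real.exp_add]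
  congr 1; push_cast; ring

theorem siegel_main {α : ℝ} (hα : α^3 = α^2 + 1) (G p q : ℕ) (hG : 1 ≤ G) (hq : 0 < q)
    (a1 a2 a3 : ℝ) (ha1 : Real.exp a1 = α) (ha2 : Real.exp a2 = G) (ha3 : Real.exp a3 = (p/q:ℝ)*(3*α-2))
    (V : ℝ) (hVq : (q:ℝ) ≤ V) (hVp : (p:ℝ)*(3*α+2) ≤ V)
    (k s h L Δ X T L1 L2 L3 ν : ℕ) (hh : 0 < h) (hΔ : ∀ i, 1 ≤ i → i ≤ h → i ∣ Δ) (hΔ1 : 1 ≤ Δ)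
    (B : ℝ) (hΔB : (Δ:ℝ) ≤ B) (hu : ∀ l ∈ box L1 L2 L3, |(uu k l : ℝ)| ≤ B)
    (hv : ∀ l ∈ box L1 L2 L3, |(vv s l : ℝ)| ≤ B) (hhY : (h:ℝ) ≤ 2 * X) (hX : 0 < X) (hT : 0 < T)
    (hν : 2 ≤ ν) (hcount : ν * (X * (T*(T+1)*(T+2))) ≤ 2 * (L1*L2*L3*(h*L)))
    (Cm : ℝ) (hCm : 1 ≤ Cm)
    (hC : ((L1*L2*L3*(h*L) : ℕ):ℝ) * (2^(h*L) * B^T * QB (2*X) 1 h L *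
      (Real.exp (2*X*(L1*a1+L2*a2)) * V^(L3*(2*X)))) ≤ Cm^(ν-1)) :
    ∃ c : ℕ × ℕ × ℕ → ℕ → ℤ, (∃ l ∈ box L1 L2 L3, ∃ i < h*L, c l i ≠ 0) ∧ (∀ l i, |(c l i:ℝ)| ≤ Cm) ∧
      ∀ x < X, ∀ m0 m1 m2, m0+m1+m2 < T →
        ∑ l ∈ box L1 L2 L3, (hasseDeriv m0 (pp h (h*L) c l)).eval (((2*x+1:ℕ)):ℝ) * ((uu k l:ℝ)^m1 * (vv s l:ℝ)^m2) *
          Real.exp ((l.1 * a1 + l.2.1 * a2 + l.2.2 * a3) * ((2*x+1:ℕ):ℝ)) = 0 := by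
  classical
  have hα0 := al_gt hα
  have hV1 : 1 ≤ V := le_trans (by exact_mod_cast hq) hVq
  have hB1 : 1 ≤ B := le_trans (by exact_mod_cast hΔ1) hΔB
  have hlα : 0 ≤ a1 := by
    by_contra hcon
    have := (Real.exp_lt_exp.2 (not_le.1 hcon)).trans_eq Real.exp_zero
    linarith
  have hlG : 0 ≤ a2 := by
    by_contra hcon
    have := (Real.exp_lt_exp.2 (not_le.1 hcon)).trans_eq Real.exp_zero
    rw [ha2] at this
    have : (1:ℝ) ≤ G := by exact_mod_cast hG
    linarith
  have hz : ∀ i m x : ℕ, ∃ z : ℤ, i < h*L → (2:ℝ)^(h*L) * (Δ:ℝ)^m * (hasseDeriv m (fQ h i)).eval ((2*x+1:ℕ):ℝ) = z := by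
    intro i m x
    by_cases hi : i < h*L
    · obtain ⟨z, hz⟩ := fQ_int h L 0 Δ i m hh hi hΔ ((2*x+1:ℕ):ℤ)
      refine ⟨z, fun _ => ?_⟩
      simpa using hz
    · exact ⟨0, fun h => absurd h hi⟩
  choose zf hzf using hz
  choose A hA1 hA2 using fun a b => coords_bound hα a b
  set S : Finset ((ℕ × ℕ × ℕ) × ℕ) := box L1 L2 L3 ×ˢ Finset.range (h*L) with hS
  let Ee : (Fin X × Smp T × Fin 3) → S → ℤ := fun r j =>
    zf j.1.2 r.2.1.1 r.1 * ((uu k j.1.1)^(r.2.1.2.1:ℕ) * (vv s j.1.1)^(r.2.1.2.2:ℕ)) *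
      ((G:ℤ)^(j.1.1.2.1*(2*r.1+1)) * ((p:ℤ)^(j.1.1.2.2*(2*r.1+1)) * (q:ℤ)^((L3 - j.1.1.2.2)*(2*r.1+1)))) *
      A (j.1.1.1*(2*r.1+1)) (j.1.1.2.2*(2*r.1+1)) r.2.2
  set Ent : ℝ := 2^(h*L) * B^T * QB (2*X) 1 h L *
      (Real.exp (2*X*(L1*a1+L2*a2)) * V^(L3*(2*X))) with hEnt
  have hcardS : Fintype.card S = L1*L2*L3*(h*L) := by
    rw [Fintype.card_coe, hS, Finset.card_product, box, Finset.card_product, Finset.card_product]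
    simp only [Finset.card_range]; ring
  have hcardI : 2 * Fintype.card (Fin X × Smp T × Fin 3) = X * (T*(T+1)*(T+2)) := by
    rw [Fintype.card_prod, Fintype.card_prod, Fintype.card_fin, Fintype.card_fin, ← smp_card]; ring
  have hQB1 : ∀ i < h*L, ∀ x < X, ∀ m, |(hasseDeriv m (fQ h i)).eval ((2*x+1:ℕ):ℝ)| ≤ QB (2*X) 1 h L := by
    intro i hi x hx m
    have hx' : ((2*x+1:ℕ):ℝ) ≤ 2*X := by
      have : 2*x+1 ≤ 2*X := by omega
      exact_mod_cast this
    exact (abs_eval_le_maj _ m _ le_rfl).trans (fQ_maj h L i hh hi _ 1 _ le_rfl (by positivity) hx' hhY)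
  have hent : ∀ r j, |((Ee r j : ℤ):ℝ)| ≤ Ent := by
    rintro ⟨x, ⟨m0, m1, m2⟩, e⟩ ⟨⟨⟨l1, l2, l3⟩, i⟩, hj⟩
    have hj' := hj
    rw [hS, Finset.mem_product] at hj'
    obtain ⟨hl, hi⟩ := hj'
    have hl' := hl
    simp only [box, Finset.mem_product, Finset.mem_range] at hl' hi
    obtain ⟨hl1, hl2, hl3⟩ := hl'
    have hm : (m0:ℕ) + m1 + m2 ≤ T := by
      have h0 := m0.2; have h1 := m1.2; have h2 := m2.2
      omega
    have hxX : (2*(x:ℕ)+1) ≤ 2*X := by have := x.2; omega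
    simp only [Ee]
    push_cast
    rw [abs_mul, abs_mul, abs_mul]
    set y := 2*(x:ℕ)+1 with hy
    have e1 : |(zf i m0 x : ℝ)| ≤ 2^(h*L) * B^(m0:ℕ) * QB (2*X) 1 h L := by
      rw [← hzf i m0 x hi, abs_mul, abs_mul, abs_of_pos (by positivity : (0:ℝ) < 2^(h*L)),
        abs_of_nonneg (by positivity : (0:ℝ) ≤ (Δ:ℝ)^(m0:ℕ))]
      have := hQB1 i hi x x.2 m0
      gcongr
    have e2 : |(uu k (l1,l2,l3) : ℝ)^(m1:ℕ) * (vv s (l1,l2,l3):ℝ)^(m2:ℕ)| ≤ B^((m1:ℕ)+m2) := by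
      rw [abs_mul, abs_pow, abs_pow, pow_add]
      have := hu _ hl; have := hv _ hl
      gcongr
    have e3 : |(A (l1*y) (l3*y) e : ℝ)| ≤ α^(l1*y) * (3*α+2)^(l3*y) := hA2 _ _ _
    have e4 : |(G:ℝ)^(l2*y) * ((p:ℝ)^(l3*y) * (q:ℝ)^((L3-l3)*y))| = (G:ℝ)^(l2*y) * ((p:ℝ)^(l3*y) * (q:ℝ)^((L3-l3)*y)) :=
      abs_of_nonneg (by positivity)
    have hG1 : (1:ℝ) ≤ G := by exact_mod_cast hG
    have e5 : (p:ℝ)^(l3*y) * (q:ℝ)^((L3-l3)*y) * (3*α+2)^(l3*y) ≤ V^(L3*(2*X)) := by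
      calc (p:ℝ)^(l3*y) * (q:ℝ)^((L3-l3)*y) * (3*α+2)^(l3*y)
          = (p*(3*α+2))^(l3*y) * (q:ℝ)^((L3-l3)*y) := by rw [mul_pow]; ring
        _ ≤ V^(l3*y) * V^((L3-l3)*y) := by
            have : 0 ≤ (p:ℝ)*(3*α+2) := by positivity
            gcongr
        _ = V^(L3*y) := by rw [← pow_add, ← add_mul]; congr 2; omega
        _ ≤ V^(L3*(2*X)) := pow_le_pow_right₀ hV1 (Nat.mul_le_mul_left _ hxX)
    have e6 : (G:ℝ)^(l2*y) * α^(l1*y) ≤ Real.exp (2*X*(L1*a1+L2*a2)) := by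
      have : Real.exp (2*X*(L1*a1+L2*a2)) = (G:ℝ)^(L2*(2*X)) * α^(L1*(2*X)) := by
        rw [← ha1, ← ha2, ← Real.exp_nat_mul, ← Real.exp_nat_mul, ← Real.exp_add]
        congr 1; push_cast; ring
      rw [this]
      have : 1 ≤ α := by linarith
      gcongr
    have hQ0 : 0 ≤ QB (2*X) 1 h L := by unfold QB; positivity
    have e7 : 0 ≤ (p:ℝ)^(l3*y) * (q:ℝ)^((L3-l3)*y) * (3*α+2)^(l3*y) := by positivity
    have e8 : B^(m0:ℕ) * B^((m1:ℕ)+m2) ≤ B^T := by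
      rw [← pow_add]; exact pow_le_pow_right₀ hB1 (by omega)
    have e9 : 0 ≤ (G:ℝ)^(l2*y) * α^(l1*y) := by positivity
    rw [e4]
    calc _ ≤ (2^(h*L) * B^(m0:ℕ) * QB (2*X) 1 h L) * B^((m1:ℕ)+m2) *
          ((G:ℝ)^(l2*y) * ((p:ℝ)^(l3*y) * (q:ℝ)^((L3-l3)*y))) * (α^(l1*y) * (3*α+2)^(l3*y)) := by
            gcongr
      _ = 2^(h*L) * (B^(m0:ℕ) * B^((m1:ℕ)+m2)) * QB (2*X) 1 h L * (((G:ℝ)^(l2*y) * α^(l1*y)) *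
          ((p:ℝ)^(l3*y) * (q:ℝ)^((L3-l3)*y) * (3*α+2)^(l3*y))) := by ring
      _ ≤ Ent := by
          rw [hEnt]
          gcongr
  have hEnt1 : 1 ≤ Ent := by
    have h1 : (1:ℝ) ≤ 2^(h*L) := one_le_pow₀ (by norm_num)
    have h2 : 1 ≤ B^T := one_le_pow₀ hB1
    have h3 : 1 ≤ QB (2*X) 1 h L := by
      unfold QB
      have hp1 : (h.factorial:ℝ) ≤ (2*X+1)^h := by
        have : (h.factorial:ℝ) ≤ (h:ℝ)^h := by exact_mod_cast Nat.factorial_le_pow h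
        exact this.trans (pow_le_pow_left₀ (by positivity) (by linarith) _)
      exact one_le_pow₀ ((one_le_div (by positivity)).2 hp1)
    have h4 : 1 ≤ Real.exp (2*X*(L1*a1+L2*a2)) := Real.one_le_exp (by positivity)
    have h5 : 1 ≤ V^(L3*(2*X)) := one_le_pow₀ hV1
    exact one_le_mul_of_one_le_of_one_le (one_le_mul_of_one_le_of_one_le (one_le_mul_of_one_le_of_one_le h1 h2) h3)
      (one_le_mul_of_one_le_of_one_le h4 h5)
  have hIpos : 0 < Fintype.card (Fin X × Smp T × Fin 3) := by
    have : 0 < X * (T*(T+1)*(T+2)) := by positivity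
    omega
  obtain ⟨c, hc0, hc1, hc2⟩ := siegel_abs Ee Ent Cm ν hν (by rw [hcardS]; nlinarith) hIpos hent hEnt1 hCm
    (by rw [hcardS]; exact hC)
  let c' : ℕ × ℕ × ℕ → ℕ → ℤ := fun l i => if hli : (l,i) ∈ S then c ⟨(l,i),hli⟩ else 0
  refine ⟨c', ?_, ?_, ?_⟩
  · obtain ⟨⟨⟨l, i⟩, hli⟩, hne⟩ := Function.ne_iff.1 hc0
    have hj' := hli
    rw [hS, Finset.mem_product] at hj'
    refine ⟨l, hj'.1, i, Finset.mem_range.1 hj'.2, ?_⟩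
    simp only [c', dif_pos hli]
    exact hne
  · intro l i
    simp only [c']
    split_ifs with hli
    · exact hc2 _
    · simp; linarith
  · intro x hx m0 m1 m2 hm
    set y := 2*x+1 with hy
    have key : ∀ e : Fin 3, ∑ l ∈ box L1 L2 L3, ∑ i ∈ Finset.range (h*L), (c' l i : ℝ) *
        ((zf i m0 x : ℝ) * ((uu k l:ℝ)^m1 * (vv s l:ℝ)^m2) *
      ((G:ℝ)^(l.2.1*y) * ((p:ℝ)^(l.2.2*y) * (q:ℝ)^((L3 - l.2.2)*y))) *
      A (l.1*y) (l.2.2*y) e) = 0 := by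
      intro e
      let F : (ℕ × ℕ × ℕ) × ℕ → ℤ := fun w => c' w.1 w.2 * (zf w.2 m0 x * ((uu k w.1)^m1 * (vv s w.1)^m2) *
        ((G:ℤ)^(w.1.2.1*y) * ((p:ℤ)^(w.1.2.2*y) * (q:ℤ)^((L3 - w.1.2.2)*y))) * A (w.1.1*y) (w.1.2.2*y) e)
      have h1 := hc1 (⟨x,hx⟩, ⟨⟨m0, by omega⟩, ⟨m1, by simp; omega⟩, ⟨m2, by simp; omega⟩⟩, e)
      have h2 : ∑ j : S, Ee (⟨x,hx⟩, ⟨⟨m0, by omega⟩, ⟨m1, by simp; omega⟩, ⟨m2, by simp; omega⟩⟩, e) j * c j =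
          ∑ j : S, F j.1 := by
        refine Finset.sum_congr rfl fun j _ => ?_
        have : c' j.1.1 j.1.2 = c j := by simp only [c']; rw [dif_pos j.2]
        simp only [F, this, Ee]; ring
      rw [h2, Finset.sum_coe_sort S F, hS, Finset.sum_product] at h1
      have h3 := congrArg (Int.cast : ℤ → ℝ) h1
      simp only [F] at h3
      push_cast at h3
      exact h3
    have hcomb : (2^(h*L) * (Δ:ℝ)^m0 * (q:ℝ)^(L3*y)) *
        ∑ l ∈ box L1 L2 L3, (hasseDeriv m0 (pp h (h*L) c' l)).eval ((y:ℕ):ℝ) * ((uu k l:ℝ)^m1 * (vv s l:ℝ)^m2) *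
          Real.exp ((l.1 * a1 + l.2.1 * a2 + l.2.2 * a3) * ((y:ℕ):ℝ)) = 
        0 := by
      have key3 : ∀ x y z : ℝ, x = 0 → y = 0 → z = 0 → (0:ℝ) = x + y * α + z * α^2 := by
        intro x y z h1 h2 h3; rw [h1, h2, h3]; ring
      rw [key3 _ _ _ (key 0) (key 1) (key 2)]
      rw [Finset.mul_sum, Finset.sum_mul, Finset.sum_mul, ← Finset.sum_add_distrib, ← Finset.sum_add_distrib]
      refine Finset.sum_congr rfl fun l hl => ?_
      rw [pp_hasse, Finset.sum_mul, Finset.sum_mul, Finset.sum_mul, Finset.sum_mul, Finset.mul_sum,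
        ← Finset.sum_add_distrib, ← Finset.sum_add_distrib]
      refine Finset.sum_congr rfl fun i hi => ?_
      have hl3 : l.2.2 < L3 := by
        simp only [box, Finset.mem_product, Finset.mem_range] at hl; exact hl.2.2
      rw [exp_lin, ha1, ha2, ha3]
      have hq' : (q:ℝ) ≠ 0 := by positivity
      have hqq : (q:ℝ)^(L3*y) * ((p/q:ℝ)*(3*α-2))^(l.2.2*y) =
          (p:ℝ)^(l.2.2*y) * (q:ℝ)^((L3 - l.2.2)*y) * (3*α-2)^(l.2.2*y) := by
        have : L3*y = (L3-l.2.2)*y + l.2.2*y := by rw [← add_mul]; congr 1; omega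
        rw [this, pow_add, mul_pow, div_pow]; field_simp
      have h1 := hzf i m0 x (Finset.mem_range.1 hi)
      have h2 := hA1 (l.1*y) (l.2.2*y)
      calc _ = (c' l i : ℝ) * ((2:ℝ)^(h*L) * (Δ:ℝ)^m0 * (hasseDeriv m0 (fQ h i)).eval ((y:ℕ):ℝ)) *
            ((uu k l:ℝ)^m1 * (vv s l:ℝ)^m2) * ((G:ℝ)^(l.2.1*y)) * α^(l.1*y) *
            ((q:ℝ)^(L3*y) * ((p/q:ℝ)*(3*α-2))^(l.2.2*y)) := by ring
        _ = (c' l i : ℝ) * (zf i m0 x) *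
            ((uu k l:ℝ)^m1 * (vv s l:ℝ)^m2) * ((G:ℝ)^(l.2.1*y)) *
            ((p:ℝ)^(l.2.2*y) * (q:ℝ)^((L3 - l.2.2)*y)) * (α^(l.1*y) * (3*α-2)^(l.2.2*y)) := by rw [hqq, h1]; ring
        _ = _ := by rw [h2]; ring
    have hne : (2^(h*L) * (Δ:ℝ)^m0 * (q:ℝ)^(L3*y)) ≠ 0 := by positivity
    exact (mul_eq_zero.1 hcomb).resolve_left hne

end

section
open Polynomial

structure Stp where
  (α : ℝ) (hα : α^3 = α^2 + 1)
  (G p q : ℕ) (hG : ¬ IsSquare G) (hp : 0 < p) (hq : 0 < q)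
  (a1 a2 a3 : ℝ) (ha1 : Real.exp a1 = α) (ha2 : Real.exp a2 = G) (ha3 : Real.exp a3 = (p/q:ℝ)*(3*α-2))
  (V : ℝ) (hVq : (q:ℝ) ≤ V) (hVp : (p:ℝ)*(3*α+2) ≤ V)
  (k s h L Δ X T L1 L2 L3 : ℕ) (hh : 0 < h) (hΔ : ∀ i, 1 ≤ i → i ≤ h → i ∣ Δ) (hΔ1 : 1 ≤ Δ)
  (B : ℝ) (hΔB : (Δ:ℝ) ≤ B) (hu : ∀ l ∈ box L1 L2 L3, |(uu k l : ℝ)| ≤ B)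
  (hv : ∀ l ∈ box L1 L2 L3, |(vv s l : ℝ)| ≤ B) (hhY : (h:ℝ) ≤ 2 * X) (hX : 0 < X) (hT : 0 < T)
  (hL : 0 < L) (hL1 : 0 < L1) (hL2 : 0 < L2) (hL3 : 0 < L3)
  (c : ℕ × ℕ × ℕ → ℕ → ℤ) (Cm : ℝ) (hCm : 1 ≤ Cm) (hc : ∀ l i, |(c l i:ℝ)| ≤ Cm)

namespace Stp
variable (P : Stp)

def cls (J : ℕ) (ρ : ℕ × ℕ × ℕ) : Finset (ℕ × ℕ × ℕ) :=
  (box P.L1 P.L2 P.L3).filter (fun l => l.1 % 2^J = ρ.1 ∧ l.2.1 % 2^J = ρ.2.1 ∧ l.2.2 % 2^J = ρ.2.2)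

noncomputable def tm (m0 m1 m2 : ℕ) (z : ℝ) (l : ℕ × ℕ × ℕ) : ℝ :=
  (hasseDeriv m0 (pp P.h (P.h*P.L) P.c l)).eval z * ((uu P.k l:ℝ)^m1 * (vv P.s l:ℝ)^m2) *
          Real.exp ((l.1 * P.a1 + l.2.1 * P.a2 + l.2.2 * P.a3) * z)

noncomputable def Nc : ℝ := P.L1 * P.L2 * P.L3
noncomputable def Em (K : ℝ) : ℝ := K^(P.h*P.L) * P.B^P.T * (((P.h*P.L:ℕ):ℝ) * P.Cm * QB (2*P.X) 1 P.h P.L)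
noncomputable def R : ℝ := 2*P.X*(P.L1*P.a1+P.L2*P.a2)
noncomputable def VE : ℝ := P.V^(P.L3*(2*P.X))
noncomputable def mult (K : ℝ) : ℝ := K^(P.h*P.L) * P.B^P.T * P.VE * P.VE * (P.Nc * P.Em K * Real.exp P.R * P.VE)^23

theorem one_le_B : 1 ≤ P.B := le_trans (by exact_mod_cast P.hΔ1) P.hΔB
theorem one_le_V : 1 ≤ P.V := le_trans (by exact_mod_cast P.hq) P.hVq
theorem one_le_G : 1 ≤ P.G := by
  rcases Nat.eq_zero_or_pos P.G with h | h
  · exact absurd ⟨0, by simp [h]⟩ P.hG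
  · exact h
theorem a1_nonneg : 0 ≤ P.a1 := by
  by_contra hcon
  have := (Real.exp_lt_exp.2 (not_le.1 hcon)).trans_eq Real.exp_zero
  have h1 := P.ha1
  have h2 := al_gt P.hα
  linarith
theorem a2_nonneg : 0 ≤ P.a2 := by
  by_contra hcon
  have := (Real.exp_lt_exp.2 (not_le.1 hcon)).trans_eq Real.exp_zero
  have h1 := P.ha2
  have h2 : (1:ℝ) ≤ P.G := by exact_mod_cast P.one_le_G
  linarith
theorem QB_one (ϱ : ℝ) (hϱ : 1 ≤ ϱ) : 1 ≤ QB (2*P.X) ϱ P.h P.L := by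
  unfold QB
  have hp1 : (P.h.factorial:ℝ) ≤ (2*P.X+ϱ)^P.h := by
    have : (P.h.factorial:ℝ) ≤ (P.h:ℝ)^P.h := by exact_mod_cast Nat.factorial_le_pow P.h
    exact this.trans (pow_le_pow_left₀ (by positivity) (by linarith [P.hhY]) _)
  exact one_le_pow₀ ((one_le_div (by positivity)).2 hp1)
theorem one_le_VE : 1 ≤ P.VE := one_le_pow₀ P.one_le_V
theorem one_le_Nc : 1 ≤ P.Nc := by
  have h1 : (1:ℝ) ≤ P.L1 := by exact_mod_cast P.hL1
  have h2 : (1:ℝ) ≤ P.L2 := by exact_mod_cast P.hL2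
  have h3 : (1:ℝ) ≤ P.L3 := by exact_mod_cast P.hL3
  exact one_le_mul_of_one_le_of_one_le (one_le_mul_of_one_le_of_one_le h1 h2) h3
theorem one_le_Em (K : ℝ) (hK : 1 ≤ K) : 1 ≤ P.Em K := by
  have h1 : (1:ℝ) ≤ ((P.h*P.L:ℕ):ℝ) := by exact_mod_cast Nat.mul_pos P.hh P.hL
  exact one_le_mul_of_one_le_of_one_le (one_le_mul_of_one_le_of_one_le (one_le_pow₀ hK) (one_le_pow₀ P.one_le_B))
    (one_le_mul_of_one_le_of_one_le (one_le_mul_of_one_le_of_one_le h1 P.hCm) (P.QB_one 1 le_rfl))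
theorem R_nonneg : 0 ≤ P.R := by
  unfold R
  have := P.a1_nonneg; have := P.a2_nonneg
  positivity

theorem pp_maj (ϱ : ℝ) (hϱ : 1 ≤ ϱ) (l : ℕ × ℕ × ℕ) (ξ : ℝ) (h0 : 0 ≤ ξ) (h1 : ξ ≤ 2*P.X) :
    maj ϱ (taylor ξ (pp P.h (P.h*P.L) P.c l)) ≤ ((P.h*P.L:ℕ):ℝ) * P.Cm * QB (2*P.X) ϱ P.h P.L := by
  unfold pp
  rw [map_sum]
  refine (maj_sum (by linarith) _ _).trans ?_
  have : ∀ i ∈ Finset.range (P.h*P.L), maj ϱ (taylor ξ (C (P.c l i : ℝ) * fQ P.h i)) ≤ P.Cm * QB (2*P.X) ϱ P.h P.L := by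
    intro i hi
    rw [taylor_mul, taylor_C, maj_C_mul]
    have e1 := fQ_maj P.h P.L i P.hh (Finset.mem_range.1 hi) (2*P.X) ϱ ξ hϱ h0 h1 P.hhY
    have e2 := maj_nonneg (by linarith : 0 ≤ ϱ) (taylor ξ (fQ P.h i))
    exact mul_le_mul (P.hc l i) e1 e2 (by linarith [P.hCm])
  refine (Finset.sum_le_card_nsmul _ _ _ this).trans ?_
  rw [Finset.card_range, nsmul_eq_mul, mul_assoc]

theorem box_mem {l : ℕ × ℕ × ℕ} (h : l ∈ box P.L1 P.L2 P.L3) : l.1 < P.L1 ∧ l.2.1 < P.L2 ∧ l.2.2 < P.L3 := by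
  simpa [box] using h

theorem pp_int (J m : ℕ) (y : ℕ) (l : ℕ × ℕ × ℕ) :
    ∃ z : ℤ, ((2 * 2^J : ℕ):ℝ)^(P.h*P.L) * (P.Δ:ℝ)^m * (hasseDeriv m (pp P.h (P.h*P.L) P.c l)).eval ((y:ℝ)/2^J) = z := by
  have : ∀ i, ∃ z : ℤ, i < P.h*P.L → ((2 * 2^J : ℕ):ℝ)^(P.h*P.L) * (P.Δ:ℝ)^m * (hasseDeriv m (fQ P.h i)).eval ((y:ℝ)/2^J) = z := by
    intro i
    by_cases hi : i < P.h*P.L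
    · obtain ⟨z, hz⟩ := fQ_int P.h P.L J P.Δ i m P.hh hi P.hΔ (y:ℤ)
      exact ⟨z, fun _ => by simpa using hz⟩
    · exact ⟨0, fun h => absurd h hi⟩
  choose z hz using this
  refine ⟨∑ i ∈ Finset.range (P.h*P.L), P.c l i * z i, ?_⟩
  rw [pp_hasse, Finset.mul_sum]
  push_cast
  refine Finset.sum_congr rfl fun i hi => ?_
  rw [← hz i (Finset.mem_range.1 hi)]; push_cast; ring

theorem cls_succ (J : ℕ) (ρ : ℕ × ℕ × ℕ) (y : ℕ) (hy : y % 2 = 1) (h1 : ρ.1 < 2^(J+1)) (h2 : ρ.2.1 < 2^(J+1)) (h3 : ρ.2.2 < 2^(J+1)) :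
    P.cls (J+1) ρ = (P.cls J (ρ.1 % 2^J, ρ.2.1 % 2^J, ρ.2.2 % 2^J)).filter
      (fun l => (l.1/2^J*y) % 2 = ρ.1/2^J ∧ (l.2.1/2^J*y) % 2 = ρ.2.1/2^J ∧ (l.2.2/2^J*y) % 2 = ρ.2.2/2^J) := by
  have key : ∀ a r : ℕ, r < 2^(J+1) → (a % 2^(J+1) = r ↔ a % 2^J = r % 2^J ∧ (a/2^J*y) % 2 = r/2^J) := by
    intro a r hr
    have e : (a/2^J*y) % 2 = (a/2^J) % 2 := by rw [Nat.mul_mod, hy]; simp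
    have hpos : 0 < 2^J := by positivity
    have hr2 : r/2^J < 2 := by rw [Nat.div_lt_iff_lt_mul hpos]; rw [pow_succ] at hr; linarith
    rw [e, Nat.mod_pow_succ]
    constructor
    · intro h
      subst h
      have hm := Nat.mod_lt a hpos
      constructor
      · rw [Nat.add_mul_mod_self_left, Nat.mod_mod]
      · rw [Nat.add_mul_div_left _ _ hpos, Nat.div_eq_of_lt hm, zero_add]
    · rintro ⟨h, h'⟩
      rw [h, h']; exact Nat.mod_add_div r (2^J)
  ext l
  simp only [cls, Finset.mem_filter, key _ _ h1, key _ _ h2, key _ _ h3]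
  tauto

theorem cls_empty (J : ℕ) (ρ : ℕ × ℕ × ℕ) (h : ¬ (ρ.1 < 2^J ∧ ρ.2.1 < 2^J ∧ ρ.2.2 < 2^J)) : P.cls J ρ = ∅ := by
  rw [cls, Finset.filter_eq_empty_iff]
  rintro l _ ⟨h1, h2, h3⟩
  have hpos : 0 < 2^J := by positivity
  exact h ⟨h1 ▸ Nat.mod_lt _ hpos, h2 ▸ Nat.mod_lt _ hpos, h3 ▸ Nat.mod_lt _ hpos⟩

theorem cls_card (J : ℕ) (ρ : ℕ × ℕ × ℕ) : ((P.cls J ρ).card : ℝ) ≤ P.Nc := by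
  have : (P.cls J ρ).card ≤ P.L1 * P.L2 * P.L3 := by
    refine (Finset.card_filter_le _ _).trans ?_
    simp [box, mul_assoc]
  unfold Nc
  exact_mod_cast this

end Stp

end

section
open Polynomial
namespace Stp
variable (P : Stp)

theorem exp_neg_le (ρ : ℕ × ℕ × ℕ) (hρ : ρ.2.2 ≤ P.L3) (z : ℝ) (h0 : 0 ≤ z) (h1 : z ≤ 2*P.X) :
    Real.exp (-((ρ.1 * P.a1 + ρ.2.1 * P.a2 + ρ.2.2 * P.a3) * z)) ≤ P.VE := by
  have hV := P.one_le_V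
  have ha := al_gt P.hα
  have hlog : -P.a3 ≤ Real.log P.V := by
    rw [Real.le_log_iff_exp_le (by linarith), Real.exp_neg, P.ha3]
    have hq : (0:ℝ) < P.q := by exact_mod_cast P.hq
    have hp : (1:ℝ) ≤ P.p := by exact_mod_cast P.hp
    have : (1:ℝ) ≤ P.p * (3*P.α-2) := by nlinarith
    refine le_trans ?_ P.hVq
    rw [div_mul_eq_mul_div, inv_div]
    exact div_le_self hq.le this
  have hVE : P.VE = Real.exp (((P.L3*(2*P.X) : ℕ):ℝ) * Real.log P.V) := by
    rw [Real.exp_nat_mul, Real.exp_log (by linarith)]; rfl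
  rw [hVE]
  apply Real.exp_le_exp.2
  have hl0 : 0 ≤ Real.log P.V := Real.log_nonneg hV
  have := P.a1_nonneg
  have := P.a2_nonneg
  have hρ' : (ρ.2.2:ℝ) ≤ P.L3 := by exact_mod_cast hρ
  have e1 : 0 ≤ (ρ.1 * P.a1 + ρ.2.1 * P.a2) * z := by positivity
  have e2 : (ρ.2.2:ℝ) * z ≤ P.L3 * (2*P.X) := by gcongr
  have e3 : (ρ.2.2:ℝ) * z * (-P.a3) ≤ (ρ.2.2:ℝ) * z * Real.log P.V := by gcongr
  have e4 : (ρ.2.2:ℝ) * z * Real.log P.V ≤ P.L3 * (2*P.X) * Real.log P.V := by gcongr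
  push_cast
  nlinarith

theorem arith_step (J m0 m1 m2 : ℕ) (hm : m0+m1+m2 ≤ P.T) (y : ℕ) (hy : y % 2 = 1)
    (hyX : y ≤ 2^(J+1)*(2*P.X)) (ρ : ℕ × ℕ × ℕ) (K ε : ℝ) (hK : ((2*2^(J+1) : ℕ):ℝ) ≤ K)
    (h1 : ρ.1 < 2^(J+1)) (h2 : ρ.2.1 < 2^(J+1)) (h3 : ρ.2.2 < 2^(J+1))
    (hε : |∑ l ∈ P.cls J (ρ.1 % 2^J, ρ.2.1 % 2^J, ρ.2.2 % 2^J), P.tm m0 m1 m2 ((y:ℝ)/2^(J+1)) l| ≤ ε)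
    (hsm : ε * P.mult K < 1) :
    ∑ l ∈ P.cls (J+1) ρ, P.tm m0 m1 m2 ((y:ℝ)/2^(J+1)) l = 0 := by
  rw [P.cls_succ J ρ y hy h1 h2 h3]
  set r : ℕ × ℕ × ℕ := (ρ.1 % 2^J, ρ.2.1 % 2^J, ρ.2.2 % 2^J) with hr
  set z : ℝ := (y:ℝ)/2^(J+1) with hz
  rcases Finset.eq_empty_or_nonempty (P.cls J r) with he | ⟨l0, hl0⟩
  · rw [he]; simp
  have hr3 : r.2.2 ≤ P.L3 := by
    rw [cls, Finset.mem_filter] at hl0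
    have := (P.box_mem hl0.1).2.2
    rw [← hl0.2.2.2]
    exact (Nat.mod_le _ _).trans this.le
  have hK1 : 1 ≤ K := by
    refine le_trans ?_ hK
    have : 1 ≤ 2*2^(J+1) := by have : 0 < 2^(J+1) := by positivity
                               omega
    exact_mod_cast this
  have hB := P.one_le_B
  have hyX' : (y:ℝ) ≤ 2^(J+1)*(2*P.X) := by exact_mod_cast hyX
  have hz0 : 0 ≤ z := by positivity
  have hzX : z ≤ 2*P.X := by rw [hz, div_le_iff₀ (by positivity)]; linarith
  choose f hf using P.pp_int (J+1) m0 y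
  set D : ℝ := ((2 * 2^(J+1) : ℕ):ℝ)^(P.h*P.L) * (P.Δ:ℝ)^m0 with hD
  have hΔ0 : (0:ℝ) < P.Δ := by exact_mod_cast P.hΔ1
  have hD0 : 0 < D := by positivity
  set F : ℕ × ℕ × ℕ → ℤ := fun l => f l * ((uu P.k l)^m1 * (vv P.s l)^m2) with hF
  set x1 := Real.exp (P.a1/2) with hx1
  set x2 := Real.exp (P.a2/2) with hx2
  set x3 := Real.exp (P.a3/2) with hx3
  have hs1 : x1^2 = P.α := by rw [hx1, ← Real.exp_nat_mul, ← P.ha1]; congr 1; push_cast; ring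
  have hs2 : x2^2 = P.G := by rw [hx2, ← Real.exp_nat_mul, ← P.ha2]; congr 1; push_cast; ring
  have hs3 : x3^2 = (((P.p:ℚ)/P.q : ℚ):ℝ) * (3*P.α-2) := by
    push_cast
    rw [hx3, ← Real.exp_nat_mul, ← P.ha3]; congr 1; push_cast; ring
  set w : ℝ := Real.exp ((r.1 * P.a1 + r.2.1 * P.a2 + r.2.2 * P.a3) * z) with hw
  have hw0 : 0 < w := Real.exp_pos _
  set n1 : ℕ × ℕ × ℕ → ℕ := fun l => l.1/2^J*y with hn1
  set n2 : ℕ × ℕ × ℕ → ℕ := fun l => l.2.1/2^J*y with hn2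
  set n3 : ℕ × ℕ × ℕ → ℕ := fun l => l.2.2/2^J*y with hn3
  have hterm : ∀ l ∈ P.cls J r, D * P.tm m0 m1 m2 z l = w * ((F l:ℝ) * (x1^(n1 l) * x2^(n2 l) * x3^(n3 l))) := by
    intro l hl
    rw [cls, Finset.mem_filter] at hl
    obtain ⟨hlb, e1, e2, e3⟩ := hl
    have d1 : (l.1:ℝ) = r.1 + 2^J * ((l.1/2^J : ℕ):ℝ) := by
      rw [← e1]; exact_mod_cast (Nat.mod_add_div _ _).symm
    have d2 : (l.2.1:ℝ) = r.2.1 + 2^J * ((l.2.1/2^J : ℕ):ℝ) := by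
      rw [← e2]; exact_mod_cast (Nat.mod_add_div _ _).symm
    have d3 : (l.2.2:ℝ) = r.2.2 + 2^J * ((l.2.2/2^J : ℕ):ℝ) := by
      rw [← e3]; exact_mod_cast (Nat.mod_add_div _ _).symm
    have hexp : Real.exp ((l.1 * P.a1 + l.2.1 * P.a2 + l.2.2 * P.a3) * z) =
        w * (x1^(n1 l) * x2^(n2 l) * x3^(n3 l)) := by
      rw [hw, hx1, hx2, hx3, ← Real.exp_nat_mul, ← Real.exp_nat_mul, ← Real.exp_nat_mul, ← Real.exp_add,
        ← Real.exp_add, ← Real.exp_add]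
      congr 1
      rw [d1, d2, d3, hz, hn1, hn2, hn3, pow_succ]
      push_cast
      field_simp
      ring
    have := hf l
    rw [tm, hexp, hF]
    push_cast
    rw [← this]; ring
  have hFb : ∀ l ∈ P.cls J r, |(F l:ℝ)| ≤ P.Em K := by
    intro l hl
    rw [cls, Finset.mem_filter] at hl
    have hfl : |(f l:ℝ)| ≤ K^(P.h*P.L) * P.B^m0 * (((P.h*P.L:ℕ):ℝ) * P.Cm * QB (2*P.X) 1 P.h P.L) := by
      rw [← hf l, abs_mul, abs_mul, abs_pow, abs_pow, abs_of_nonneg (by positivity : (0:ℝ) ≤ ((2 * 2^(J+1) : ℕ):ℝ)),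
        abs_of_pos hΔ0]
      have e1 := (abs_eval_le_maj (pp P.h (P.h*P.L) P.c l) m0 z le_rfl).trans (P.pp_maj 1 le_rfl l z hz0 hzX)
      have := P.hΔB
      gcongr
    have e2 : |(uu P.k l : ℝ)^m1 * (vv P.s l:ℝ)^m2| ≤ P.B^(m1+m2) := by
      rw [abs_mul, abs_pow, abs_pow, pow_add]
      have := P.hu _ hl.1; have := P.hv _ hl.1
      gcongr
    have hQ0 : 0 ≤ ((P.h*P.L:ℕ):ℝ) * P.Cm * QB (2*P.X) 1 P.h P.L :=
      mul_nonneg (mul_nonneg (by positivity) (by linarith [P.hCm])) (by linarith [P.QB_one 1 le_rfl])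
    have e8 : P.B^m0 * P.B^(m1+m2) ≤ P.B^P.T := by
      rw [← pow_add]; exact pow_le_pow_right₀ hB (by omega)
    rw [hF]
    push_cast
    rw [abs_mul]
    calc _ ≤ (K^(P.h*P.L) * P.B^m0 * (((P.h*P.L:ℕ):ℝ) * P.Cm * QB (2*P.X) 1 P.h P.L)) * P.B^(m1+m2) := by gcongr
      _ = K^(P.h*P.L) * (P.B^m0 * P.B^(m1+m2)) * (((P.h*P.L:ℕ):ℝ) * P.Cm * QB (2*P.X) 1 P.h P.L) := by ring
      _ ≤ _ := by unfold Em; gcongr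
  have hdivy : ∀ a : ℕ, ((a/2^J*y : ℕ):ℝ) ≤ 4 * P.X * a := by
    intro a
    have h1 : ((a/2^J : ℕ):ℝ) ≤ (a:ℝ)/2^J := by
      have := @Nat.cast_div_le ℝ _ _ _ a (2^J)
      simpa using this
    push_cast
    calc ((a/2^J : ℕ):ℝ) * y ≤ (a:ℝ)/2^J * (2^(J+1)*(2*P.X)) := by gcongr
      _ = 4 * P.X * a := by rw [pow_succ]; field_simp; ring
  have hn3b : ∀ l ∈ P.cls J r, n3 l ≤ 2 * (P.L3*(2*P.X)) := by
    intro l hl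
    rw [cls, Finset.mem_filter] at hl
    have h1 := hdivy l.2.2
    have h2 : (l.2.2:ℝ) ≤ P.L3 := by exact_mod_cast (P.box_mem hl.1).2.2.le
    have h3 : ((n3 l : ℕ):ℝ) ≤ ((2 * (P.L3*(2*P.X)) : ℕ):ℝ) := by
      refine h1.trans ?_
      push_cast
      nlinarith [mul_le_mul_of_nonneg_left h2 (Nat.cast_nonneg P.X : (0:ℝ) ≤ P.X)]
    exact_mod_cast h3
  have hRb : ∀ l ∈ P.cls J r, x1^(n1 l) * x2^(n2 l) ≤ Real.exp P.R := by
    intro l hl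
    rw [cls, Finset.mem_filter] at hl
    rw [hx1, hx2, ← Real.exp_nat_mul, ← Real.exp_nat_mul, ← Real.exp_add]
    apply Real.exp_le_exp.2
    have hb := P.box_mem hl.1
    have h1 := hdivy l.1
    have h2 := hdivy l.2.1
    have b1 : (l.1:ℝ) ≤ P.L1 := by exact_mod_cast hb.1.le
    have b2 : (l.2.1:ℝ) ≤ P.L2 := by exact_mod_cast hb.2.1.le
    have ha1 := P.a1_nonneg
    have ha2 := P.a2_nonneg
    calc ((n1 l:ℕ):ℝ) * (P.a1/2) + ((n2 l:ℕ):ℝ) * (P.a2/2) ≤ (4 * P.X * l.1) * (P.a1/2) + (4 * P.X * l.2.1) * (P.a2/2) := by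
          gcongr
      _ ≤ (4 * P.X * P.L1) * (P.a1/2) + (4 * P.X * P.L2) * (P.a2/2) := by gcongr
      _ = P.R := by unfold R; ring
  have hsum : D * ∑ l ∈ P.cls J r, P.tm m0 m1 m2 z l = w * ∑ l ∈ P.cls J r, (F l:ℝ) * (x1^(n1 l) * x2^(n2 l) * x3^(n3 l)) := by
    rw [Finset.mul_sum, Finset.mul_sum]
    exact Finset.sum_congr rfl hterm
  have hzero : ∑ l ∈ P.cls J r, (F l:ℝ) * (x1^(n1 l) * x2^(n2 l) * x3^(n3 l)) = 0 := by
    rcases liouville P.hα P.G P.p P.q P.hq x1 x2 x3 hs1 hs2 hs3 (Real.exp_pos _).le (Real.exp_pos _).le P.V P.hVq P.hVp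
      (P.cls J r) F n1 n2 n3 (P.L3*(2*P.X)) hn3b P.Nc (P.Em K) P.R (P.cls_card J r) P.one_le_Nc hFb (P.one_le_Em K hK1)
      P.R_nonneg hRb with h | h
    · exact h
    exfalso
    set Sg := ∑ l ∈ P.cls J r, (F l:ℝ) * (x1^(n1 l) * x2^(n2 l) * x3^(n3 l)) with hSg
    have hSb : |Sg| ≤ ε * (K^(P.h*P.L) * P.B^P.T * P.VE) := by
      have e1 : |Sg| = w⁻¹ * (D * |∑ l ∈ P.cls J r, P.tm m0 m1 m2 z l|) := by
        have : |D * ∑ l ∈ P.cls J r, P.tm m0 m1 m2 z l| = |w * Sg| := by rw [hsum]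
        rw [abs_mul D, abs_mul w, abs_of_pos hD0, abs_of_pos hw0] at this
        rw [this]; field_simp
      have e2 : w⁻¹ ≤ P.VE := by
        rw [hw, ← Real.exp_neg]; exact P.exp_neg_le r hr3 z hz0 hzX
      have e3 : D ≤ K^(P.h*P.L) * P.B^P.T := by
        rw [hD]
        have := P.hΔB
        have e4 : P.B^m0 ≤ P.B^P.T := pow_le_pow_right₀ hB (by omega)
        calc _ ≤ K^(P.h*P.L) * P.B^m0 := by gcongr
          _ ≤ _ := by gcongr
      have hVE := P.one_le_VE
      have hε0 : 0 ≤ ε := (abs_nonneg _).trans hε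
      rw [e1]
      calc _ ≤ P.VE * ((K^(P.h*P.L) * P.B^P.T) * ε) := by gcongr
        _ = _ := by ring
    have hE1 := P.one_le_Em K hK1
    have hN1 := P.one_le_Nc
    have hVE := P.one_le_VE
    have hfac : 0 ≤ P.VE * (P.Nc * P.Em K * Real.exp P.R * P.VE)^23 := by
      have : 0 ≤ P.Nc * P.Em K * Real.exp P.R * P.VE := by positivity
      positivity
    have : |Sg| * P.VE * (P.Nc * P.Em K * Real.exp P.R * P.VE)^23 ≤ ε * P.mult K := by
      have := mul_le_mul_of_nonneg_right hSb hfac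
      unfold mult
      calc _ = |Sg| * (P.VE * (P.Nc * P.Em K * Real.exp P.R * P.VE)^23) := by ring
        _ ≤ _ := this
        _ = _ := by ring
    have h' : 1 ≤ |Sg| * P.VE * (P.Nc * P.Em K * Real.exp P.R * P.VE)^23 := h
    linarith
  have hb : ∀ a : ℕ, a < 2^(J+1) → a/2^J < 2 := by
    intro a ha
    rw [Nat.div_lt_iff_lt_mul (by positivity)]; rw [pow_succ] at ha; linarith
  have hpq : (0:ℚ) < (P.p:ℚ)/P.q := by
    have := P.hp; have := P.hq
    positivity
  have hk := kummer_split P.hα P.G P.hG ((P.p:ℚ)/P.q) hpq x1 x2 x3 hs1 hs2 hs3 (P.cls J r) F n1 n2 n3 hzero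
    (ρ.1/2^J) (ρ.2.1/2^J) (ρ.2.2/2^J) (hb _ h1) (hb _ h2) (hb _ h3)
  have hfin : D * ∑ l ∈ (P.cls J r).filter
      (fun l => (l.1/2^J*y) % 2 = ρ.1/2^J ∧ (l.2.1/2^J*y) % 2 = ρ.2.1/2^J ∧ (l.2.2/2^J*y) % 2 = ρ.2.2/2^J),
      P.tm m0 m1 m2 z l = w * 0 := by
    rw [← hk, Finset.mul_sum, Finset.mul_sum]
    exact Finset.sum_congr rfl fun l hl => hterm l (Finset.mem_filter.1 hl).1
  rw [mul_zero] at hfin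
  exact (mul_eq_zero.1 hfin).resolve_left hD0.ne'
end Stp

end

section
open Polynomial

theorem exp_poly_bound (n : ℝ) (hn : 4000 ≤ n) : 2*n^2*(n+1) ≤ Real.exp (0.01*n) := by
  have h := Real.pow_div_factorial_le_exp (0.01*n) (by linarith) 16
  refine le_trans ?_ h
  rw [le_div_iff₀ (by positivity)]
  obtain ⟨x, rfl⟩ : ∃ x, n = 100*x := ⟨n/100, by ring⟩
  have hx : 40 ≤ x := by linarith
  have h13 : (40:ℝ)^13 ≤ x^13 := pow_le_pow_left₀ (by norm_num) hx 13
  have h3 : 0 ≤ x^3 := by positivity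
  have e1 : 2*(100*x)^2*(100*x+1) ≤ 2*1000000*1.01*x^3 := by nlinarith [sq_nonneg x]
  have e2 : (0.01*(100*x))^16 = x^13*x^3 := by rw [← pow_add]; congr 1; ring
  rw [e2]
  have e3 : ((16).factorial:ℝ) = 20922789888000 := by norm_num [Nat.factorial]
  rw [e3]
  calc 2*(100*x)^2*(100*x+1) * 20922789888000 ≤ (2*1000000*1.01*x^3) * 20922789888000 := by
        gcongr
    _ ≤ 40^13 * x^3 := by nlinarith
    _ ≤ _ := by gcongr

theorem factorial_upper (n : ℕ) (hn : 1 ≤ n) : (n.factorial:ℝ) ≤ Real.exp 1 * n * (n / Real.exp 1)^n := by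
  induction n, hn using Nat.le_induction with
  | base => simp
  | succ n hn ih =>
    have hn' : (0:ℝ) < n := by exact_mod_cast hn
    rw [Nat.factorial_succ]
    push_cast
    have key : Real.exp 1 * (n:ℝ)^(n+1) ≤ ((n:ℝ)+1)^(n+1) := by
      have h1 := Real.one_sub_inv_le_log_of_pos (by positivity : (0:ℝ) < ((n:ℝ)+1)/n)
      have h2 : Real.exp 1 ≤ (((n:ℝ)+1)/n)^(n+1) := by
        rw [← Real.exp_log (by positivity : (0:ℝ) < ((n:ℝ)+1)/n), ← Real.exp_nat_mul]
        apply Real.exp_le_exp.2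
        have : 1 - (((n:ℝ)+1)/n)⁻¹ = 1/((n:ℝ)+1) := by field_simp; ring
        rw [this] at h1
        push_cast
        calc (1:ℝ) = ((n:ℝ)+1) * (1/((n:ℝ)+1)) := by field_simp
          _ ≤ _ := by gcongr
      rw [div_pow, le_div_iff₀ (by positivity)] at h2
      exact h2
    have he := Real.exp_pos 1
    calc ((n:ℝ)+1) * n.factorial ≤ ((n:ℝ)+1) * (Real.exp 1 * n * (n / Real.exp 1)^n) := by gcongr
      _ = ((n:ℝ)+1) * (Real.exp 1 * (n:ℝ)^(n+1)) / Real.exp 1 ^ n := by rw [div_pow]; field_simp; ring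
      _ ≤ ((n:ℝ)+1) * ((n:ℝ)+1)^(n+1) / Real.exp 1 ^ n := by gcongr
      _ = _ := by rw [div_pow]; field_simp; ring

theorem fact_step (n : ℕ) (hn : 4000 ≤ n) :
    ((n+1).factorial:ℝ) ≤ (Real.exp 0.01 * (n/Real.exp 1))^n := by
  have hn' : (4000:ℝ) ≤ n := by exact_mod_cast hn
  have h1 := exp_poly_bound n hn'
  have h2 := factorial_upper n (by omega)
  rw [Nat.factorial_succ, mul_pow, ← Real.exp_nat_mul]
  push_cast
  have he : Real.exp 1 ≤ 3 := by linarith [Real.exp_one_lt_d9]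
  have h3 : ((n:ℝ)+1) * (Real.exp 1 * n) ≤ Real.exp (n*0.01) := by
    rw [mul_comm (n:ℝ) 0.01]
    refine le_trans ?_ h1
    nlinarith [mul_nonneg (by linarith : (0:ℝ) ≤ n) (by linarith : (0:ℝ) ≤ n+1)]
  calc ((n:ℝ)+1) * n.factorial ≤ ((n:ℝ)+1) * (Real.exp 1 * n * (n / Real.exp 1)^n) := by gcongr
    _ = ((n:ℝ)+1) * (Real.exp 1 * n) * (n / Real.exp 1)^n := by ring
    _ ≤ _ := by gcongr

namespace Stp
variable (P : Stp)

noncomputable def Λ : ℝ := P.a3 - P.k * P.a1 + P.s * P.a2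
noncomputable def Θ : ℝ := P.L1 * P.a1 + P.L2 * P.a2 + P.L3 * Real.log P.V + 1
noncomputable def AA (ϱ : ℝ) : ℝ := ((P.h*P.L:ℕ):ℝ) * P.Cm * QB (2*P.X) ϱ P.h P.L

noncomputable def eps1 (N : ℕ) : ℝ :=
  P.Nc * (P.B^P.T * P.AA 2 * Real.exp (P.Θ*(1+2*P.X)) * (2*(2*P.X)*(P.L3*|P.Λ|))) * (2*N*(4*Real.exp 0.01)^N)
noncomputable def eps2 (N : ℕ) (E : ℝ) : ℝ :=
  P.Nc * (P.B^P.T * P.AA (E*P.X+1) * Real.exp (P.Θ*(E*P.X+2*P.X))) * (2*Real.exp 0.01/(Real.exp 1*E))^N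

def St (J T' : ℕ) : Prop := ∀ ρ : ℕ × ℕ × ℕ, ∀ i < 2^J*P.X, ∀ m0 m1 m2, m0+m1+m2 < T' →
  ∑ l ∈ P.cls J ρ, P.tm m0 m1 m2 (((i:ℝ)+1/2)*(2/2^J)) l = 0

theorem abs_a3_le : |P.a3| ≤ Real.log P.V := by
  have hV := P.one_le_V
  have ha := al_gt P.hα
  have hq : (1:ℝ) ≤ P.q := by exact_mod_cast P.hq
  have hp : (1:ℝ) ≤ P.p := by exact_mod_cast P.hp
  rw [abs_le']
  constructor
  · rw [Real.le_log_iff_exp_le (by linarith), P.ha3]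
    refine le_trans ?_ P.hVp
    have : (P.p:ℝ)/P.q ≤ P.p := div_le_self (by linarith) hq
    have h0 : (0:ℝ) ≤ P.p/P.q := by positivity
    nlinarith
  · rw [Real.le_log_iff_exp_le (by linarith), Real.exp_neg, P.ha3]
    have : (1:ℝ) ≤ P.p * (3*P.α-2) := by nlinarith
    refine le_trans ?_ P.hVq
    rw [div_mul_eq_mul_div, inv_div]
    exact div_le_self (by linarith) this

theorem st_step (J M T0 T1 N : ℕ) (hM : 0 < M) (hN : 2^J*P.X*M = N) (hT0 : T0 ≤ P.T) (hT : T1 + M ≤ T0) (E K : ℝ) (hE : 1 ≤ E)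
    (hX : 4000 ≤ P.X) (hK : ((2*2^(J+1) : ℕ):ℝ) ≤ K) (hΛ : 2*P.X*(P.L3*|P.Λ|) ≤ 1)
    (hsm : (P.eps1 N + P.eps2 N E) * P.mult K < 1) (hS : P.St J T0) : P.St (J+1) T1 := by
  intro ρ i hi m0 m1 m2 hm
  by_cases hρ : ¬ (ρ.1 < 2^(J+1) ∧ ρ.2.1 < 2^(J+1) ∧ ρ.2.2 < 2^(J+1))
  · rw [P.cls_empty _ _ hρ]; simp
  rw [not_not] at hρ
  set y := 2*i+1 with hy
  have hz : ((i:ℝ)+1/2)*(2/2^(J+1)) = (y:ℝ)/2^(J+1) := by rw [hy]; push_cast; ring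
  rw [hz]
  have hyX : y ≤ 2^(J+1)*(2*P.X) := by
    have : 2^(J+1)*(2*P.X) = 2*(2^(J+1)*P.X) := by ring
    rw [this]; omega
  refine P.arith_step J m0 m1 m2 (by omega) y (by omega) hyX ρ K (P.eps1 N + P.eps2 N E) hK hρ.1 hρ.2.1 hρ.2.2 ?_ hsm
  set r : ℕ × ℕ × ℕ := (ρ.1 % 2^J, ρ.2.1 % 2^J, ρ.2.2 % 2^J) with hr
  have hω : ∀ l : ℕ × ℕ × ℕ, (l.1 * P.a1 + l.2.1 * P.a2 + l.2.2 * P.a3) =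
      (uu P.k l:ℝ) * P.a1 + (vv P.s l:ℝ) * P.a2 + l.2.2 * P.Λ := by
    intro l; simp only [uu, vv, Λ]; push_cast; ring
  have hXp : (0:ℝ) < P.X := by exact_mod_cast P.hX
  have hL3b : ∀ l ∈ P.cls J r, |(l.2.2:ℝ) * P.Λ| ≤ P.L3*|P.Λ| := by
    intro l hl
    rw [cls, Finset.mem_filter] at hl
    have h2 : (l.2.2:ℝ) ≤ P.L3 := by exact_mod_cast (P.box_mem hl.1).2.2.le
    rw [abs_mul, abs_of_nonneg (by positivity : (0:ℝ) ≤ l.2.2)]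
    gcongr
  have hlV : 0 ≤ Real.log P.V := Real.log_nonneg P.one_le_V
  have ha1 := P.a1_nonneg
  have ha2 := P.a2_nonneg
  have hΘ0 : 0 ≤ P.Θ := by unfold Θ; positivity
  have hτ1 : P.L3*|P.Λ| ≤ 1 := by
    have h4 : (4000:ℝ) ≤ P.X := by exact_mod_cast hX
    have h5 : 0 ≤ P.L3*|P.Λ| := by positivity
    nlinarith
  have hn : 0 < 2^J*P.X := Nat.mul_pos (by positivity) P.hX
  have hn4 : 4000 ≤ 2^J*P.X := hX.trans (Nat.le_mul_of_pos_left _ (by positivity))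
  have hstep := analytic_step (P.cls J r) (pp P.h (P.h*P.L) P.c) (fun l => (uu P.k l:ℝ)) (fun l => (vv P.s l:ℝ))
    (fun l => (l.2.2:ℝ) * P.Λ) P.a1 P.a2 (2^J*P.X) M T0 hn hM (2/2^J) (by positivity)
    (by apply div_le_self (by norm_num); exact one_le_pow₀ (by norm_num)) (2*P.X) (P.L3*|P.Λ|) P.Θ P.B (E*P.X)
    (P.AA (E*P.X+1)) (P.AA 2) P.Nc (by push_cast; field_simp) (by positivity) P.one_le_B
    (by
      have := P.QB_one (E*P.X+1) (by nlinarith)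
      have := P.hCm
      unfold AA; positivity)
    (by
      have := P.QB_one 2 (by norm_num)
      have := P.hCm
      unfold AA; positivity) (P.cls_card J r) (by positivity) hL3b hΛ hΘ0
    (by
      intro l hl
      have h1 := hL3b l hl
      rw [cls, Finset.mem_filter] at hl
      have hb := P.box_mem hl.1
      have b1 : (l.1:ℝ) ≤ P.L1 := by exact_mod_cast hb.1.le
      have b2 : (l.2.1:ℝ) ≤ P.L2 := by exact_mod_cast hb.2.1.le
      have b3 : (l.2.2:ℝ) ≤ P.L3 := by exact_mod_cast hb.2.2.le
      have h2 : (uu P.k l:ℝ) * P.a1 + (vv P.s l:ℝ) * P.a2 =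
        l.1 * P.a1 + l.2.1 * P.a2 + l.2.2 * P.a3 - l.2.2 * P.Λ := by rw [hω l]; ring
      have h3 : |(l.2.2:ℝ) * P.a3| ≤ P.L3 * Real.log P.V := by
        rw [abs_mul, abs_of_nonneg (by positivity : (0:ℝ) ≤ l.2.2)]
        have := P.abs_a3_le
        gcongr
      have h4 : (l.1:ℝ) * P.a1 ≤ P.L1 * P.a1 := by gcongr
      have h5 : (l.2.1:ℝ) * P.a2 ≤ P.L2 * P.a2 := by gcongr
      have h6 : (0:ℝ) ≤ (l.1:ℝ) * P.a1 := by positivity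
      have h7 : (0:ℝ) ≤ (l.2.1:ℝ) * P.a2 := by positivity
      rw [h2]
      unfold Θ
      rw [abs_le] at h1 h3 ⊢
      constructor <;> linarith [h1.1, h1.2, h3.1, h3.2])
    (fun l hl => P.hu l (Finset.mem_filter.1 hl).1) (fun l hl => P.hv l (Finset.mem_filter.1 hl).1)
    (fun l _ ξ h0 h1 => P.pp_maj _ (by nlinarith) l ξ h0 h1)
    (fun l _ ξ h0 h1 => P.pp_maj _ (by norm_num) l ξ h0 h1)
    (by
      intro i' hi' m0' m1' m2' hm'
      have := hS r i' hi' m0' m1' m2' hm'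
      simp only [tm, hω] at this
      exact this)
    m0 m1 m2 (by omega) ((y:ℝ)/2^(J+1)) (by positivity)
    (by
      rw [div_le_iff₀ (by positivity)]
      have : (y:ℝ) ≤ 2^(J+1)*(2*P.X) := by exact_mod_cast hyX
      linarith)
    (by
      intro i' hcon
      rw [pow_succ] at hcon
      field_simp at hcon
      have h2 : (y:ℝ) = ((2*(2*i'+1) : ℕ):ℝ) := by push_cast; linarith
      have h3 : y = 2*(2*i'+1) := by exact_mod_cast h2
      omega)
  simp only [tm, hω]
  refine hstep.trans ?_
  have hB := P.one_le_B
  have hBT : P.B^(m0+m1+m2) ≤ P.B^P.T := pow_le_pow_right₀ hB (by omega)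
  have hNc := P.one_le_Nc
  have hA : ∀ ϱ, 1 ≤ ϱ → 0 ≤ P.AA ϱ := by
    intro ϱ hϱ
    have := P.QB_one ϱ hϱ
    have := P.hCm
    unfold AA; positivity
  have hA2 := hA 2 (by norm_num)
  have hA1 := hA (E*P.X+1) (by nlinarith)
  set n := 2^J*P.X with hnn
  have hnr : (4000:ℝ) ≤ n := by exact_mod_cast hn4
  have hNpos : 1 ≤ N := by rw [← hN]; exact Nat.mul_pos hn hM
  have hNr : (1:ℝ) ≤ N := by exact_mod_cast hNpos
  have hf1 : (1 + (n:ℝ) * M * 4^(n*M) * (2 * (n:ℝ)^2 * (n+1))^M) ≤ 2*N*(4*Real.exp 0.01)^N := by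
    have e1 : (2 * (n:ℝ)^2 * (n+1))^M ≤ (Real.exp 0.01)^N := by
      calc (2 * (n:ℝ)^2 * (n+1))^M ≤ (Real.exp (0.01*n))^M := pow_le_pow_left₀ (by positivity) (exp_poly_bound n hnr) _
        _ = (Real.exp 0.01)^N := by
          rw [← hN, pow_mul, mul_comm, Real.exp_nat_mul]
    have e2 : (n:ℝ) * M = N := by rw [← hN]; push_cast; rfl
    rw [hN, e2, mul_pow 4 (Real.exp 0.01)]
    have e3 : (1:ℝ) ≤ 4^N := one_le_pow₀ (by norm_num)
    have e4 : (1:ℝ) ≤ (Real.exp 0.01)^N := one_le_pow₀ (Real.one_le_exp (by norm_num))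
    have e5 : (1:ℝ) ≤ N * (4^N * (Real.exp 0.01)^N) :=
      one_le_mul_of_one_le_of_one_le hNr (one_le_mul_of_one_le_of_one_le e3 e4)
    have e6 : (N:ℝ) * 4^N * (2 * (n:ℝ)^2 * (n+1))^M ≤ N * 4^N * (Real.exp 0.01)^N := by gcongr
    have e7 : (N:ℝ) * 4^N * (Real.exp 0.01)^N = N * (4^N * (Real.exp 0.01)^N) := by ring
    have e8 : 2 * (N:ℝ) * (4^N * (Real.exp 0.01)^N) = 2 * (N * (4^N * (Real.exp 0.01)^N)) := by ring
    rw [e8]; rw [e7] at e6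
    linarith
  have hf2 : (((E*P.X)^(n*M))⁻¹ * ((2/2^J)^n * (n+1).factorial)^M) ≤ (2*Real.exp 0.01/(Real.exp 1*E))^N := by
    have hfs := fact_step n hn4
    have e1 : ((2/2^J:ℝ)^n * (n+1).factorial)^M ≤ ((2/2^J:ℝ)^n * (Real.exp 0.01 * (n/Real.exp 1))^n)^M := by
      gcongr
    have hE0 : 0 < E := by linarith
    calc _ ≤ ((E*P.X)^(n*M))⁻¹ * ((2/2^J:ℝ)^n * (Real.exp 0.01 * (n/Real.exp 1))^n)^M := by gcongr
      _ = _ := by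
        rw [← mul_pow, ← pow_mul, ← inv_pow, ← mul_pow, hN]
        congr 1
        rw [hnn]; push_cast
        field_simp
  unfold eps1 eps2
  have g1 : 0 ≤ Real.exp (P.Θ*(1+2*P.X)) := (Real.exp_pos _).le
  have g2 : 0 ≤ Real.exp (P.Θ*(E*P.X+2*P.X)) := (Real.exp_pos _).le
  gcongr

theorem st_induct (μ : ℕ) (hμ : 0 < μ) (hT : P.T = 32768*μ) (E : ℝ) (hE : 1 ≤ E)
    (hX : 4000 ≤ P.X) (hΛ : 2*P.X*(P.L3*|P.Λ|) ≤ 1)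
    (hsm : (P.eps1 (12288*μ*P.X) + P.eps2 (12288*μ*P.X) E) * P.mult 8192 < 1) (hS : P.St 0 P.T) :
    P.St 12 (8192*μ) := by
  have main : ∀ J, J ≤ 12 → P.St J (8192*μ + 6*μ*2^(12-J)) := by
    intro J
    induction J with
    | zero =>
      intro _
      have : 8192*μ + 6*μ*2^(12-0) = P.T := by rw [hT]; norm_num; ring
      rw [this]; exact hS
    | succ J ih =>
      intro hJ
      have e : 2^(12-J) = 2*2^(12-(J+1)) := by rw [← pow_succ']; congr 1; omega
      have e12 : 2^J*2^(12-J) = 4096 := by rw [← pow_add]; rw [show J+(12-J) = 12 by omega]; norm_num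
      refine P.st_step J (3*μ*2^(12-J)) (8192*μ + 6*μ*2^(12-J)) _ (12288*μ*P.X) (by positivity) ?_ ?_ ?_ E 8192 hE hX ?_ hΛ hsm
        (ih (by omega))
      · calc 2^J*P.X*(3*μ*2^(12-J)) = (2^J*2^(12-J))*(3*μ*P.X) := by ring
          _ = _ := by rw [e12]; ring
      · have : 2^(12-J) ≤ 4096 := by rw [← e12]; exact Nat.le_mul_of_pos_left _ (by positivity)
        rw [hT]; nlinarith
      · rw [e]; apply le_of_eq; ring
      · have : 2*2^(J+1) ≤ 2^13 := by rw [← pow_succ']; exact Nat.pow_le_pow_right (by norm_num) (by omega)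
        calc ((2*2^(J+1) : ℕ):ℝ) ≤ ((2^13:ℕ):ℝ) := by exact_mod_cast this
          _ = 8192 := by norm_num
  have h12 := main 12 le_rfl
  intro ρ i hi m0 m1 m2 hm
  exact h12 ρ i hi m0 m1 m2 (by omega)

end Stp

end

section
open Polynomial

theorem poly_zero_of_hasse (p : ℝ[X]) (n M : ℕ) (r : ℕ → ℝ) (hr : ∀ i < n, ∀ j < n, r i = r j → i = j)
    (hz : ∀ i < n, ∀ m < M, (hasseDeriv m p).eval (r i) = 0) (hd : p.degree < ((n*M:ℕ):WithBot ℕ)) : p = 0 := by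
  by_contra hp
  have h1 : ∀ i ∈ Finset.range n, (X - C (r i))^M ∣ p := by
    intro i hi
    have h2 : X^M ∣ taylor (r i) p := by
      rw [X_pow_dvd_iff]
      intro m hm
      rw [taylor_coeff]
      exact hz i (Finset.mem_range.1 hi) m hm
    have h3 := map_dvd (taylorAlgHom (-r i)) h2
    have h4 : (taylorAlgHom (-r i)) ((taylor (r i)) p) = p := by
      simp [taylor_taylor]
    have h5 : (taylorAlgHom (-r i)) (X^M : ℝ[X]) = (X - C (r i))^M := by
      simp [taylor_X, sub_eq_add_neg]
    rwa [h4, h5] at h3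
  have h2 : ∏ i ∈ Finset.range n, (X - C (r i))^M ∣ p := by
    apply Finset.prod_dvd_of_coprime _ h1
    intro i hi j hj hij
    apply IsCoprime.pow
    apply isCoprime_X_sub_C_of_isUnit_sub
    rw [isUnit_iff_ne_zero, sub_ne_zero]
    intro h
    exact hij (hr i (by simpa using hi) j (by simpa using hj) h)
  have h3 := degree_le_of_dvd h2 hp
  have h4 : (∏ i ∈ Finset.range n, (X - C (r i))^M).degree = ((n*M:ℕ):WithBot ℕ) := by
    rw [degree_prod]
    simp [degree_pow, degree_X_sub_C]
  rw [h4] at h3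
  exact absurd hd (not_lt.2 h3)

theorem comb_moments {ι : Type*} (S : Finset ι) (w u v : ι → ℝ) (n : ℕ)
    (h : ∀ m1 m2, m1 + m2 < n → ∑ l ∈ S, w l * (u l^m1 * v l^m2) = 0) (Q1 Q2 : ℝ[X])
    (hQ : Q1.natDegree + Q2.natDegree < n) : ∑ l ∈ S, w l * (Q1.eval (u l) * Q2.eval (v l)) = 0 := by
  have : ∀ l, w l * (Q1.eval (u l) * Q2.eval (v l)) =
      ∑ i ∈ Finset.range (Q1.natDegree+1), ∑ j ∈ Finset.range (Q2.natDegree+1),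
        Q1.coeff i * Q2.coeff j * (w l * (u l^i * v l^j)) := by
    intro l
    rw [eval_eq_sum_range, eval_eq_sum_range, Finset.sum_mul_sum, Finset.mul_sum]
    refine Finset.sum_congr rfl fun i _ => ?_
    rw [Finset.mul_sum]
    refine Finset.sum_congr rfl fun j _ => ?_
    ring
  simp_rw [this]
  rw [Finset.sum_comm]
  refine Finset.sum_eq_zero fun i hi => ?_
  rw [Finset.sum_comm]
  refine Finset.sum_eq_zero fun j hj => ?_
  rw [← Finset.mul_sum, h i j (by
    have := Finset.mem_range.1 hi; have := Finset.mem_range.1 hj; omega), mul_zero]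

namespace Stp
variable (P : Stp)

theorem endgame (J T' M : ℕ) (hS : P.St J T') (hs : P.L2 ≤ P.s)
    (hcard : (P.L2/2^J+1)*(P.L3/2^J+1) + (P.L1/2^J+1) + M ≤ T')
    (hdeg : P.h*P.L ≤ 2^J*P.X*M) (l0 : ℕ × ℕ × ℕ) (hl0 : l0 ∈ box P.L1 P.L2 P.L3) (i : ℕ) (hi : i < P.h*P.L) :
    P.c l0 i = 0 := by
  classical
  set ρ : ℕ × ℕ × ℕ := (l0.1 % 2^J, l0.2.1 % 2^J, l0.2.2 % 2^J) with hρ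
  have hl0c : l0 ∈ P.cls J ρ := by simp [cls, hl0, hρ]
  set SV := ((P.cls J ρ).image (fun l => vv P.s l)).erase (vv P.s l0) with hSV
  set SU := (((P.cls J ρ).filter (fun l => vv P.s l = vv P.s l0)).image (fun l => uu P.k l)).erase (uu P.k l0) with hSU
  have hvinj : ∀ l ∈ P.cls J ρ, vv P.s l = vv P.s l0 → l.2 = l0.2 := by
    intro l hl hv
    have hb := P.box_mem (Finset.mem_filter.1 hl).1
    have hb0 := P.box_mem hl0
    unfold vv at hv
    have e3 : l.2.2 = l0.2.2 := by
      by_contra hne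
      have hsz : (0:ℤ) < P.s := by omega
      have h1 : (P.s:ℤ) * ((l.2.2:ℤ) - l0.2.2) = l.2.1 - l0.2.1 := by linarith
      rcases lt_or_gt_of_ne hne with h | h
      · have : ((l.2.2:ℤ) - l0.2.2) ≤ -1 := by omega
        nlinarith
      · have : (1:ℤ) ≤ ((l.2.2:ℤ) - l0.2.2) := by omega
        nlinarith
    rw [e3] at hv
    have e2 : l.2.1 = l0.2.1 := by omega
    exact Prod.ext e2 e3
  have hcV : SV.card ≤ (P.L2/2^J+1)*(P.L3/2^J+1) := by
    refine (Finset.card_erase_le).trans ?_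
    have hsub : (P.cls J ρ).image (fun l => vv P.s l) ⊆
        (Finset.range (P.L2/2^J+1) ×ˢ Finset.range (P.L3/2^J+1)).image
          (fun ab => (((2^J*ab.1+ρ.2.1 : ℕ):ℤ) - P.s * ((2^J*ab.2+ρ.2.2:ℕ):ℤ))) := by
      intro v hv
      obtain ⟨l, hl, rfl⟩ := Finset.mem_image.1 hv
      have hf := (Finset.mem_filter.1 hl)
      have hb := P.box_mem hf.1
      refine Finset.mem_image.2 ⟨(l.2.1/2^J, l.2.2/2^J), ?_, ?_⟩
      · rw [Finset.mem_product, Finset.mem_range, Finset.mem_range]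
        exact ⟨Nat.lt_succ_of_le (Nat.div_le_div_right hb.2.1.le), Nat.lt_succ_of_le (Nat.div_le_div_right hb.2.2.le)⟩
      · dsimp only
        rw [← hf.2.2.1, ← hf.2.2.2, Nat.div_add_mod, Nat.div_add_mod]
        rfl
    refine (Finset.card_le_card hsub).trans (Finset.card_image_le.trans ?_)
    simp
  have hcU : SU.card ≤ P.L1/2^J+1 := by
    refine (Finset.card_erase_le).trans ?_
    have hsub : ((P.cls J ρ).filter (fun l => vv P.s l = vv P.s l0)).image (fun l => uu P.k l) ⊆
        (Finset.range (P.L1/2^J+1)).image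
          (fun a => (((2^J*a+ρ.1 : ℕ):ℤ) + P.k * (l0.2.2:ℤ))) := by
      intro v hv
      obtain ⟨l, hl, rfl⟩ := Finset.mem_image.1 hv
      have hl' := (Finset.mem_filter.1 hl)
      have hf := (Finset.mem_filter.1 hl'.1)
      have hb := P.box_mem hf.1
      have e := hvinj l hl'.1 hl'.2
      refine Finset.mem_image.2 ⟨l.1/2^J, ?_, ?_⟩
      · rw [Finset.mem_range]
        exact Nat.lt_succ_of_le (Nat.div_le_div_right hb.1.le)
      · rw [← hf.2.1, Nat.div_add_mod, ← e]
        rfl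
    refine (Finset.card_le_card hsub).trans (Finset.card_image_le.trans ?_)
    simp
  set Q1 : ℝ[X] := ∏ a ∈ SU, (Polynomial.X - C (a:ℝ)) with hQ1
  set Q2 : ℝ[X] := ∏ a ∈ SV, (Polynomial.X - C (a:ℝ)) with hQ2
  have hd1 : Q1.natDegree = SU.card := by rw [hQ1, natDegree_prod_of_monic _ _ (fun i _ => monic_X_sub_C _)]; simp only [natDegree_X_sub_C, Finset.sum_const, smul_eq_mul, mul_one]
  have hd2 : Q2.natDegree = SV.card := by rw [hQ2, natDegree_prod_of_monic _ _ (fun i _ => monic_X_sub_C _)]; simp only [natDegree_X_sub_C, Finset.sum_const, smul_eq_mul, mul_one]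
  have hp0 : pp P.h (P.h*P.L) P.c l0 = 0 := by
    apply poly_zero_of_hasse _ (2^J*P.X) M (fun i => ((i:ℝ)+1/2)*(2/2^J))
    · intro i _ j _ hij
      have h2 : (2/2^J:ℝ) ≠ 0 := by positivity
      have := mul_right_cancel₀ h2 hij
      have : (i:ℝ) = j := by linarith
      exact_mod_cast this
    · intro i hi m0 hm0
      set z := ((i:ℝ)+1/2)*(2/2^J) with hz
      have := comb_moments (P.cls J ρ)
        (fun l => (hasseDeriv m0 (pp P.h (P.h*P.L) P.c l)).eval z *
          Real.exp ((l.1 * P.a1 + l.2.1 * P.a2 + l.2.2 * P.a3) * z))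
        (fun l => (uu P.k l:ℝ)) (fun l => (vv P.s l:ℝ)) (T' - m0) (by
          intro m1 m2 hm
          have h := hS ρ i hi m0 m1 m2 (by omega)
          rw [← h]
          refine Finset.sum_congr rfl fun l _ => ?_
          unfold tm
          ring) Q1 Q2 (by rw [hd1, hd2]; omega)
      rw [Finset.sum_eq_single_of_mem l0 hl0c] at this
      · have hn1 : Q1.eval (uu P.k l0:ℝ) ≠ 0 := by
          rw [hQ1, eval_prod, Finset.prod_ne_zero_iff]
          intro a ha
          simp only [eval_sub, eval_X, eval_C]
          rw [sub_ne_zero]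
          intro h
          exact (Finset.mem_erase.1 ha).1 (by exact_mod_cast h.symm)
        have hn2 : Q2.eval (vv P.s l0:ℝ) ≠ 0 := by
          rw [hQ2, eval_prod, Finset.prod_ne_zero_iff]
          intro a ha
          simp only [eval_sub, eval_X, eval_C]
          rw [sub_ne_zero]
          intro h
          exact (Finset.mem_erase.1 ha).1 (by exact_mod_cast h.symm)
        rcases mul_eq_zero.1 this with h | h
        · rcases mul_eq_zero.1 h with h | h
          · exact h
          · exact absurd h (Real.exp_ne_zero _)
        · exact absurd h (mul_ne_zero hn1 hn2)
      · intro l hl hne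
        by_cases hv : vv P.s l = vv P.s l0
        · have hu : uu P.k l ≠ uu P.k l0 := by
            intro hu
            have e := hvinj l hl hv
            unfold uu at hu
            rw [e] at hu
            exact hne (Prod.ext (by omega) e)
          have : Q1.eval (uu P.k l:ℝ) = 0 := by
            rw [hQ1, eval_prod]
            apply Finset.prod_eq_zero (i := uu P.k l)
            · rw [hSU, Finset.mem_erase]
              exact ⟨hu, Finset.mem_image_of_mem _ (Finset.mem_filter.2 ⟨hl, hv⟩)⟩
            · simp
          rw [this, zero_mul, mul_zero]
        · have : Q2.eval (vv P.s l:ℝ) = 0 := by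
            rw [hQ2, eval_prod]
            apply Finset.prod_eq_zero (i := vv P.s l)
            · rw [hSV, Finset.mem_erase]
              exact ⟨hv, Finset.mem_image_of_mem _ hl⟩
            · simp
          rw [this, mul_zero, mul_zero]
    · have hd : (pp P.h (P.h*P.L) P.c l0).degree < ((P.h*P.L:ℕ):WithBot ℕ) := by
        unfold pp
        refine (degree_sum_le _ _).trans_lt ?_
        rw [Finset.sup_lt_iff (WithBot.bot_lt_coe _)]
        intro j hj
        rw [degree_mul]
        refine (add_le_add_left degree_C_le _).trans_lt ?_
        rw [fQ_degree, zero_add]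
        exact_mod_cast Finset.mem_range.1 hj
      exact hd.trans_le (by exact_mod_cast hdeg)
  have := fQ_indep P.h (P.h*P.L) (fun i => (P.c l0 i:ℝ)) hp0 i hi
  exact_mod_cast this
end Stp

end

section
open Polynomial

theorem mul_le_exp {a b x y : ℝ} (ha : a ≤ Real.exp x) (hb : b ≤ Real.exp y) (hb0 : 0 ≤ b) :
    a * b ≤ Real.exp (x+y) := by
  rw [Real.exp_add]
  exact mul_le_mul ha hb hb0 (Real.exp_pos _).le

theorem pow_le_exp {a x : ℝ} (n : ℕ) (ha0 : 0 ≤ a) (ha : a ≤ Real.exp x) : a^n ≤ Real.exp (n*x) := by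
  rw [Real.exp_nat_mul]
  exact pow_le_pow_left₀ ha0 ha n

theorem self_le_exp (y : ℝ) (hy : 1e9 ≤ y) : y ≤ Real.exp (0.0000001*y) := by
  have h0 : 0 < y := by linarith
  have h1 : y = 1e8 * (y/1e8) := by ring
  have h2 : y/1e8 ≤ Real.exp (y/1e8 - 1) := by
    have := Real.add_one_le_exp (y/1e8 - 1); linarith
  have h3 : (1e8:ℝ) ≤ Real.exp 27 := by
    have : (2:ℝ) ≤ Real.exp 1 := by linarith [Real.exp_one_gt_d9]
    calc (1e8:ℝ) ≤ 2^27 := by norm_num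
      _ ≤ (Real.exp 1)^27 := by gcongr
      _ = Real.exp 27 := by rw [← Real.exp_nat_mul]; norm_num
  calc y = 1e8 * (y/1e8) := h1
    _ ≤ Real.exp (27 + (y/1e8-1)) := mul_le_exp h3 h2 (by positivity)
    _ ≤ _ := by apply Real.exp_le_exp.2; norm_num at hy ⊢; linarith

theorem QB_le (X h L : ℕ) (hh : 18 ≤ h) (ϱ x c : ℝ) (hϱ : 0 ≤ ϱ) (hx : (2*X+ϱ) ≤ h * Real.exp c) (hc : c + 1 ≤ x) :
    QB (2*X) ϱ h L ≤ Real.exp (x * (h*L:ℕ)) := by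
  have hh' : (0:ℝ) < h := by exact_mod_cast (by omega : 0 < h)
  unfold QB
  have h1 : (h:ℝ)^h / h.factorial ≤ Real.exp h := Real.pow_div_factorial_le_exp h hh'.le h
  have h2 : (2*X+ϱ)^h/h.factorial ≤ Real.exp (h*x) := by
    calc (2*X+ϱ)^h/h.factorial ≤ (h*Real.exp c)^h/h.factorial := by gcongr
      _ = (h:ℝ)^h / h.factorial * Real.exp c^h := by rw [mul_pow]; ring
      _ ≤ Real.exp (h + h*c) := mul_le_exp h1 (by rw [← Real.exp_nat_mul]) (by positivity)
      _ ≤ _ := by apply Real.exp_le_exp.2; nlinarith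
  calc _ ≤ Real.exp (L*(h*x)) := pow_le_exp L (by positivity) h2
    _ = _ := by congr 1; push_cast; ring

theorem log_facts : Real.exp 6.9325 ≥ 1025 ∧ Real.exp 9.7671 ≥ 17409 ∧ Real.log 2 ≤ 0.693148 ∧ 0.693147 ≤ Real.log 2 := by
  have h2 := Real.log_two_lt_d9
  have h2' := Real.log_two_gt_d9
  refine ⟨?_, ?_, by linarith, by linarith⟩
  · calc (1025:ℝ) ≤ 2^10 * (1 + 0.001) := by norm_num
      _ ≤ Real.exp (10*Real.log 2) * Real.exp 0.001 := by
        gcongr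
        · rw [show (10:ℝ) = ((10:ℕ):ℝ) by norm_num, Real.exp_nat_mul, Real.exp_log (by norm_num)]
        · linarith [Real.add_one_le_exp (0.001:ℝ)]
      _ = Real.exp (10*Real.log 2 + 0.001) := by rw [Real.exp_add]
      _ ≤ _ := by apply Real.exp_le_exp.2; norm_num at h2 ⊢; linarith
  · calc (17409:ℝ) ≤ 2^14 * (1 + 0.063) := by norm_num
      _ ≤ Real.exp (14*Real.log 2) * Real.exp 0.063 := by
        gcongr
        · rw [show (14:ℝ) = ((14:ℕ):ℝ) by norm_num, Real.exp_nat_mul, Real.exp_log (by norm_num)]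
        · linarith [Real.add_one_le_exp (0.063:ℝ)]
      _ = Real.exp (14*Real.log 2 + 0.063) := by rw [Real.exp_add]
      _ ≤ _ := by apply Real.exp_le_exp.2; norm_num at h2 ⊢; linarith

theorem a1_lt {α a1 : ℝ} (hα : α^3 = α^2 + 1) (ha1 : Real.exp a1 = α) : a1 ≤ 0.386 ∧ 0.37 ≤ a1 := by
  have h1 := al_lt hα
  have h2 := al_gt hα
  constructor
  · by_contra hcon
    have h3 := Real.exp_lt_exp.2 (not_le.1 hcon)
    have h4 := Real.quadratic_le_exp_of_nonneg (by norm_num : (0:ℝ) ≤ 0.0965)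
    have h5 : Real.exp 0.386 = Real.exp 0.0965^4 := by rw [← Real.exp_nat_mul]; norm_num
    have h6 : (1.47:ℝ) ≤ Real.exp 0.0965^4 := by
      calc (1.47:ℝ) ≤ (1 + 0.0965 + 0.0965^2/2)^4 := by norm_num
        _ ≤ _ := by gcongr
    linarith
  · by_contra hcon
    have h3 := Real.exp_lt_exp.2 (not_le.1 hcon)
    have h4 : Real.exp (-0.37) ≥ 0.685 := by
      have h6 := Real.one_sub_le_exp_neg (0.37/16:ℝ)
      have h7 : Real.exp (-0.37) = Real.exp (-(0.37/16))^16 := by rw [← Real.exp_nat_mul]; norm_num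
      rw [h7]
      calc (0.685:ℝ) ≤ (1 - 0.37/16)^16 := by norm_num
        _ ≤ _ := pow_le_pow_left₀ (by norm_num) h6 _
    have h5 : Real.exp (-0.37) * Real.exp 0.37 = 1 := by rw [← Real.exp_add]; norm_num
    have h6 := Real.exp_pos 0.37
    nlinarith

end

section
open Polynomial

set_option maxHeartbeats 2000000 in
/-- numerical bounds shared by the Siegel step and the induction -/
theorem num_bounds {α a1 a2 V B : ℝ} (hα : α^3 = α^2+1) (ha1 : Real.exp a1 = α) (ha2 : 0 ≤ a2) (hV : 1 ≤ V) (hB : 1 ≤ B)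
    (h μ L2 L3 : ℕ) (hh : 18 ≤ h) (hμ : 5000000 ≤ μ) (hβ : Real.log B ≤ 6*(h+1))
    (hL2 : (L2:ℝ)*a2 ≤ 32768*μ/500) (hL3 : (L3:ℝ)*Real.log V ≤ 32768*μ/500)
    (hL2' : L2 ≤ 32768*μ) (hL3' : L3 ≤ 32768*μ) (Ω : ℝ) (hΩ : Ω = (32768*μ)*(512*h)) :
    1e12 ≤ Ω ∧ B^(32768*μ) ≤ Real.exp (0.01237*Ω) ∧ (2:ℝ)^(h*(8192*μ)) ≤ Real.exp (0.00033846*Ω) ∧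
    (8192:ℝ)^(h*(8192*μ)) ≤ Real.exp (0.0044*Ω) ∧
    QB (2*(512*h:ℕ)) 1 h (8192*μ) ≤ Real.exp (0.0038734*Ω) ∧
    QB (2*(512*h:ℕ)) 2 h (8192*μ) ≤ Real.exp (0.0038734*Ω) ∧
    QB (2*(512*h:ℕ)) (32*(512*h:ℕ)+1) h (8192*μ) ≤ Real.exp (0.0052574*Ω) ∧
    V^(L3*(2*(512*h))) ≤ Real.exp (0.004*Ω) ∧
    2*(512*h:ℕ)*((256*μ:ℕ)*a1+L2*a2) ≤ 0.010032*Ω ∧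
    (((256*μ:ℕ):ℝ)*a1+L2*a2 + L3*Real.log V + 1) * (1+2*(512*h:ℕ)) ≤ 0.014037*Ω ∧
    (((256*μ:ℕ):ℝ)*a1+L2*a2 + L3*Real.log V + 1) * (32*(512*h:ℕ)+2*(512*h:ℕ)) ≤ 0.23855*Ω ∧
    (((256*μ:ℕ):ℝ)*L2*L3) ≤ Real.exp (0.000001*Ω) ∧ (((h*(8192*μ):ℕ):ℝ)) ≤ Real.exp (0.000001*Ω) ∧
    (2*(2*(512*h:ℕ))*L3:ℝ) ≤ Real.exp (0.000001*Ω) ∧ (2*(12288*μ*(512*h):ℕ):ℝ) ≤ Real.exp (0.000001*Ω) := by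
  obtain ⟨f1, f2, f3, f4⟩ := log_facts
  obtain ⟨g1, g2⟩ := a1_lt hα ha1
  have hhr : (18:ℝ) ≤ h := by exact_mod_cast hh
  have hμr : (5000000:ℝ) ≤ μ := by exact_mod_cast hμ
  have hμh : (5000000:ℝ) * 18 ≤ μ * h := by gcongr
  have hΩμ : Ω = 16777216*(μ*h) := by rw [hΩ]; ring
  have hΩ1 : 1e12 ≤ Ω := by rw [hΩμ]; norm_num; linarith
  have hhL : ((h*(8192*μ):ℕ):ℝ) = Ω/2048 := by rw [hΩμ]; push_cast; ring
  have hlV := Real.log_nonneg hV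
  have hμ0 : (0:ℝ) ≤ μ := by linarith
  have hh0 : (0:ℝ) ≤ h := by linarith
  have hL2r : (L2:ℝ) ≤ 32768*μ := by exact_mod_cast hL2'
  have hL3r : (L3:ℝ) ≤ 32768*μ := by exact_mod_cast hL3'
  have hΩe : Ω ≤ Real.exp (0.0000001*Ω) := self_le_exp Ω (by norm_num at hΩ1 ⊢; linarith)
  have hΩ2 : Ω ≤ Real.exp (0.000001*Ω) := hΩe.trans (Real.exp_le_exp.2 (by norm_num; linarith))
  have ha1L : ((256*μ:ℕ):ℝ)*a1 ≤ 98.816*μ := by push_cast; nlinarith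
  have hsum : ((256*μ:ℕ):ℝ)*a1+L2*a2 + L3*Real.log V + 1 ≤ 229.889*μ := by
    have : (1:ℝ) ≤ 0.000001*μ := by norm_num; linarith
    linarith
  refine ⟨hΩ1, ?_, ?_, ?_, ?_, ?_, ?_, ?_, ?_, ?_, ?_, ?_, ?_, ?_, ?_⟩
  · have hB0 : 0 < B := by linarith
    refine (pow_le_exp (x := Real.log B) _ hB0.le (Real.exp_log hB0).ge).trans (Real.exp_le_exp.2 ?_)
    push_cast
    rw [hΩμ]
    calc 32768*(μ:ℝ)*Real.log B ≤ 32768*(μ:ℝ)*(6*(h+1)) := by gcongr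
      _ = 32768*6*(μ*h) + 32768*6*μ := by ring
      _ ≤ _ := by nlinarith
  · refine (pow_le_exp (x := Real.log 2) _ (by norm_num) (Real.exp_log (by norm_num)).ge).trans (Real.exp_le_exp.2 ?_)
    rw [hhL]; norm_num at f3 ⊢; nlinarith
  · refine (pow_le_exp (x := 13*Real.log 2) _ (by norm_num) ?_).trans (Real.exp_le_exp.2 ?_)
    · rw [show (13:ℝ) = ((13:ℕ):ℝ) by norm_num, Real.exp_nat_mul, Real.exp_log (by norm_num)]; norm_num
    rw [hhL]; norm_num at f3 ⊢; nlinarith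
  · refine (QB_le (512*h) h _ hh 1 7.9325 6.9325 (by norm_num) ?_ (by norm_num)).trans (Real.exp_le_exp.2 ?_)
    · push_cast; nlinarith
    · rw [hhL]; norm_num at hΩ1 ⊢; linarith
  · refine (QB_le (512*h) h _ hh 2 7.9325 6.9325 (by norm_num) ?_ (by norm_num)).trans (Real.exp_le_exp.2 ?_)
    · push_cast; nlinarith
    · rw [hhL]; norm_num at hΩ1 ⊢; linarith
  · refine (QB_le (512*h) h _ hh _ 10.7671 9.7671 (by positivity) ?_ (by norm_num)).trans (Real.exp_le_exp.2 ?_)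
    · push_cast; nlinarith
    · rw [hhL]; norm_num at hΩ1 ⊢; linarith
  · have hV0 : 0 < V := by linarith
    refine (pow_le_exp (x := Real.log V) _ hV0.le (Real.exp_log hV0).ge).trans (Real.exp_le_exp.2 ?_)
    push_cast
    calc (L3:ℝ)*(2*(512*h))*Real.log V = (L3*Real.log V)*(2*(512*h)) := by ring
      _ ≤ (32768*μ/500)*(2*(512*h)) := by gcongr
      _ = _ := by rw [hΩ]; ring
  · calc 2*((512*h:ℕ):ℝ)*((256*μ:ℕ)*a1+L2*a2) ≤ 2*((512*h:ℕ):ℝ)*(98.816*μ+32768*μ/500) := by gcongr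
      _ = 168296.448*(μ*h) := by push_cast; ring
      _ ≤ _ := by rw [hΩμ]; norm_num; linarith
  · calc _ ≤ (229.889*μ)*(1+2*((512*h:ℕ):ℝ)) := by gcongr
      _ = 229.889*μ + 235406.336*(μ*h) := by push_cast; ring
      _ ≤ _ := by rw [hΩμ]; nlinarith
  · calc _ ≤ (229.889*μ)*(32*((512*h:ℕ):ℝ)+2*(512*h:ℕ)) := by gcongr
      _ = 4001907.712*(μ*h) := by push_cast; ring
      _ ≤ _ := by rw [hΩμ]; norm_num; linarith
  · have e1 : ((256*μ:ℕ):ℝ) ≤ Ω := by push_cast; rw [hΩμ]; nlinarith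
    have e2 : (L2:ℝ) ≤ Ω := by rw [hΩμ]; nlinarith
    have e3 : (L3:ℝ) ≤ Ω := by rw [hΩμ]; nlinarith
    calc _ ≤ Real.exp (0.0000001*Ω+0.0000001*Ω+0.0000001*Ω) :=
          mul_le_exp (mul_le_exp (e1.trans hΩe) (e2.trans hΩe) (by positivity)) (e3.trans hΩe) (by positivity)
      _ ≤ _ := by apply Real.exp_le_exp.2; norm_num; linarith
  · rw [hhL]; norm_num at hΩ1 hΩ2 ⊢; linarith
  · have h4 : 4*Ω ≤ Real.exp (0.000001*Ω) :=
      (self_le_exp (4*Ω) (by norm_num at hΩ1 ⊢; linarith)).trans (Real.exp_le_exp.2 (by norm_num; linarith))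
    refine le_trans ?_ h4
    calc (2*(2*(512*h:ℕ))*L3:ℝ) ≤ 2*(2*(512*h:ℕ))*(32768*μ) := by gcongr
      _ = _ := by rw [hΩ]; push_cast; ring
  · refine le_trans ?_ hΩ2
    rw [hΩ]; push_cast; nlinarith

end

section
open Polynomial

set_option maxHeartbeats 4000000 in
theorem lfl_core {α : ℝ} (hα : α^3 = α^2+1) (G p q : ℕ) (hG : ¬ IsSquare G) (hp : 0 < p) (hq : 0 < q)
    (a1 a2 a3 : ℝ) (ha1 : Real.exp a1 = α) (ha2 : Real.exp a2 = G) (ha3 : Real.exp a3 = (p/q:ℝ)*(3*α-2))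
    (V : ℝ) (hVq : (q:ℝ) ≤ V) (hVp : (p:ℝ)*(3*α+2) ≤ V)
    (k s h μ Δ L2 L3 : ℕ) (hh : 18 ≤ h) (hμ : 5000000 ≤ μ)
    (hΔ : ∀ i, 1 ≤ i → i ≤ h → i ∣ Δ) (hΔ1 : 1 ≤ Δ)
    (B : ℝ) (hΔB : (Δ:ℝ) ≤ B) (hβ : Real.log B ≤ 6*(h+1))
    (hu : ∀ l ∈ box (256*μ) L2 L3, |(uu k l : ℝ)| ≤ B)
    (hv : ∀ l ∈ box (256*μ) L2 L3, |(vv s l : ℝ)| ≤ B)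
    (hL2 : (L2:ℝ)*a2 ≤ 32768*μ/500) (hL3 : (L3:ℝ)*Real.log V ≤ 32768*μ/500)
    (hL2' : L2 ≤ 32768*μ) (hL3' : L3 ≤ 32768*μ) (hL20 : 0 < L2) (hL30 : 0 < L3)
    (hcount : 524288*((32768*μ+1)*(32768*μ+2)) ≤ 32768*μ*(L2*L3))
    (hcard : (L2/2^12+1)*(L3/2^12+1) ≤ 8000*μ) (hs : L2 ≤ s)
    (hΛ : |a3 - k*a1 + s*a2| ≤ Real.exp (-(1.63*((32768*μ)*(512*h))))) : False := by
  have hG1 : 1 ≤ G := by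
    rcases Nat.eq_zero_or_pos G with h | h
    · exact absurd ⟨0, by simp [h]⟩ hG
    · exact h
  have hV1 : 1 ≤ V := le_trans (by exact_mod_cast hq) hVq
  have hB1 : 1 ≤ B := le_trans (by exact_mod_cast hΔ1) hΔB
  have ha20 : 0 ≤ a2 := by
    by_contra hcon
    have := (Real.exp_lt_exp.2 (not_le.1 hcon)).trans_eq Real.exp_zero
    have h2 : (1:ℝ) ≤ G := by exact_mod_cast hG1
    linarith
  obtain ⟨Ω, hΩ⟩ : ∃ Ω : ℝ, Ω = (32768*μ)*(512*h) := ⟨_, rfl⟩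
  rw [← hΩ] at hΛ
  obtain ⟨n0, nB, n2, nK, nQ1, nQ2, nQE, nV, nR, nT1, nT2, nNc, nhL, nX, nN⟩ :=
    num_bounds hα ha1 ha20 hV1 hB1 h μ L2 L3 hh hμ hβ hL2 hL3 hL2' hL3' Ω hΩ
  have hΩ1 : (1e12:ℝ) ≤ Ω := n0
  norm_num at hΩ1
  have hQ0 : ∀ Y ϱ : ℝ, 0 ≤ Y → 0 ≤ ϱ → 0 ≤ QB Y ϱ h (8192*μ) := by
    intro Y ϱ h1 h2; unfold QB; positivity
  have hXr : (0:ℝ) ≤ 2*((512*h:ℕ):ℝ) := by positivity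
  have hQ1 := hQ0 _ 1 hXr (by norm_num)
  have hQ2 := hQ0 _ 2 hXr (by norm_num)
  have hQE := hQ0 _ (32*((512*h:ℕ):ℝ)+1) hXr (by positivity)
  obtain ⟨Cm, hCmdef⟩ : ∃ Cm : ℝ, Cm = Real.exp (0.01021*Ω) := ⟨_, rfl⟩
  have hCm1 : 1 ≤ Cm := by rw [hCmdef]; exact Real.one_le_exp (by positivity)
  have hVE0 : 0 ≤ V^(L3*(2*(512*h))) := by positivity
  have hBT0 : 0 ≤ B^(32768*μ) := by positivity
  have hcount' : 4 * ((512*h) * ((32768*μ)*(32768*μ+1)*(32768*μ+2))) ≤ 2 * ((256*μ)*L2*L3*(h*(8192*μ))) := by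
    have := Nat.mul_le_mul_left (128*h*μ) hcount
    calc 4 * ((512*h) * ((32768*μ)*(32768*μ+1)*(32768*μ+2))) = 128*h*μ*(524288*((32768*μ+1)*(32768*μ+2))) := by ring
      _ ≤ _ := this
      _ = _ := by ring
  have hhY : (h:ℝ) ≤ 2*((512*h:ℕ):ℝ) := by
    push_cast; have : (0:ℝ) ≤ h := by positivity
    linarith
  have hC : (((256*μ)*L2*L3*(h*(8192*μ)) : ℕ):ℝ) * (2^(h*(8192*μ)) * B^(32768*μ) * QB (2*(512*h:ℕ)) 1 h (8192*μ) *
      (Real.exp (2*(512*h:ℕ)*((256*μ:ℕ)*a1+L2*a2)) * V^(L3*(2*(512*h))))) ≤ Cm^(4-1) := by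
    have e1 : (((256*μ)*L2*L3*(h*(8192*μ)) : ℕ):ℝ) ≤ Real.exp (0.000001*Ω + 0.000001*Ω) := by
      have : (((256*μ)*L2*L3*(h*(8192*μ)) : ℕ):ℝ) = (((256*μ:ℕ):ℝ)*L2*L3) * ((h*(8192*μ):ℕ):ℝ) := by push_cast; ring
      rw [this]
      exact mul_le_exp nNc nhL (by positivity)
    have e2 := mul_le_exp (Real.exp_le_exp.2 nR) nV hVE0
    have e3 := mul_le_exp (mul_le_exp (mul_le_exp n2 nB hBT0) nQ1 hQ1) e2 (by positivity)
    refine (mul_le_exp e1 e3 (by positivity)).trans ?_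
    rw [hCmdef, ← Real.exp_nat_mul]
    apply Real.exp_le_exp.2
    norm_num
    linarith
  obtain ⟨c, ⟨l0, hl0, i0, hi0, hne⟩, hcb, hcz⟩ := siegel_main hα G p q hG1 hq a1 a2 a3 ha1 ha2 ha3 V hVq hVp k s h (8192*μ) Δ
    (512*h) (32768*μ) (256*μ) L2 L3 4 (by omega) hΔ hΔ1 B hΔB hu hv hhY (by omega) (by omega) (by norm_num) hcount' Cm hCm1 hC
  obtain ⟨P, hP⟩ : ∃ P : Stp, P = (⟨α, hα, G, p, q, hG, hp, hq, a1, a2, a3, ha1, ha2, ha3, V, hVq, hVp, k, s, h, 8192*μ, Δ,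
    512*h, 32768*μ, 256*μ, L2, L3, by omega, hΔ, hΔ1, B, hΔB, hu, hv, hhY, by omega, by omega, by omega, by omega, hL20, hL30,
    c, Cm, hCm1, hcb⟩ : Stp) := ⟨_, rfl⟩
  have p1 : P.a1 = a1 := by rw [hP]
  have p2 : P.a2 = a2 := by rw [hP]
  have p3 : P.a3 = a3 := by rw [hP]
  have pV : P.V = V := by rw [hP]
  have pk : P.k = k := by rw [hP]
  have ps : P.s = s := by rw [hP]
  have ph : P.h = h := by rw [hP]
  have pL : P.L = 8192*μ := by rw [hP]
  have pX : P.X = 512*h := by rw [hP]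
  have pT : P.T = 32768*μ := by rw [hP]
  have pL1 : P.L1 = 256*μ := by rw [hP]
  have pL2 : P.L2 = L2 := by rw [hP]
  have pL3 : P.L3 = L3 := by rw [hP]
  have pB : P.B = B := by rw [hP]
  have pc : P.c = c := by rw [hP]
  have pCm : P.Cm = Cm := by rw [hP]
  clear hP
  have hEmult : P.mult 8192 ≤ Real.exp (1.0573*Ω) := by
    have hEm : P.Em 8192 ≤ Real.exp (0.0044*Ω + 0.01237*Ω + (0.000001*Ω+0.01021*Ω+0.0038734*Ω)) := by
      unfold Stp.Em
      rw [ph, pL, pB, pT, pCm, pX]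
      exact mul_le_exp (mul_le_exp nK nB hBT0) (mul_le_exp (mul_le_exp nhL hCmdef.le (by linarith)) nQ1 hQ1) (by positivity)
    have hEm0 := P.one_le_Em 8192 (by norm_num)
    have hNc : P.Nc ≤ Real.exp (0.000001*Ω) := by
      unfold Stp.Nc; rw [pL1, pL2, pL3]; exact nNc
    have hR : Real.exp P.R ≤ Real.exp (0.010032*Ω) := by
      unfold Stp.R; rw [pX, pL1, pL2, p1, p2]; exact Real.exp_le_exp.2 nR
    have hVE : P.VE ≤ Real.exp (0.004*Ω) := by
      unfold Stp.VE; rw [pV, pL3, pX]; exact nV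
    have hVE0' := P.one_le_VE
    have hNc0 := P.one_le_Nc
    have hpw := pow_le_exp 23 (by positivity)
      (mul_le_exp (mul_le_exp (mul_le_exp hNc hEm (by linarith)) hR (Real.exp_pos _).le) hVE (by linarith))
    unfold Stp.mult
    have hK : (8192:ℝ)^(P.h*P.L) ≤ Real.exp (0.0044*Ω) := by rw [ph, pL]; exact nK
    have hBT : P.B^P.T ≤ Real.exp (0.01237*Ω) := by rw [pB, pT]; exact nB
    have hBT0' : 0 ≤ P.B^P.T := by rw [pB]; positivity
    refine (mul_le_exp (mul_le_exp (mul_le_exp (mul_le_exp hK hBT hBT0') hVE (by linarith)) hVE (by linarith))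
      hpw (by positivity)).trans (Real.exp_le_exp.2 ?_)
    push_cast; norm_num; linarith only [hΩ1]
  have hmult0 : 0 ≤ P.mult 8192 := by
    have hEm0 := P.one_le_Em 8192 (by norm_num)
    have hVE0' := P.one_le_VE
    have hNc0 := P.one_le_Nc
    have := P.one_le_B
    unfold Stp.mult; positivity
  have pΛ : P.Λ = a3 - k*a1 + s*a2 := by unfold Stp.Λ; rw [p1, p2, p3, pk, ps]
  have hsm1 : P.eps1 (12288*μ*P.X) * P.mult 8192 ≤ Real.exp (-2) := by
    have hf : (4*Real.exp 0.01)^(12288*μ*(512*h)) ≤ Real.exp (0.523865*Ω) := by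
      refine (pow_le_exp (x := 2*Real.log 2 + 0.01) _ (by positivity) ?_).trans (Real.exp_le_exp.2 ?_)
      · rw [Real.exp_add, show (2:ℝ) * Real.log 2 = ((2:ℕ):ℝ) * Real.log 2 by norm_num, Real.exp_nat_mul, Real.exp_log (by norm_num)]
        norm_num
      · have : ((12288*μ*(512*h):ℕ):ℝ) = 0.375*Ω := by rw [hΩ]; push_cast; ring
        rw [this]
        have := log_facts.2.2.1
        norm_num at this ⊢
        nlinarith only [this, hΩ1]
    have hA : P.eps1 (12288*μ*P.X) ≤ Real.exp (0.000001*Ω + (0.01237*Ω + (0.000001*Ω+0.01021*Ω+0.0038734*Ω) + 0.014037*Ω +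
        (0.000001*Ω + -(1.63*Ω))) + (0.000001*Ω + 0.523865*Ω)) := by
      unfold Stp.eps1 Stp.Nc Stp.AA Stp.Θ
      rw [pL1, pL2, pL3, pB, pT, ph, pL, pCm, pX, p1, p2, pV, pΛ]
      have e1 : (2*(2*((512*h:ℕ):ℝ))*(L3*|a3 - k*a1 + s*a2|)) ≤ Real.exp (0.000001*Ω + -(1.63*Ω)) := by
        rw [← mul_assoc]; exact mul_le_exp nX hΛ (abs_nonneg _)
      refine mul_le_exp (mul_le_exp nNc (mul_le_exp (mul_le_exp (mul_le_exp nB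
        (mul_le_exp (mul_le_exp nhL hCmdef.le (by linarith)) nQ2 hQ2) (by positivity))
        (Real.exp_le_exp.2 nT1) (Real.exp_pos _).le) e1 (by positivity)) (by positivity))
        (mul_le_exp nN hf (by positivity)) (by positivity)
    refine (mul_le_exp hA hEmult hmult0).trans (Real.exp_le_exp.2 ?_)
    norm_num; linarith only [hΩ1]
  have hsm2 : P.eps2 (12288*μ*P.X) 32 * P.mult 8192 ≤ Real.exp (-2) := by
    have hf : (2*Real.exp 0.01/(Real.exp 1*32))^(12288*μ*(512*h)) ≤ Real.exp (-(1.41096*Ω)) := by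
      refine (pow_le_exp (x := -(4*Real.log 2 + 0.99)) _ (by positivity) ?_).trans (Real.exp_le_exp.2 ?_)
      · have : Real.exp (-(4*Real.log 2 + 0.99)) = (Real.exp (((4:ℕ):ℝ)*Real.log 2))⁻¹ * (Real.exp 0.01 / Real.exp 1) := by
          rw [← Real.exp_neg, ← Real.exp_sub, ← Real.exp_add]; congr 1; push_cast; ring
        rw [this, Real.exp_nat_mul, Real.exp_log (by norm_num)]
        apply le_of_eq
        field_simp
        norm_num
      · have : ((12288*μ*(512*h):ℕ):ℝ) = 0.375*Ω := by rw [hΩ]; push_cast; ring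
        rw [this]
        have := log_facts.2.2.2
        norm_num at this ⊢
        nlinarith only [this, hΩ1]
    have hA : P.eps2 (12288*μ*P.X) 32 ≤ Real.exp (0.000001*Ω + (0.01237*Ω + (0.000001*Ω+0.01021*Ω+0.0052574*Ω) + 0.23855*Ω)
         + -(1.41096*Ω)) := by
      unfold Stp.eps2 Stp.Nc Stp.AA Stp.Θ
      rw [pL1, pL2, pL3, pB, pT, ph, pL, pCm, pX, p1, p2, pV]
      refine mul_le_exp (mul_le_exp nNc (mul_le_exp (mul_le_exp nB
        (mul_le_exp (mul_le_exp nhL hCmdef.le (by linarith)) nQE hQE) (by positivity))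
        (Real.exp_le_exp.2 nT2) (Real.exp_pos _).le) (by positivity))
        hf (by positivity)
    refine (mul_le_exp hA hEmult hmult0).trans (Real.exp_le_exp.2 ?_)
    norm_num; linarith only [hΩ1]
  have hsm : (P.eps1 (12288*μ*P.X) + P.eps2 (12288*μ*P.X) 32) * P.mult 8192 < 1 := by
    have : Real.exp (-2) ≤ 1/3 := by
      rw [Real.exp_neg, inv_le_comm₀ (Real.exp_pos _) (by norm_num)]
      linarith [Real.add_one_le_exp (2:ℝ)]
    rw [add_mul]; linarith
  have hΛ1 : 2*P.X*(P.L3*|P.Λ|) ≤ 1 := by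
    rw [pX, pL3, pΛ, ← mul_assoc]
    have e1 : (2*((512*h:ℕ):ℝ)*L3) ≤ 2*(2*((512*h:ℕ):ℝ))*L3 := by
      have : (0:ℝ) ≤ ((512*h:ℕ):ℝ)*L3 := by positivity
      linarith
    refine (mul_le_exp (e1.trans nX) hΛ (abs_nonneg _)).trans ?_
    rw [← Real.exp_zero]
    apply Real.exp_le_exp.2
    norm_num; linarith only [hΩ1]
  have hS0 : P.St 0 P.T := by
    intro ρ i hi m0 m1 m2 hm
    by_cases hρ : ρ = (0,0,0)
    · subst hρ
      have hcls : P.cls 0 (0,0,0) = box (256*μ) L2 L3 := by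
        unfold Stp.cls
        rw [pL1, pL2, pL3]
        apply Finset.filter_true_of_mem
        intro l _
        simp [Nat.mod_one]
      rw [hcls]
      rw [pX] at hi
      rw [pT] at hm
      rw [← hcz i (by simpa using hi) m0 m1 m2 hm]
      have hz : ((i:ℝ)+1/2)*(2/2^0) = ((2*i+1:ℕ):ℝ) := by push_cast; ring
      rw [hz]
      unfold Stp.tm
      rw [p1, p2, p3, pk, ps, ph, pL, pc]
    · rw [P.cls_empty, Finset.sum_empty]
      simp only [pow_zero, Nat.lt_one_iff]
      rintro ⟨h1, h2, h3⟩
      exact hρ (Prod.ext h1 (Prod.ext h2 h3))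
  have hS := P.st_induct μ (by omega) pT 32 (by norm_num) (by rw [pX]; omega) hΛ1 hsm hS0
  have := P.endgame 12 (8192*μ) μ hS (by rw [pL2, ps]; exact hs) (by
      rw [pL1, pL2, pL3]
      have : 256*μ/2^12+1 ≤ μ := by omega
      omega) (by rw [ph, pL, pX]; nlinarith only [Nat.zero_le (h*μ)]) l0 (by rw [pL1, pL2, pL3]; exact hl0) i0 (by rw [ph, pL]; exact hi0)
  rw [pc] at this
  exact hne this

end

section
theorem lfl_params {a2 H : ℝ} (h2 : 0.693 ≤ a2) (hH : 1.8 ≤ H) :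
    ∃ μ L2 L3 : ℕ, 5000000 ≤ μ ∧ (μ:ℝ) ≤ 4.2e6*(a2*H) + 1 ∧ (L2:ℝ)*a2 ≤ 32768*μ/500 ∧ (L3:ℝ)*H ≤ 32768*μ/500 ∧
      L2 ≤ 32768*μ ∧ L3 ≤ 32768*μ ∧ 0 < L2 ∧ 0 < L3 ∧
      524288*((32768*μ+1)*(32768*μ+2)) ≤ 32768*μ*(L2*L3) ∧ (L2/2^12+1)*(L3/2^12+1) ≤ 8000*μ ∧
      (L2:ℝ) ≤ 2.8e8*H ∧ (L3:ℝ) ≤ 2.8e8*a2 ∧ 256*(μ:ℝ) ≤ 1.2e9*(a2*H) := by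
  obtain ⟨w, hw⟩ : ∃ w, w = a2*H := ⟨_, rfl⟩
  have hw1 : 1.247 ≤ w := by rw [hw]; norm_num at *; nlinarith
  have ha0 : 0 < a2 := by norm_num at h2; linarith
  have hH0 : 0 < H := by norm_num at hH; linarith
  rw [← hw]
  obtain ⟨μ, hμ1, hμ2⟩ : ∃ μ : ℕ, 4.2e6*w ≤ μ ∧ (μ:ℝ) ≤ 4.2e6*w+1 :=
    ⟨⌈4.2e6*w⌉₊, Nat.le_ceil _, (Nat.ceil_lt_add_one (by positivity)).le⟩
  have hμ5 : (5000000:ℝ) ≤ μ := by norm_num at hμ1 hw1; linarith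
  obtain ⟨x2, hx2⟩ : ∃ x, x = 32768*(μ:ℝ)/(500*a2) := ⟨_, rfl⟩
  obtain ⟨x3, hx3⟩ : ∃ x, x = 32768*(μ:ℝ)/(500*H) := ⟨_, rfl⟩
  have e2 : x2*a2 = 32768*μ/500 := by rw [hx2]; field_simp
  have e3 : x3*H = 32768*μ/500 := by rw [hx3]; field_simp
  have f2 : 65.536*(4.2e6*H) ≤ x2 := by
    rw [hx2, le_div_iff₀ (by positivity)]
    calc _ = 32768*(4.2e6*(a2*H)) := by ring
      _ ≤ _ := by rw [← hw]; linarith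
  have f3 : 65.536*(4.2e6*a2) ≤ x3 := by
    rw [hx3, le_div_iff₀ (by positivity)]
    calc _ = 32768*(4.2e6*(a2*H)) := by ring
      _ ≤ _ := by rw [← hw]; linarith
  have hμ3 : (μ:ℝ) ≤ 4.21e6*w := by norm_num at *; linarith
  have u2 : x2 ≤ 2.8e8*H := by
    rw [hx2, div_le_iff₀ (by positivity)]
    calc _ ≤ 32768*(4.21e6*w) := by linarith
      _ ≤ 2.8e8*500*(a2*H) := by rw [← hw]; norm_num; linarith
      _ = _ := by ring
  have u3 : x3 ≤ 2.8e8*a2 := by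
    rw [hx3, div_le_iff₀ (by positivity)]
    calc _ ≤ 32768*(4.21e6*w) := by linarith
      _ ≤ 2.8e8*500*(a2*H) := by rw [← hw]; norm_num; linarith
      _ = _ := by ring
  have e23 : x2*x3*w = (32768*μ/500)^2 := by rw [hw]; linear_combination x3*H*e2 + 32768*μ/500*e3
  have x2b : 1e8 ≤ x2 := by norm_num at *; linarith
  have x3b : 1e8 ≤ x3 := by norm_num at *; linarith
  have x20 : 0 ≤ x2 := le_trans (by norm_num) x2b
  have x30 : 0 ≤ x3 := le_trans (by norm_num) x3b
  have x2M : x2 ≤ 32768*μ := by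
    rw [hx2]; apply div_le_self (by positivity); norm_num at *; linarith
  have x3M : x3 ≤ 32768*μ := by
    rw [hx3]; apply div_le_self (by positivity); norm_num at *; linarith
  have P1 : 1.8e10*(μ:ℝ) ≤ x2*x3 := by
    have : 1.8e10*(μ:ℝ)*w ≤ x2*x3*w := by
      rw [e23]; norm_num at *; nlinarith
    exact le_of_mul_le_mul_right this (by linarith)
  have P2 : x2*x3 ≤ 1.81e10*(μ:ℝ) := by
    have : x2*x3*w ≤ 1.81e10*(μ:ℝ)*w := by
      rw [e23]; norm_num at *; nlinarith
    exact le_of_mul_le_mul_right this (by linarith)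
  have l2 : ((⌊x2⌋₊:ℕ):ℝ) ≤ x2 := Nat.floor_le x20
  have l3 : ((⌊x3⌋₊:ℕ):ℝ) ≤ x3 := Nat.floor_le x30
  have m2 : x2 - 1 ≤ ((⌊x2⌋₊:ℕ):ℝ) := by linarith [Nat.lt_floor_add_one x2]
  have m3 : x3 - 1 ≤ ((⌊x3⌋₊:ℕ):ℝ) := by linarith [Nat.lt_floor_add_one x3]
  refine ⟨μ, ⌊x2⌋₊, ⌊x3⌋₊, by exact_mod_cast hμ5, hμ2, ?_, ?_, ?_, ?_, ?_, ?_, ?_, ?_, l2.trans u2, l3.trans u3, ?_⟩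
  · rw [← e2]; gcongr
  · rw [← e3]; gcongr
  · have := l2.trans x2M; exact_mod_cast this
  · have := l3.trans x3M; exact_mod_cast this
  · apply Nat.floor_pos.2; norm_num at *; linarith
  · apply Nat.floor_pos.2; norm_num at *; linarith
  · have Q1 : (x2-1)*(x3-1) ≤ (⌊x2⌋₊:ℝ)*(⌊x3⌋₊:ℝ) := by
      apply mul_le_mul m2 m3 _ (by positivity)
      norm_num at *; linarith
    have Q2 : 1.79e10*(μ:ℝ) ≤ (⌊x2⌋₊:ℝ)*(⌊x3⌋₊:ℝ) := by
      refine le_trans ?_ Q1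
      have : x2*x3 - x2 - x3 ≤ (x2-1)*(x3-1) := by linarith
      norm_num at *
      linarith
    have Q3 : 524288*((32768*(μ:ℝ)+1)*(32768*μ+2)) ≤ 32768*μ*((⌊x2⌋₊:ℝ)*(⌊x3⌋₊:ℝ)) := by
      refine le_trans ?_ (mul_le_mul_of_nonneg_left Q2 (by positivity))
      norm_num at *
      nlinarith
    exact_mod_cast Q3
  · have c2 : ((⌊x2⌋₊/2^12:ℕ):ℝ) ≤ x2/4096 := by
      refine (Nat.cast_div_le).trans ?_
      norm_num; linarith
    have c3 : ((⌊x3⌋₊/2^12:ℕ):ℝ) ≤ x3/4096 := by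
      refine (Nat.cast_div_le).trans ?_
      norm_num; linarith
    have : (((⌊x2⌋₊/2^12:ℕ):ℝ)+1)*(((⌊x3⌋₊/2^12:ℕ):ℝ)+1) ≤ 8000*μ := by
      calc _ ≤ (x2/4096+1)*(x3/4096+1) := by gcongr
        _ = x2*x3/4096^2 + (x2+x3)/4096+1 := by ring
        _ ≤ _ := by norm_num at *; linarith
    exact_mod_cast this
  · norm_num at *; linarith

theorem log_V_ge {V : ℝ} (h : 6.38 ≤ V) : 1.8 ≤ Real.log V := by
  rw [Real.le_log_iff_exp_le (lt_of_lt_of_le (by norm_num) h)]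
  refine le_trans ?_ h
  have h1 := Real.exp_one_lt_d9
  have h2 : 1 + 0.2 + 0.2^2/2 ≤ Real.exp 0.2 := Real.quadratic_le_exp_of_nonneg (by norm_num)
  have h3 : Real.exp 1.8 * Real.exp 0.2 = Real.exp 1 * Real.exp 1 := by
    rw [← Real.exp_add, ← Real.exp_add]; norm_num
  have h4 : Real.exp 1 * Real.exp 1 ≤ 2.7182818286*2.7182818286 := by gcongr
  have h5 := Real.exp_pos 1.8
  norm_num at *
  nlinarith

theorem lfl {α : ℝ} (hα : α^3 = α^2+1) (G p q : ℕ) (hG : ¬ IsSquare G) (hp : 0 < p) (hq : 0 < q)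
    (a1 a2 a3 : ℝ) (ha1 : Real.exp a1 = α) (ha2 : Real.exp a2 = G) (ha3 : Real.exp a3 = (p/q:ℝ)*(3*α-2))
    (V : ℝ) (hVq : (q:ℝ) ≤ V) (hVp : (p:ℝ)*(3*α+2) ≤ V)
    (k s : ℕ) (B : ℝ) (hβ : 108 ≤ Real.log B) (hB0 : 0 < B)
    (hB : 2e9*(a2+1)*(k+s+Real.log V) ≤ B) (hs : 1e9*Real.log V ≤ s) :
    Real.exp (-(2e13*a2*Real.log V*Real.log B)) ≤ |a3 - k*a1 + s*a2| := by
  by_contra hcon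
  rw [not_le] at hcon
  have hp1 : (1:ℝ) ≤ p := by exact_mod_cast hp
  have hV : 6.38 ≤ V := by
    have := al_gt hα
    norm_num at this ⊢
    nlinarith
  have hH := log_V_ge hV
  obtain ⟨H, hHd⟩ : ∃ H, H = Real.log V := ⟨_, rfl⟩
  obtain ⟨β, hβd⟩ : ∃ H, H = Real.log B := ⟨_, rfl⟩
  have hG2 : 2 ≤ G := by
    rcases G with _ | _ | G
    · exact absurd ⟨0, by simp⟩ hG
    · exact absurd ⟨1, by simp⟩ hG
    · omega
  have h2 : 0.693 ≤ a2 := by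
    have : a2 = Real.log G := by rw [← ha2, Real.log_exp]
    rw [this]
    have h3 : Real.log 2 ≤ Real.log G := Real.log_le_log (by norm_num) (by exact_mod_cast hG2)
    have := Real.log_two_gt_d9
    norm_num at *; linarith
  obtain ⟨μ, L2, L3, g1, g2, g3, g4, g5, g6, g7, g8, g9, g10, g11, g12, g13⟩ := lfl_params h2 hH
  rw [← hHd] at hB hs g2 g4 g11 g13 hcon hH
  rw [← hβd] at hcon hβ
  have hh1 : ((⌊β/6⌋₊:ℕ):ℝ) ≤ β/6 := Nat.floor_le (by linarith)
  have hh2 := (Nat.lt_floor_add_one (β/6)).le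
  have hh3 : 18 ≤ ⌊β/6⌋₊ := Nat.le_floor (by push_cast; linarith)
  obtain ⟨h, hhd⟩ : ∃ h, h = ⌊β/6⌋₊ := ⟨_, rfl⟩
  rw [← hhd] at hh1 hh2 hh3
  have hk0 : (0:ℝ) ≤ k := by positivity
  have hs0 : (0:ℝ) ≤ s := by positivity
  have ha0 : 0 < a2 := by norm_num at h2; linarith
  have hH0 : 0 < H := by norm_num at hH; linarith
  have hlcm := Chebyshev.psi_le_const_mul_self (x := (h:ℝ)) (by positivity)
  rw [Chebyshev.psi_eq_log_lcmUpto] at hlcm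
  have hΔ1 : 1 ≤ Nat.lcmUpto h := Nat.lcmUpto_pos h
  have hB' : 2e9*(a2*k) + 2e9*(a2*s) + 2e9*(a2*H) + 2e9*H + 2e9*k+2e9*s ≤ B := by
    refine le_trans (le_of_eq ?_) hB; ring
  have hak : 0 ≤ a2*k := by positivity
  have has : 0 ≤ a2*s := by positivity
  have haH : 0 ≤ a2*H := by positivity
  have hkL : (k:ℝ)*L3 ≤ 2.8e8*(a2*k) := by
    calc (k:ℝ)*L3 ≤ k*(2.8e8*a2) := by gcongr
      _ = _ := by ring
  have hsL : (s:ℝ)*L3 ≤ 2.8e8*(a2*s) := by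
    calc (s:ℝ)*L3 ≤ s*(2.8e8*a2) := by gcongr
      _ = _ := by ring
  refine lfl_core hα G p q hG hp hq a1 a2 a3 ha1 ha2 ha3 V hVq hVp k s h μ (Nat.lcmUpto h) L2 L3 hh3 g1
    (fun i hi1 hi2 => Finset.dvd_lcm (f := id) (Finset.mem_Icc.2 ⟨hi1, hi2⟩)) hΔ1 B ?_ ?_ ?_ ?_ g3 (by rw [← hHd]; exact g4) g5 g6 g7 g8 g9 g10 ?_ ?_
  · rw [← Real.log_le_log_iff (by exact_mod_cast hΔ1) hB0, ← hβd]
    refine hlcm.trans ?_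
    have h4 : Real.log 4 = 2*Real.log 2 := by rw [show (4:ℝ) = 2^2 by norm_num, Real.log_pow]; norm_num
    have := Real.log_two_lt_d9
    have h5 : Real.log 4 + 4 ≤ 6 := by rw [h4]; norm_num at *; linarith
    calc _ ≤ 6*(h:ℝ) := by gcongr
      _ ≤ β := by linarith
  · rw [← hβd]; linarith
  · rintro ⟨l1, l2, l3⟩ hl
    simp only [box, Finset.mem_product, Finset.mem_range] at hl
    obtain ⟨hl1, hl2, hl3⟩ := hl
    simp only [uu]
    push_cast
    rw [abs_of_nonneg (by positivity)]
    have q1 : (l1:ℝ) ≤ 256*μ := by exact_mod_cast hl1.le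
    have q3 : (l3:ℝ) ≤ L3 := by exact_mod_cast hl3.le
    have q4 : (k:ℝ)*l3 ≤ k*L3 := by gcongr
    norm_num at *
    linarith
  · rintro ⟨l1, l2, l3⟩ hl
    simp only [box, Finset.mem_product, Finset.mem_range] at hl
    obtain ⟨hl1, hl2, hl3⟩ := hl
    simp only [vv]
    push_cast
    have q1 : (l2:ℝ) ≤ L2 := by exact_mod_cast hl2.le
    have q3 : (l3:ℝ) ≤ L3 := by exact_mod_cast hl3.le
    have q4 : (s:ℝ)*l3 ≤ s*L3 := by gcongr
    have q5 : (0:ℝ) ≤ s*l3 := by positivity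
    have q6 : (0:ℝ) ≤ l2 := by positivity
    rw [abs_le]
    norm_num at g11 hkL hsL hB' hB ⊢
    constructor <;> linarith
  · have : (L2:ℝ) ≤ s := by norm_num at g11 hs; linarith
    exact_mod_cast this
  · refine hcon.le.trans (Real.exp_le_exp.2 (neg_le_neg ?_))
    have hw : 1.247 ≤ a2*H := by norm_num at *; nlinarith
    have e1 : (μ:ℝ)*h ≤ (4.2e6*(a2*H)+1)*(β/6) := by gcongr
    calc _ = 1.63*32768*512*((μ:ℝ)*h) := by ring
      _ ≤ 1.63*32768*512*((4.2e6*(a2*H)+1)*(β/6)) := by gcongr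
      _ = (1.63*32768*512/6*(4.2e6*(a2*H)+1))*β := by ring
      _ ≤ (2e13*(a2*H))*β := by
          refine mul_le_mul_of_nonneg_right ?_ (by linarith)
          norm_num at hw ⊢; linarith
      _ = _ := by ring

end

section
theorem exists_alpha : ∃ α : ℝ, α^3 = α^2+1 := by
  have hc : ContinuousOn (fun x : ℝ => x^3 - x^2) (Set.Icc 1 2) := by fun_prop
  obtain ⟨x, _, hx⟩ := intermediate_value_Icc (by norm_num : (1:ℝ) ≤ 2) hc
    (show (1:ℝ) ∈ Set.Icc _ _ from ⟨by norm_num, by norm_num⟩)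
  exact ⟨x, by simp only at hx; linarith⟩

theorem nar_rec (n : ℕ) : narayana (n+3) = narayana (n+2) + narayana n := rfl

theorem nar_approx {α : ℝ} (hα : α^3 = α^2+1) (k : ℕ) : |(3*α-2)*narayana k - α^k| ≤ 2 := by
  have h1 := al_gt hα
  have h2 := al_lt hα
  obtain ⟨e, he⟩ : ∃ e : ℕ → ℝ, ∀ k, e k = (3*α-2)*narayana k - α^k := ⟨_, fun _ => rfl⟩
  have h3 : ∀ n, e (n+3) = e (n+2) + e n := by
    intro n
    rw [he, he, he, nar_rec]; push_cast
    linear_combination (-α^n)*hα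
  have e0 : e 0 = -1 := by rw [he]; simp [narayana]
  have e1 : e 1 = 2*α-2 := by rw [he]; simp [narayana]; ring
  have e2 : e 2 = 3*α-2-α^2 := by rw [he]; simp [narayana]
  have hr : ∀ n, e (n+2) = -(α-1)*e (n+1) - α*(α-1)*e n := by
    intro n
    induction n with
    | zero => rw [e0, zero_add, e1, e2]; ring
    | succ n ih =>
      have := h3 n
      rw [show n+1+2 = n+3 by ring, this, show n+1+1=n+2 by ring, ih]
      linear_combination (-e n)*hα
  have hQ : ∀ n, (e (n+1))^2 + (α-1)*(e n*e (n+1)) + α*(α-1)*(e n)^2 ≤ 1.3 ∧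
      0 ≤ (e (n+1))^2 + (α-1)*(e n*e (n+1)) + α*(α-1)*(e n)^2 := by
    have hpos : ∀ x y : ℝ, 0 ≤ y^2 + (α-1)*(x*y) + α*(α-1)*x^2 := by
      intro x y
      have hc : 0 ≤ α*(α-1) - (α-1)^2/4 := by norm_num at *; nlinarith
      nlinarith [sq_nonneg (y + (α-1)/2*x), mul_nonneg hc (sq_nonneg x)]
    intro n
    refine ⟨?_, hpos _ _⟩
    induction n with
    | zero =>
      rw [e0, zero_add, e1]; norm_num at *; nlinarith
    | succ n ih =>
      rw [show n+1+1=n+2 by ring, hr n]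
      have hx := hpos (e n) (e (n+1))
      have : (-(α-1)*e (n+1) - α*(α-1)*e n)^2 + (α-1)*(e (n+1)*(-(α-1)*e (n+1) - α*(α-1)*e n)) + α*(α-1)*(e (n+1))^2
        = α*(α-1)*((e (n+1))^2 + (α-1)*(e n*e (n+1)) + α*(α-1)*(e n)^2) := by ring
      rw [this]
      refine le_trans ?_ ih
      refine mul_le_of_le_one_left hx ?_
      norm_num at *; nlinarith
  have hk := (hQ k).1
  rw [← he]
  have hc : 0.6 ≤ α*(α-1) - (α-1)^2/4 := by norm_num at *; nlinarith
  have hsq : e k^2 ≤ 2^2 := by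
    have q1 := mul_le_mul_of_nonneg_right hc (sq_nonneg (e k))
    have q2 := sq_nonneg (e (k+1) + (α-1)/2*e k)
    norm_num at *
    nlinarith
  exact abs_le_of_sq_le_sq hsq (by norm_num)

theorem nonsq_root (g : ℕ) (hg : 2 ≤ g) : ∃ G e : ℕ, g = G^(2^e) ∧ ¬ IsSquare G ∧ 2 ≤ G := by
  induction g using Nat.strong_induction_on with
  | _ g ih =>
    by_cases h : IsSquare g
    · obtain ⟨r, hr⟩ := h
      have hr2 : 2 ≤ r := by
        by_contra hc
        have : r = 0 ∨ r = 1 := by omega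
        rcases this with rfl | rfl <;> omega
      obtain ⟨G, e, h1, h2, h3⟩ := ih r (by nlinarith) hr2
      exact ⟨G, e+1, by rw [hr, h1, pow_succ, pow_mul]; ring, h2, h3⟩
    · exact ⟨g, 0, by simp, h, hg⟩

theorem log_one_sub {x : ℝ} (h0 : 0 ≤ x) (h1 : x ≤ 1/2) : |Real.log (1-x)| ≤ 2*x := by
  have hp : 0 < 1-x := by linarith
  have := Real.one_sub_inv_le_log_of_pos hp
  have h2 := Real.log_le_sub_one_of_pos hp
  have h3 : (1-x)⁻¹ ≤ 1+2*x := by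
    rw [inv_le_iff_one_le_mul₀ hp]; nlinarith
  rw [abs_le]; constructor <;> linarith

theorem log_near_one {y ε : ℝ} (h0 : |y-1| ≤ ε) (h1 : ε ≤ 1/2) : |Real.log y| ≤ 2*ε := by
  have he : 0 ≤ ε := (abs_nonneg _).trans h0
  obtain ⟨ha, hb⟩ := abs_le.1 h0
  have hp : 0 < y := by linarith
  have := Real.one_sub_inv_le_log_of_pos hp
  have h2 := Real.log_le_sub_one_of_pos hp
  have h3 : y⁻¹ ≤ 1+2*ε := by
    rw [inv_le_iff_one_le_mul₀ hp]; nlinarith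
  rw [abs_le]; constructor <;> linarith

theorem lfl_step {α : ℝ} (hα : α^3 = α^2+1) (G e g p q : ℕ) (hG : ¬ IsSquare G) (hG2 : 2 ≤ G) (hg : g = G^(2^e))
    (hp : 0 < p) (hq : 0 < q) (V : ℝ) (hVq : (q:ℝ) ≤ V) (hVp : (p:ℝ)*(3*α+2) ≤ V)
    (k s j : ℕ) (t : ℝ) (ht : 36 ≤ Real.log t) (ht0 : 0 < t)
    (hB : 2e9*(Real.log g+1)*(k+2*Real.log g*s+Real.log V) ≤ t^3) (hs : 1e9*Real.log V ≤ s)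
    (hΛ : |Real.log ((p/q:ℝ)*(3*α-2)) - k*Real.log α + s*Real.log g| ≤ 12*Real.exp (-(j*Real.log g))) :
    j*Real.log g ≤ 6.1e13*Real.log g*Real.log t*Real.log V := by
  have h1 := al_gt hα
  norm_num at h1
  have hGr : (2:ℝ) ≤ G := by exact_mod_cast hG2
  have hlog : Real.log g = 2^e * Real.log G := by rw [hg]; push_cast; rw [Real.log_pow]; push_cast; ring
  have hp1 : (1:ℝ) ≤ p := by exact_mod_cast hp
  have hV : 6.38 ≤ V := by
    norm_num
    nlinarith
  have hH := log_V_ge hV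
  have hl2 := Real.log_two_gt_d9
  have hG3 : Real.log 2 ≤ Real.log G := Real.log_le_log (by norm_num) hGr
  have hG4 : 0.69 ≤ Real.log G := by norm_num at *; linarith
  have he1 : (1:ℝ) ≤ 2^e := one_le_pow₀ (by norm_num)
  have hGg : Real.log G ≤ Real.log g := by
    rw [hlog]; norm_num at hG4; nlinarith
  have hBpos : 0 < t^3 := by positivity
  have hlB : Real.log (t^3) = 3*Real.log t := by rw [Real.log_pow]; norm_num
  have he2 : (2:ℝ)^e ≤ 2*Real.log g := by
    rw [hlog]; norm_num at hG4; nlinarith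
  have key := lfl hα G p q hG hp hq (Real.log α) (Real.log G) (Real.log ((p/q:ℝ)*(3*α-2))) (Real.exp_log (by linarith))
    (Real.exp_log (by linarith)) (Real.exp_log (by
      have : (0:ℝ) < q := by exact_mod_cast hq
      have : (0:ℝ) < 3*α-2 := by linarith
      positivity)) V hVq hVp k (2^e*s) (t^3) (by rw [hlB]; linarith) hBpos (by
      refine le_trans ?_ hB
      push_cast
      have hH0 : 0 ≤ Real.log V := le_trans (by norm_num) hH
      have hG0 : 0 ≤ Real.log G := le_trans (by norm_num) hG4
      gcongr) (by
      push_cast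
      refine hs.trans ?_
      exact le_mul_of_one_le_left (by positivity) he1)
  have e1 : Real.log ((p/q:ℝ)*(3*α-2)) - k*Real.log α + ((2^e*s:ℕ):ℝ)*Real.log G =
    Real.log ((p/q:ℝ)*(3*α-2)) - k*Real.log α + s*Real.log g := by rw [hlog]; push_cast; ring
  rw [e1] at key
  have h3 := key.trans hΛ
  rw [hlB] at h3
  have h12 : (12:ℝ) ≤ Real.exp 11 := by linarith [Real.add_one_le_exp (11:ℝ)]
  have h4 : 12*Real.exp (-(j*Real.log g)) ≤ Real.exp (11 + -(j*Real.log g)) := by rw [Real.exp_add]; gcongr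
  have h5 := Real.exp_le_exp.1 (h3.trans h4)
  obtain ⟨H, hHd⟩ : ∃ H, H = Real.log V := ⟨_, rfl⟩
  obtain ⟨T, hTd⟩ : ∃ H, H = Real.log t := ⟨_, rfl⟩
  obtain ⟨a, had⟩ : ∃ H, H = Real.log G := ⟨_, rfl⟩
  obtain ⟨b, hbd⟩ : ∃ H, H = Real.log g := ⟨_, rfl⟩
  rw [← hHd, ← hTd, ← had, ← hbd] at h5
  rw [← hHd, ← hTd, ← hbd]
  rw [← hHd] at hH
  rw [← hTd] at ht
  rw [← had] at hG4
  rw [← had, ← hbd] at hGg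
  have hTH : 36*1.8 ≤ T*H := mul_le_mul ht hH (by norm_num) (by linarith)
  have e2 : a*(T*H) ≤ b*(T*H) := by
    apply mul_le_mul_of_nonneg_right hGg; norm_num at hTH; linarith
  have e3 : 0.69*(36*1.8) ≤ b*(T*H) := mul_le_mul (hG4.trans hGg) hTH (by norm_num) (by norm_num at *; linarith)
  norm_num at *
  linarith

end

section
theorem psi_bound {g j : ℕ} (hg : 2 ≤ g) (hj : 1 ≤ j) :
    |Real.log ((g:ℝ)^j-1) - j*Real.log g| ≤ 2*Real.exp (-(j*Real.log g)) := by
  have hg2 : (2:ℝ) ≤ g := by exact_mod_cast hg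
  have hg0 : (0:ℝ) < g := by linarith
  have he : Real.exp (-(j*Real.log g)) = ((g:ℝ)^j)⁻¹ := by
    rw [Real.exp_neg, Real.exp_nat_mul, Real.exp_log hg0]
  have hgj : (2:ℝ) ≤ (g:ℝ)^j := by
    calc (2:ℝ) ≤ g := hg2
      _ = (g:ℝ)^1 := by ring
      _ ≤ (g:ℝ)^j := pow_le_pow_right₀ (by linarith) hj
  have h1 : Real.log ((g:ℝ)^j-1) - j*Real.log g = Real.log (1 - ((g:ℝ)^j)⁻¹) := by
    rw [← Real.log_pow, ← Real.log_div (by linarith) (by positivity)]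
    congr 1; field_simp
  rw [h1, he]
  apply log_one_sub (by positivity)
  rw [inv_le_comm₀ (by positivity) (by norm_num)]; norm_num; linarith

theorem delta_bound {α : ℝ} (hα : α^3 = α^2+1) {g k t : ℕ} (hg : 2 ≤ g) (ht : 3 ≤ t) (hN : g^t ≤ narayana k) :
    |Real.log ((3*α-2)*narayana k) - k*Real.log α| ≤ 4*Real.exp (-(t*Real.log g)) := by
  have h1 := al_gt hα
  norm_num at h1
  have hg2 : (2:ℝ) ≤ g := by exact_mod_cast hg
  have hg0 : (0:ℝ) < g := by linarith
  have he : Real.exp (-(t*Real.log g)) = ((g:ℝ)^t)⁻¹ := by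
    rw [Real.exp_neg, Real.exp_nat_mul, Real.exp_log hg0]
  have hgt : (8:ℝ) ≤ (g:ℝ)^t := by
    calc (8:ℝ) = 2^3 := by norm_num
      _ ≤ (g:ℝ)^3 := by gcongr
      _ ≤ (g:ℝ)^t := pow_le_pow_right₀ (by linarith) ht
  have hNr : (g:ℝ)^t ≤ narayana k := by exact_mod_cast hN
  have ha := nar_approx hα k
  obtain ⟨ha1, ha2⟩ := abs_le.1 ha
  have hak : (g:ℝ)^t ≤ α^k := by nlinarith
  have hak0 : 0 < α^k := by linarith
  have h2 : Real.log ((3*α-2)*narayana k) - k*Real.log α = Real.log ((3*α-2)*narayana k/α^k) := by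
    rw [← Real.log_pow, ← Real.log_div _ (by positivity)]
    have : 0 < (3*α-2)*(narayana k:ℝ) := by
      apply mul_pos <;> linarith
    exact this.ne'
  rw [h2, he]
  have h3 : |(3*α-2)*narayana k/α^k - 1| ≤ 2*((g:ℝ)^t)⁻¹ := by
    have : (3*α-2)*narayana k/α^k - 1 = ((3*α-2)*narayana k - α^k)/α^k := by field_simp
    rw [this, abs_div, abs_of_pos hak0, div_eq_mul_inv]
    gcongr
  refine (log_near_one h3 ?_).trans (by linarith)
  have : ((g:ℝ)^t)⁻¹ ≤ 8⁻¹ := by gcongr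
  norm_num at this ⊢; linarith

theorem nar_large {g k d₁ d₂ d₃ d₄ ℓ m n t : ℕ} (hg : 2 ≤ g)
    (hd₁ : 1 ≤ d₁) (hd₂ : 1 ≤ d₂) (hd₃ : 1 ≤ d₃) (hd₄ : 1 ≤ d₄)
    (hℓ : 1 ≤ ℓ) (hm : 1 ≤ m) (hn : 2 ≤ n) (ht : 1 ≤ t)
    (heq : narayana k * (g - 1) ^ 4 =
      d₁ * d₂ * d₃ * d₄ * (g ^ ℓ - 1) * (g ^ m - 1) * (g ^ n - 1) * (g ^ t - 1)) : g^t ≤ narayana k := by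
  have hA : ∀ j, (g-1)*g^j ≤ g^(j+1) - 1 := by
    intro j
    have h1 : 1 ≤ g^j := Nat.one_le_pow _ _ (by omega)
    rw [Nat.sub_mul, pow_succ, one_mul, mul_comm g]
    omega
  have hA1 : ∀ j, 1 ≤ j → g-1 ≤ g^j - 1 := by
    intro j hj
    have := Nat.pow_le_pow_right (show 0 < g by omega) hj
    rw [pow_one] at this
    omega
  have hA2 : (g-1)*g ≤ g^n - 1 := by
    have h1 := hA 1
    have h2 := Nat.pow_le_pow_right (show 0 < g by omega) hn
    rw [pow_one] at h1
    exact h1.trans (Nat.sub_le_sub_right h2 1)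
  have hA3 : (g-1)*g^(t-1) ≤ g^t - 1 := by
    have := hA (t-1)
    rwa [Nat.sub_add_cancel ht] at this
  have hD : 1 ≤ d₁*d₂*d₃*d₄ := Nat.mul_pos (Nat.mul_pos (Nat.mul_pos hd₁ hd₂) hd₃) hd₄
  have h4 : 0 < (g-1)^4 := pow_pos (by omega) 4
  refine Nat.le_of_mul_le_mul_right ?_ h4
  rw [heq]
  calc g^t*(g-1)^4 = 1*(g-1)*(g-1)*((g-1)*g)*((g-1)*g^(t-1)) := by
        obtain ⟨u, rfl⟩ : ∃ u, t = u+1 := ⟨t-1, by omega⟩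
        simp only [Nat.add_sub_cancel]; ring
    _ ≤ _ := by
        gcongr
        · exact Nat.le_self_pow (by omega) g
        · exact Nat.le_self_pow (by omega) g

theorem fin_num1 {b L n t : ℝ} (hb : 0.69 ≤ b) (hL : 36 ≤ L) (hnt : n ≤ t) (hn : 9.72e42*L^3*b^6 ≤ n) :
    b ≤ 0.000000000000000000000000000001*t ∧ 1e30 ≤ t ∧ 1e9*((6.2e13*(b*L))^2*(25*b^4)) ≤ n := by
  have hb0 : 0 < b := by norm_num at hb; linarith
  have h6 : 0.69^6 ≤ b^6 := by gcongr
  have h36 : 36^3 ≤ L^3 := by gcongr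
  have e1 : 9.72e42*36^3*b^6 ≤ t := (mul_le_mul_of_nonneg_right (by gcongr) (by positivity)).trans (hn.trans hnt)
  have t1 : 1e35 ≤ t := by norm_num at *; linarith
  refine ⟨?_, le_trans (by norm_num) t1, ?_⟩
  · have : b ≤ 1 + b^6 := by
      rcases le_total b 1 with h | h
      · linarith [show 0 ≤ b^6 by positivity]
      · have := pow_le_pow_right₀ h (show 1 ≤ 6 by norm_num)
        rw [pow_one] at this; linarith
    norm_num at *; linarith
  · refine le_trans ?_ hn
    have h2 : 36*L^2 ≤ L^3 := by
      rw [pow_succ L 2, mul_comm]; gcongr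
    have h3 : 36*(L^2*b^6) ≤ L^3*b^6 := by
      rw [← mul_assoc]; gcongr
    have h0 : 0 ≤ L^2*b^6 := by positivity
    calc _ = 1e9*(6.2e13^2*25)*(L^2*b^6) := by ring
      _ ≤ 9.72e42*(L^3*b^6) := by norm_num at *; linarith
      _ = _ := by ring

theorem fin_num2 {b t k s H : ℝ} (hb : 0.69 ≤ b) (hbt : b ≤ 0.000000000000000000000000000001*t) (ht : 1e30 ≤ t) (hk : k*0.37 ≤ 4*t*b+14)
    (hs : s ≤ 4*t) (hH : H ≤ 2 + 4*b + 2*t*b) :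
    2e9*(b+1)*(k+2*b*s+H) ≤ t^3 := by
  have hb0 : 0 < b := by norm_num at hb; linarith
  have ht0 : 0 < t := lt_of_lt_of_le (by norm_num) ht
  have htb : 6e29 ≤ t*b := by
    refine le_trans ?_ (mul_le_mul ht hb (by norm_num) ht0.le)
    norm_num
  have h1 : b*s ≤ 4*(t*b) := by
    calc b*s ≤ b*(4*t) := by gcongr
      _ = _ := by ring
  have h2 : 4*b ≤ t*b := by
    gcongr; norm_num at ht; linarith
  have h3 : k+2*b*s+H ≤ 30*(t*b) := by
    norm_num at *; linarith
  have h4 : b+1 ≤ 3*b := by norm_num at hb; linarith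
  calc 2e9*(b+1)*(k+2*b*s+H) ≤ 2e9*(b+1)*(30*(t*b)) := by gcongr
    _ ≤ 2e9*(3*b)*(30*(t*b)) := by gcongr
    _ = 18e10*t*(b*b) := by ring
    _ ≤ 18e10*t*((0.000000000000000000000000000001*t)*(0.000000000000000000000000000001*t)) := by gcongr
    _ = 0.00000000000000000000000000000000000000000000000018*t^3 := by ring
    _ ≤ t^3 := by
      have : 0 ≤ t^3 := by positivity
      norm_num; linarith

end


set_option maxHeartbeats 4000000 in
theorem n_bound (g k d₁ d₂ d₃ d₄ ℓ m n t : ℕ) (hg : 2 ≤ g) (hk : 1 ≤ k)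
    (hd₁ : 1 ≤ d₁) (hd₁g : d₁ ≤ g - 1) (hd₂ : 1 ≤ d₂) (hd₂g : d₂ ≤ g - 1)
    (hd₃ : 1 ≤ d₃) (hd₃g : d₃ ≤ g - 1) (hd₄ : 1 ≤ d₄) (hd₄g : d₄ ≤ g - 1)
    (hℓ : 1 ≤ ℓ) (hℓm : ℓ ≤ m) (hmn : m ≤ n) (hnt : n ≤ t) (ht : 2 ≤ t)
    (heq : narayana k * (g - 1) ^ 4 =
      d₁ * d₂ * d₃ * d₄ * (g ^ ℓ - 1) * (g ^ m - 1) * (g ^ n - 1) * (g ^ t - 1)) :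
    (n : ℝ) < 9.72e42 * Real.log t ^ 3 * Real.log g ^ 6 := by
  by_contra hcon
  rw [not_lt] at hcon
  obtain ⟨α, hα⟩ := exists_alpha
  have h1 := al_gt hα
  have h2 := al_lt hα
  norm_num at h1 h2
  obtain ⟨G, e, hgG, hG, hG2⟩ := nonsq_root g hg
  have hg2 : (2:ℝ) ≤ g := by exact_mod_cast hg
  have hg0 : (0:ℝ) < g := by linarith
  have ht2 : (2:ℝ) ≤ t := by exact_mod_cast ht
  have hntr : (n:ℝ) ≤ t := by exact_mod_cast hnt
  have hmnr : (m:ℝ) ≤ n := by exact_mod_cast hmn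
  have hℓmr : (ℓ:ℝ) ≤ m := by exact_mod_cast hℓm
  have hl2 := Real.log_two_gt_d9
  obtain ⟨b, hb⟩ : ∃ b, b = Real.log g := ⟨_, rfl⟩
  obtain ⟨L, hL⟩ : ∃ b, b = Real.log t := ⟨_, rfl⟩
  have hb1 : 0.69 ≤ b := by
    have := Real.log_le_log (by norm_num) hg2
    rw [← hb] at this; norm_num at this hl2 ⊢; linarith
  have hL1 : 0.69 ≤ L := by
    have := Real.log_le_log (by norm_num) ht2
    rw [← hL] at this; norm_num at this hl2 ⊢; linarith
  rw [← hb, ← hL] at hcon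
  have hb0 : 0 < b := by norm_num at hb1; linarith
  have hnbig : (1e30:ℝ) ≤ n := by
    refine le_trans ?_ hcon
    calc (1e30:ℝ) ≤ 9.72e42*0.69^3*0.69^6 := by norm_num
      _ ≤ _ := by gcongr
  have hL36 : 36 ≤ L := by
    rw [hL, Real.le_log_iff_exp_le (by linarith)]
    have : Real.exp 36 ≤ 3^36 := by
      rw [show (36:ℝ) = ((36:ℕ):ℝ)*1 by norm_num, Real.exp_nat_mul]
      gcongr
      linarith [Real.exp_one_lt_d9]
    refine this.trans (le_trans ?_ (hnbig.trans hntr))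
    norm_num
  obtain ⟨hbt, htbig, hXn⟩ := fin_num1 hb1 hL36 hntr hcon
  have hn3 : 3 ≤ n := by
    have : (3:ℝ) ≤ n := le_trans (by norm_num) hnbig
    exact_mod_cast this
  have hNar := nar_large hg hd₁ hd₂ hd₃ hd₄ hℓ (hℓ.trans hℓm) (by omega) (by omega) heq
  have hδ := delta_bound hα hg (by omega : 3 ≤ t) hNar
  have hψℓ := psi_bound hg hℓ
  have hψm := psi_bound hg (hℓ.trans hℓm)
  have hψn := psi_bound hg (show 1 ≤ n by omega)
  have hψt := psi_bound hg (show 1 ≤ t by omega)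
  rw [← hb] at hδ hψℓ hψm hψn hψt
  have xmℓ : Real.exp (-(m*b)) ≤ Real.exp (-(ℓ*b)) := by
    apply Real.exp_le_exp.2; apply neg_le_neg; gcongr
  have xnm : Real.exp (-(n*b)) ≤ Real.exp (-(m*b)) := by
    apply Real.exp_le_exp.2; apply neg_le_neg; gcongr
  have xtn : Real.exp (-(t*b)) ≤ Real.exp (-(n*b)) := by
    apply Real.exp_le_exp.2; apply neg_le_neg; gcongr
  -- natural data
  obtain ⟨D, hD⟩ : ∃ D, D = d₁*d₂*d₃*d₄ := ⟨_, rfl⟩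
  obtain ⟨q, hq⟩ : ∃ q, q = (g-1)^4 := ⟨_, rfl⟩
  have hD1 : 0 < D := by rw [hD]; exact Nat.mul_pos (Nat.mul_pos (Nat.mul_pos hd₁ hd₂) hd₃) hd₄
  have hq1 : 0 < q := by rw [hq]; exact pow_pos (by omega) 4
  have hDq : D ≤ q := by
    rw [hD, hq]
    calc d₁*d₂*d₃*d₄ ≤ (g-1)*(g-1)*(g-1)*(g-1) := by gcongr
      _ = _ := by ring
  have hqg : q ≤ g^4 := by rw [hq]; gcongr; omega
  have hApos : ∀ j, 1 ≤ j → 0 < g^j - 1 := by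
    intro j hj
    have := Nat.le_self_pow (show j ≠ 0 by omega) g
    omega
  have hAc : ∀ j, ((g^j-1:ℕ):ℝ) = (g:ℝ)^j - 1 := by
    intro j
    rw [Nat.cast_sub (Nat.one_le_pow _ _ (by omega))]; push_cast; rfl
  have hAℓ := hApos ℓ hℓ
  have hAm := hApos m (hℓ.trans hℓm)
  have hAn := hApos n (by omega)
  have hAt := hApos t (by omega)
  obtain ⟨Aℓ, hAℓd⟩ : ∃ A, A = g^ℓ-1 := ⟨_, rfl⟩
  obtain ⟨Am, hAmd⟩ : ∃ A, A = g^m-1 := ⟨_, rfl⟩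
  obtain ⟨An, hAnd⟩ : ∃ A, A = g^n-1 := ⟨_, rfl⟩
  obtain ⟨At, hAtd⟩ : ∃ A, A = g^t-1 := ⟨_, rfl⟩
  rw [← hAc, ← hAℓd] at hψℓ
  rw [← hAc, ← hAmd] at hψm
  rw [← hAc, ← hAnd] at hψn
  rw [← hAc, ← hAtd] at hψt
  rw [← hD, ← hq, ← hAℓd, ← hAmd, ← hAnd, ← hAtd] at heq
  rw [← hAℓd] at hAℓ
  rw [← hAmd] at hAm
  rw [← hAnd] at hAn
  rw [← hAtd] at hAt
  have hAℓg : Aℓ ≤ g^ℓ := by omega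
  have hAmg : Am ≤ g^m := by omega
  have hN0 : 0 < narayana k := lt_of_lt_of_le (pow_pos (by omega) t) hNar
  have rD : (D:ℝ) ≠ 0 := by exact_mod_cast hD1.ne'
  have rq : (q:ℝ) ≠ 0 := by exact_mod_cast hq1.ne'
  have rℓ : (Aℓ:ℝ) ≠ 0 := by exact_mod_cast hAℓ.ne'
  have rm : (Am:ℝ) ≠ 0 := by exact_mod_cast hAm.ne'
  have rn : (An:ℝ) ≠ 0 := by exact_mod_cast hAn.ne'
  have rt : (At:ℝ) ≠ 0 := by exact_mod_cast hAt.ne'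
  have rN : (narayana k:ℝ) ≠ 0 := by exact_mod_cast hN0.ne'
  have rw0 : 3*α-2 ≠ 0 := by linarith
  have hlogeq : Real.log (narayana k) + Real.log q =
      Real.log D + Real.log Aℓ + Real.log Am + Real.log An + Real.log At := by
    rw [← Real.log_mul rN rq, ← Real.log_mul rD rℓ, ← Real.log_mul (by positivity) rm, ← Real.log_mul (by positivity) rn,
      ← Real.log_mul (by positivity) rt]
    congr 1
    exact_mod_cast heq
  rw [Real.log_mul rw0 rN] at hδ
  have a31 : Real.log ((D/q:ℝ)*(3*α-2)) = Real.log D - Real.log q + Real.log (3*α-2) := by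
    rw [Real.log_mul (by positivity) rw0, Real.log_div rD rq]
  have a32 : Real.log (((D*Aℓ:ℕ)/q:ℝ)*(3*α-2)) = Real.log D + Real.log Aℓ - Real.log q + Real.log (3*α-2) := by
    push_cast
    rw [Real.log_mul (by positivity) rw0, Real.log_div (by positivity) rq, Real.log_mul rD rℓ]
  have a33 : Real.log (((D*Aℓ*Am:ℕ)/q:ℝ)*(3*α-2)) =
      Real.log D + Real.log Aℓ + Real.log Am - Real.log q + Real.log (3*α-2) := by
    push_cast
    rw [Real.log_mul (by positivity) rw0, Real.log_div (by positivity) rq, Real.log_mul (by positivity) rm, Real.log_mul rD rℓ]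
  rw [abs_le] at hδ hψℓ hψm hψn hψt
  have Λ1 : |Real.log ((D/q:ℝ)*(3*α-2)) - k*Real.log α + ((ℓ+m+n+t:ℕ):ℝ)*b| ≤ 12*Real.exp (-(ℓ*b)) := by
    rw [a31, abs_le]; push_cast
    constructor <;> linarith only [hlogeq, xmℓ, xnm, xtn, hδ.1, hδ.2, hψℓ.1, hψℓ.2, hψm.1, hψm.2, hψn.1, hψn.2, hψt.1, hψt.2]
  have Λ2 : |Real.log (((D*Aℓ:ℕ)/q:ℝ)*(3*α-2)) - k*Real.log α + ((m+n+t:ℕ):ℝ)*b| ≤ 12*Real.exp (-(m*b)) := by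
    rw [a32, abs_le]; push_cast
    constructor <;> linarith only [hlogeq, xnm, xtn, hδ.1, hδ.2, hψm.1, hψm.2, hψn.1, hψn.2, hψt.1, hψt.2, Real.exp_pos (-(m*b))]
  have Λ3 : |Real.log (((D*Aℓ*Am:ℕ)/q:ℝ)*(3*α-2)) - k*Real.log α + ((n+t:ℕ):ℝ)*b| ≤ 12*Real.exp (-(n*b)) := by
    rw [a33, abs_le]; push_cast
    constructor <;> linarith only [hlogeq, xnm, xtn, hδ.1, hδ.2, hψn.1, hψn.2, hψt.1, hψt.2, Real.exp_pos (-(n*b))]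
  -- heights
  have h7 : Real.log 7 ≤ 2 := by
    rw [Real.log_le_iff_le_exp (by norm_num)]
    have := Real.exp_one_gt_d9
    have h : Real.exp 2 = Real.exp 1 * Real.exp 1 := by rw [← Real.exp_add]; norm_num
    rw [h]; norm_num at this; nlinarith only [this]
  obtain ⟨H1, hH1⟩ : ∃ H, H = Real.log 7 + 4*b := ⟨_, rfl⟩
  have hV1 : Real.log (7*(g:ℝ)^4) = H1 := by
    rw [Real.log_mul (by norm_num) (by positivity), Real.log_pow, hH1, hb]; norm_num
  have hV2 : Real.log (7*(g:ℝ)^4*g^ℓ) = H1 + ℓ*b := by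
    rw [Real.log_mul (by positivity) (by positivity), hV1, Real.log_pow, hb]
  have hV3 : Real.log (7*(g:ℝ)^4*g^ℓ*g^m) = H1 + ℓ*b + m*b := by
    rw [Real.log_mul (by positivity) (by positivity), hV2, Real.log_pow, hb]
  have hH1b : H1 ≤ 25*b^4 := by
    have : 0.69^3 ≤ b^3 := by gcongr
    have h3 : 0.69^3*b ≤ b^4 := by
      rw [pow_succ b 3]; gcongr
    rw [hH1]; norm_num at h3 hb1 ⊢; linarith only [h3, hb1, h7]
  have hH10 : 0 ≤ H1 := by
    rw [hH1]; have := Real.log_nonneg (show (1:ℝ) ≤ 7 by norm_num); linarith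
  have hqr : (q:ℝ) ≤ (g:ℝ)^4 := by exact_mod_cast hqg
  have hDr : (D:ℝ) ≤ (g:ℝ)^4 := by exact_mod_cast hDq.trans hqg
  have hAℓr : (Aℓ:ℝ) ≤ (g:ℝ)^ℓ := by exact_mod_cast hAℓg
  have hAmr : (Am:ℝ) ≤ (g:ℝ)^m := by exact_mod_cast hAmg
  have hw7 : 3*α+2 ≤ 7 := by linarith
  have hgp4 : 0 < (g:ℝ)^4 := by positivity
  have pV1 : (D:ℝ)*(3*α+2) ≤ 7*(g:ℝ)^4 := by
    calc (D:ℝ)*(3*α+2) ≤ (g:ℝ)^4*7 := by gcongr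
      _ = _ := by ring
  have pV2 : ((D*Aℓ:ℕ):ℝ)*(3*α+2) ≤ 7*(g:ℝ)^4*g^ℓ := by
    push_cast
    calc (D:ℝ)*Aℓ*(3*α+2) = (D:ℝ)*(3*α+2)*Aℓ := by ring
      _ ≤ 7*(g:ℝ)^4*g^ℓ := by gcongr
  have pV3 : ((D*Aℓ*Am:ℕ):ℝ)*(3*α+2) ≤ 7*(g:ℝ)^4*g^ℓ*g^m := by
    push_cast
    calc (D:ℝ)*Aℓ*Am*(3*α+2) = (D:ℝ)*(3*α+2)*Aℓ*Am := by ring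
      _ ≤ 7*(g:ℝ)^4*g^ℓ*g^m := by gcongr
  have o1 : (1:ℝ) ≤ (g:ℝ)^ℓ := one_le_pow₀ (by linarith)
  have o2 : (1:ℝ) ≤ (g:ℝ)^m := one_le_pow₀ (by linarith)
  have qV1 : (q:ℝ) ≤ 7*(g:ℝ)^4 := by linarith
  have qV2 : (q:ℝ) ≤ 7*(g:ℝ)^4*g^ℓ := qV1.trans (le_mul_of_one_le_right (by positivity) o1)
  have qV3 : (q:ℝ) ≤ 7*(g:ℝ)^4*g^ℓ*g^m := qV2.trans (le_mul_of_one_le_right (by positivity) o2)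
  have hαpos : 0 < α := by linarith
  have hkb : (k:ℝ)*0.37 ≤ 4*t*b+14 := by
    have ha := (a1_lt hα (Real.exp_log hαpos)).2
    have hx : Real.exp (-(ℓ*b)) ≤ 1 := by
      rw [← Real.exp_zero]; apply Real.exp_le_exp.2
      have : 0 ≤ (ℓ:ℝ)*b := by positivity
      linarith
    have hy := (abs_le.1 Λ1).1
    have hz : Real.log ((D/q:ℝ)*(3*α-2)) ≤ 2 := by
      have hd : (D/q:ℝ) ≤ 1 := by
        rw [div_le_one (by positivity)]; exact_mod_cast hDq
      have : (D/q:ℝ)*(3*α-2) ≤ 1*3 := by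
        apply mul_le_mul hd (by linarith) (by linarith) (by norm_num)
      have h0 : 0 < (D/q:ℝ)*(3*α-2) := mul_pos (by positivity) (by linarith)
      linarith [Real.log_le_sub_one_of_pos h0]
    push_cast at hy
    have hw : (k:ℝ)*0.37 ≤ k*Real.log α := by gcongr
    have hS : ((ℓ:ℝ)+m+n+t)*b ≤ (4*t)*b := by
      gcongr; linarith
    linarith
  obtain ⟨K, hK⟩ : ∃ K, K = 6.1e13*(b*L) := ⟨_, rfl⟩
  have hK0 : 0 ≤ K := by rw [hK]; positivity
  have hK1 : 1+K ≤ 6.2e13*(b*L) := by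
    have : 0.69*36 ≤ b*L := mul_le_mul hb1 hL36 (by norm_num) hb0.le
    rw [hK]; norm_num at this ⊢; linarith only [this]
  have hX : (1+K)^2*H1 ≤ (6.2e13*(b*L))^2*(25*b^4) := by gcongr
  have hX1 : 1e9*((1+K)^2*H1) ≤ n := (mul_le_mul_of_nonneg_left hX (by norm_num)).trans hXn
  have hlt : (ℓ:ℝ)*b ≤ t*b := by gcongr; linarith
  have hmt : (m:ℝ)*b ≤ t*b := by gcongr; linarith
  have hn0 : (0:ℝ) ≤ n := by positivity
  have hm0 : (0:ℝ) ≤ m := by positivity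
  have hℓ0 : (0:ℝ) ≤ ℓ := by positivity
  have hlb0 : (0:ℝ) ≤ ℓ*b := by positivity
  have hmb0 : (0:ℝ) ≤ m*b := by positivity
  have htr0 : (0:ℝ) < t := by linarith
  -- first application
  have s1 : (ℓ:ℝ)*b ≤ K*H1 := by
    have := lfl_step hα G e g D q hG hG2 hgG hD1 hq1 (7*(g:ℝ)^4) qV1 pV1 k (ℓ+m+n+t) ℓ t (by rw [← hL]; exact hL36) htr0
      (by rw [← hb, hV1]
          apply fin_num2 hb1 hbt htbig hkb
          · push_cast; linarith only [hntr, hmnr, hℓmr, hn0, hm0, hℓ0]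
          · linarith only [hH1, h7, hlt, hmt, hlb0, hmb0, hb0])
      (by rw [hV1]; push_cast
          have : H1 ≤ (1+K)^2*H1 := le_mul_of_one_le_left hH10 (one_le_pow₀ (by linarith))
          norm_num at hX1 ⊢; linarith only [this, hX1, htr0, hn0, hm0, hℓ0])
      (by rw [← hb]; exact Λ1)
    rw [← hb, ← hL, hV1] at this
    rw [hK]; linarith only [this]
  have hH2 : H1 + ℓ*b ≤ (1+K)*H1 := by linarith
  have s2 : (m:ℝ)*b ≤ K*((1+K)*H1) := by
    have := lfl_step hα G e g (D*Aℓ) q hG hG2 hgG (Nat.mul_pos hD1 hAℓ) hq1 (7*(g:ℝ)^4*g^ℓ) qV2 pV2 k (m+n+t) m t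
      (by rw [← hL]; exact hL36) htr0
      (by rw [← hb, hV2]
          apply fin_num2 hb1 hbt htbig hkb
          · push_cast; linarith only [hntr, hmnr, hℓmr, hn0, hm0, hℓ0]
          · linarith only [hH1, h7, hlt, hmt, hlb0, hmb0, hb0])
      (by rw [hV2]; push_cast
          have : (1+K)*H1 ≤ (1+K)^2*H1 := by
            apply mul_le_mul_of_nonneg_right _ hH10
            exact le_self_pow₀ (by linarith) (by norm_num)
          norm_num at hX1 ⊢; linarith only [this, hX1, htr0, hn0, hm0, hℓ0, hH2])
      (by rw [← hb]; exact Λ2)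
    rw [← hb, ← hL, hV2] at this
    have h5 : K*(H1+ℓ*b) ≤ K*((1+K)*H1) := by gcongr
    refine le_trans ?_ h5
    rw [hK]; linarith only [this]
  have hH3 : H1 + ℓ*b + m*b ≤ (1+K)^2*H1 := by
    have : (1+K)^2*H1 = (1+K)*H1 + K*((1+K)*H1) := by ring
    linarith only [this, hH2, s2]
  have s3 : (n:ℝ)*b ≤ K*((1+K)^2*H1) := by
    have := lfl_step hα G e g (D*Aℓ*Am) q hG hG2 hgG (Nat.mul_pos (Nat.mul_pos hD1 hAℓ) hAm) hq1 (7*(g:ℝ)^4*g^ℓ*g^m)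
      qV3 pV3 k (n+t) n t
      (by rw [← hL]; exact hL36) htr0
      (by rw [← hb, hV3]
          apply fin_num2 hb1 hbt htbig hkb
          · push_cast; linarith only [hntr, hmnr, hℓmr, hn0, hm0, hℓ0]
          · linarith only [hH1, h7, hlt, hmt, hlb0, hmb0, hb0])
      (by rw [hV3]; push_cast
          norm_num at hX1 ⊢; linarith only [hX1, htr0, hn0, hH3])
      (by rw [← hb]; exact Λ3)
    rw [← hb, ← hL, hV3] at this
    have h5 : K*(H1+ℓ*b+m*b) ≤ K*((1+K)^2*H1) := by gcongr
    refine le_trans ?_ h5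
    rw [hK]; linarith only [this]
  have f1 : (n:ℝ)*b ≤ (6.2e13*(b*L))*((6.2e13*(b*L))^2*(25*b^4)) := by
    refine s3.trans ?_
    have hKK : K ≤ 6.2e13*(b*L) := by linarith only [hK1]
    have h00 : 0 ≤ (1+K)^2*H1 := by positivity
    exact mul_le_mul hKK hX h00 (by linarith only [hKK, hK0])
  have f2 : 9.72e42*L^3*b^6*b ≤ n*b := by gcongr
  have f3 : 0 < L^3*b^7 := by positivity
  have f4 : (6.2e13*(b*L))*((6.2e13*(b*L))^2*(25*b^4)) = (6.2e13^3*25)*(L^3*b^7) := by ring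
  have f5 : 9.72e42*L^3*b^6*b = 9.72e42*(L^3*b^7) := by ring
  rw [f4] at f1
  rw [f5] at f2
  norm_num at f1 f2
  linarith only [f1, f2, f3]
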